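/- arXiv:2510.12520 — 3 statements merged into one kernel-verified Lean document; each statement's English description precedes it below -/
import Mathlib

section
/- Let r ≥ 1 and let λ be the left regular representation of the free group F_r on generators g_1,…,g_r, acting on ℓ²(F_r). Then the operator norm of the self-adjoint operator λ(g_1) + λ(g_1)⁻¹ + ⋯ + λ(g_r) + λ(g_r)⁻¹ (equivalently, of the adjacency operator of the infinite 2r-regular tree) equals 2·√(2r−1). -/
/-!
Statement 0 (Kesten): for the left regular representation `λ` of the free group `F_r`
on `ℓ²(F_r)`, the norm of `λ(g₁) + λ(g₁⁻¹) + ⋯ + λ(g_r) + λ(g_r⁻¹)` equals `2√(2r-1)`.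
-/

noncomputable section

namespace SC

open scoped ENNReal

/-- The Hilbert space `ℓ²(G)`. -/
abbrev l2 (G : Type*) := lp (fun _ : G => ℂ) 2

variable {G : Type*} [Group G]

theorem memℓp_comp_equiv {f : G → ℂ} (hf : Memℓp f 2) (e : G ≃ G) :
    Memℓp (fun w => f (e w)) 2 := by
  refine memℓp_gen ?_
  exact (e.summable_iff (f := fun i => ‖f i‖ ^ (2 : ℝ≥0∞).toReal)).2 (hf.summable (by norm_num))

/-- Left translation by `g` as a linear isometry of `ℓ²(G)`:  `(λ(g) f)(w) = f (g⁻¹ w)`. -/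
def transL (g : G) : l2 G ≃ₗᵢ[ℂ] l2 G where
  toLinearEquiv :=
    { toFun := fun f => ⟨fun w => f (g⁻¹ * w), memℓp_comp_equiv (lp.memℓp f) (Equiv.mulLeft g⁻¹)⟩
      invFun := fun f => ⟨fun w => f (g * w), memℓp_comp_equiv (lp.memℓp f) (Equiv.mulLeft g)⟩
      map_add' := fun f₁ f₂ => rfl
      map_smul' := fun c f => rfl
      left_inv := fun f => lp.ext (funext fun w => congrArg f (by group))
      right_inv := fun f => lp.ext (funext fun w => congrArg f (by group)) }
  norm_map' := by
    intro f
    have hp : 0 < (2 : ℝ≥0∞).toReal := by norm_num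
    rw [lp.norm_eq_tsum_rpow hp, lp.norm_eq_tsum_rpow hp f]
    congr 1
    exact (Equiv.mulLeft g⁻¹).tsum_eq (fun w => ‖f w‖ ^ (2 : ℝ≥0∞).toReal)

/-- The left regular representation of `G` on `ℓ²(G)`: `g ↦ λ(g)`, a unitary (isometric)
bounded operator on `ℓ²(G)`, with `λ(g) δ_w = δ_{g w}`. -/
def lregHom (G : Type*) [Group G] : G →* (l2 G →L[ℂ] l2 G) where
  toFun g := (transL g).toLinearIsometry.toContinuousLinearMap
  map_one' := by
    refine ContinuousLinearMap.ext fun f => lp.ext (funext fun w => congrArg f ?_)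
    group
  map_mul' g h := by
    refine ContinuousLinearMap.ext fun f => lp.ext (funext fun w => congrArg f ?_)
    group

end SC

open SC

namespace SC

open scoped ENNReal InnerProductSpace

section FreeGroup

variable {α : Type*}

/-- Left multiplication by a letter changes the word length by `+1`, unless the letter cancels the
first letter of the word, in which case it changes by `-1`. -/
theorem norm_mk_singleton_mul [DecidableEq α] (s : α × Bool) (w : FreeGroup α) :
    (FreeGroup.mk [s] * w).norm =
      if w.toWord.head? = some (s.1, !s.2) then w.norm - 1 else w.norm + 1 := by
  have h : (FreeGroup.mk [s] * w).toWord = FreeGroup.reduce (s :: w.toWord) := by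
    conv_lhs => rw [← FreeGroup.mk_toWord (x := w)]
    rw [FreeGroup.mul_mk, FreeGroup.toWord_mk, List.singleton_append]
  rw [FreeGroup.norm, h, FreeGroup.reduce.cons, FreeGroup.reduce_toWord, FreeGroup.norm]
  obtain ⟨a, b⟩ := s
  rcases w.toWord with _ | ⟨⟨c, d⟩, L⟩
  · simp
  · have : (a = c ∧ b = !d) ↔ (c = a ∧ d = !b) := by
      constructor <;> rintro ⟨rfl, rfl⟩ <;> simp
    by_cases hc : c = a ∧ d = !b
    · simp [hc]
    · simp [this, hc]

variable [Fintype α]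

theorem sum_norm_mk_singleton_mul_one [DecidableEq α] (φ : ℕ → ℝ) :
    ∑ s : α × Bool, φ (FreeGroup.mk [s] * (1 : FreeGroup α)).norm =
      2 * Fintype.card α * φ 1 := by
  simp only [norm_mk_singleton_mul]
  simp [mul_comm]

theorem sum_norm_mk_singleton_mul [DecidableEq α] (φ : ℕ → ℝ) {w : FreeGroup α} (hw : w ≠ 1) :
    ∑ s : α × Bool, φ (FreeGroup.mk [s] * w).norm =
      φ (w.norm - 1) + (2 * Fintype.card α - 1) * φ (w.norm + 1) := by
  obtain ⟨⟨c, d⟩, L, hL⟩ : ∃ x L, w.toWord = x :: L :=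
    List.exists_cons_of_ne_nil (by simpa using hw)
  have h (s : α × Bool) : φ (FreeGroup.mk [s] * w).norm =
      φ (w.norm + 1) + if s = (c, !d) then φ (w.norm - 1) - φ (w.norm + 1) else 0 := by
    have : w.toWord.head? = some (s.1, !s.2) ↔ s = (c, !d) := by
      obtain ⟨a, b⟩ := s
      simp only [hL, List.head?_cons, Option.some.injEq, Prod.mk.injEq]
      constructor <;> rintro ⟨rfl, rfl⟩ <;> simp
    simp only [norm_mk_singleton_mul, this]
    by_cases hs : s = (c, !d) <;> simp [hs]
  simp only [h, Finset.sum_add_distrib, Finset.sum_ite_eq', Finset.mem_univ, if_true]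
  simp
  ring

theorem sum_inv_mk_singleton_mul {M : Type*} [AddCommMonoid M] (φ : FreeGroup α → M)
    (w : FreeGroup α) :
    ∑ s : α × Bool, φ ((FreeGroup.mk [s])⁻¹ * w) = ∑ s : α × Bool, φ (FreeGroup.mk [s] * w) := by
  simp [Fintype.sum_prod_type, FreeGroup.inv_mk, FreeGroup.invRev, add_comm]

end FreeGroup

section LowerBound

variable {E : Type*} [NormedAddCommGroup E] [InnerProductSpace ℂ E]

/-- A symmetric operator acting on an orthogonal sequence as `t` times the sum of the two
shifts has norm at least `2 * t`. -/
theorem two_mul_le_opNorm_of_shift (T : E →L[ℂ] E) (hT : ∀ x y, ⟪T x, y⟫_ℂ = ⟪x, T y⟫_ℂ)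
    (e : ℕ → E) (he : ∀ i j, i ≠ j → ⟪e i, e j⟫_ℂ = 0) (h1 : e 1 ≠ 0) {t : ℝ} (ht : 0 < t)
    (hTe : ∀ n, T (e (n + 1)) = (t : ℂ) • (e (n + 2) + e n)) : 2 * t ≤ ‖T‖ := by
  have htC : (t : ℂ) ≠ 0 := by exact_mod_cast ht.ne'
  have hsucc (n : ℕ) : ‖e (n + 2)‖ = ‖e (n + 1)‖ := by
    have h := hT (e (n + 1)) (e (n + 2))
    rw [hTe, hTe (n + 1), inner_smul_left, inner_smul_right, inner_add_left, inner_add_right,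
      he n (n + 2) (by omega), he (n + 1) (n + 1 + 2) (by omega), add_zero, zero_add,
      Complex.conj_ofReal, inner_self_eq_norm_sq_to_K, inner_self_eq_norm_sq_to_K] at h
    have h' := mul_left_cancel₀ htC h
    have h'' : ‖e (n + 2)‖ ^ 2 = ‖e (n + 1)‖ ^ 2 := by exact_mod_cast h'
    exact (sq_eq_sq₀ (norm_nonneg _) (norm_nonneg _)).1 h''
  have hconst (n : ℕ) : ‖e (n + 1)‖ = ‖e 1‖ := by
    induction n with
    | zero => rfl
    | succ n ih => rw [hsucc, ih]
  set c := ‖e 1‖ with hc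
  have hcpos : 0 < c := norm_pos_iff.2 h1
  set f : ℕ → E := fun n => ∑ k ∈ Finset.range n, e (k + 1) with hf
  have hf_norm (n : ℕ) : ‖f n‖ ^ 2 = n * c ^ 2 := by
    induction n with
    | zero => simp [hf]
    | succ n ih =>
      have horth : ⟪f n, e (n + 1)⟫_ℂ = 0 := by
        rw [hf, sum_inner]
        refine Finset.sum_eq_zero fun k hk => he _ _ ?_
        have := Finset.mem_range.1 hk
        omega
      have hs : f (n + 1) = f n + e (n + 1) := Finset.sum_range_succ _ _
      have := norm_add_sq_eq_norm_sq_add_norm_sq_of_inner_eq_zero (f n) (e (n + 1)) horth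
      rw [hs, sq, this, ← sq, ← sq, ih, hconst]
      push_cast
      ring
  have hTf (n : ℕ) :
      T (f n) = (2 * t : ℂ) • f n + (t : ℂ) • (e (n + 1) + e 0 - e n - e 1) := by
    induction n with
    | zero => simp [hf]
    | succ n ih =>
      have hs : f (n + 1) = f n + e (n + 1) := Finset.sum_range_succ _ _
      rw [hs, map_add, ih, hTe]
      module
  set K := t * (c + ‖e 0‖ + (‖e 0‖ + c) + c) with hK
  have hbound (n : ℕ) : (2 * t - ‖T‖) * ‖f n‖ ≤ K := by
    have hen : ‖e n‖ ≤ ‖e 0‖ + c := by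
      cases n with
      | zero => linarith
      | succ n => rw [hconst]; linarith [norm_nonneg (e 0)]
    have hrest : ‖(t : ℂ) • (e (n + 1) + e 0 - e n - e 1)‖ ≤ K := by
      rw [norm_smul, Complex.norm_real, Real.norm_of_nonneg ht.le]
      refine mul_le_mul_of_nonneg_left ?_ ht.le
      have a1 := norm_sub_le (e (n + 1) + e 0 - e n) (e 1)
      have a2 := norm_sub_le (e (n + 1) + e 0) (e n)
      have a3 := norm_add_le (e (n + 1)) (e 0)
      have a4 := hconst n
      linarith
    have hmain : (2 * t : ℂ) • f n =
        T (f n) - (t : ℂ) • (e (n + 1) + e 0 - e n - e 1) := by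
      rw [hTf]; abel
    have hnorm : ‖(2 * t : ℂ) • f n‖ = 2 * t * ‖f n‖ := by
      rw [norm_smul, norm_mul, Complex.norm_real, Real.norm_of_nonneg ht.le]
      simp
    have b1 := norm_sub_le (T (f n)) ((t : ℂ) • (e (n + 1) + e 0 - e n - e 1))
    rw [← hmain, hnorm] at b1
    have b2 := T.le_opNorm (f n)
    linarith
  by_contra! hlt
  have hd : 0 < (2 * t - ‖T‖) * c := mul_pos (by linarith) hcpos
  obtain ⟨n, hn⟩ := exists_nat_gt (K ^ 2 / ((2 * t - ‖T‖) * c) ^ 2)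
  rw [div_lt_iff₀ (by positivity)] at hn
  have h2 := pow_le_pow_left₀ (mul_nonneg (by linarith) (norm_nonneg _)) (hbound n) 2
  rw [mul_pow, hf_norm] at h2
  nlinarith

end LowerBound

theorem lregHom_apply {G : Type*} [Group G] (g : G) (f : l2 G) (w : G) :
    lregHom G g f w = f (g⁻¹ * w) := rfl

theorem inner_lregHom_left {G : Type*} [Group G] (g : G) (x y : l2 G) :
    ⟪lregHom G g x, y⟫_ℂ = ⟪x, lregHom G g⁻¹ y⟫_ℂ := by
  have h : lregHom G g (lregHom G g⁻¹ y) = y := by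
    rw [← mul_apply_eq_comp, ← map_mul, mul_inv_cancel, map_one,
      one_apply_eq_self]
  conv_lhs => rw [← h]
  exact (transL g).inner_map_map x (lregHom G g⁻¹ y)

/-- The adjacency operator `∑ₖ (λ(gₖ) + λ(gₖ⁻¹))` of the `2r`-regular tree. -/
def adjacencyOp (r : ℕ) : l2 (FreeGroup (Fin r)) →L[ℂ] l2 (FreeGroup (Fin r)) :=
  ∑ k : Fin r,
    (lregHom (FreeGroup (Fin r)) (FreeGroup.of k) +
      lregHom (FreeGroup (Fin r)) (FreeGroup.of k)⁻¹)

theorem adjacencyOp_apply (r : ℕ) (f : l2 (FreeGroup (Fin r))) (w : FreeGroup (Fin r)) :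
    adjacencyOp r f w = ∑ s : Fin r × Bool, f (FreeGroup.mk [s] * w) := by
  rw [adjacencyOp, sum_apply, lp.coeFn_sum, Finset.sum_apply,
    Fintype.sum_prod_type]
  refine Finset.sum_congr rfl fun k _ => ?_
  rw [add_apply, lp.coeFn_add, Pi.add_apply, lregHom_apply, lregHom_apply,
    inv_inv, Fintype.sum_bool, add_comm]
  simp [FreeGroup.of, FreeGroup.inv_mk, FreeGroup.invRev]

theorem inner_adjacencyOp_left (r : ℕ) (x y : l2 (FreeGroup (Fin r))) :
    ⟪adjacencyOp r x, y⟫_ℂ = ⟪x, adjacencyOp r y⟫_ℂ := by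
  simp only [adjacencyOp, sum_apply, add_apply,
    sum_inner, inner_sum, inner_add_left, inner_add_right, inner_lregHom_left, inv_inv]
  exact Finset.sum_congr rfl fun k _ => add_comm _ _

/-- The indicator function of the sphere of radius `n` in the free group, times `c`. -/
def sphereVec (r n : ℕ) (c : ℝ) : l2 (FreeGroup (Fin r)) :=
  ⟨fun w => ((if w.norm = n then c else 0 : ℝ) : ℂ), by
    refine memℓp_gen (summable_of_hasFiniteSupport ?_)
    refine ((List.finite_length_eq (Fin r × Bool) n).preimage
      FreeGroup.toWord_injective.injOn).subset fun w hw => ?_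
    by_contra h
    refine hw ?_
    have h' : w.norm ≠ n := h
    simp [h']⟩

theorem sphereVec_apply (r n : ℕ) (c : ℝ) (w : FreeGroup (Fin r)) :
    sphereVec r n c w = ((if w.norm = n then c else 0 : ℝ) : ℂ) := rfl

theorem inner_sphereVec_of_ne (r : ℕ) {m n : ℕ} (h : m ≠ n) (c d : ℝ) :
    ⟪sphereVec r m c, sphereVec r n d⟫_ℂ = 0 := by
  rw [lp.inner_eq_tsum]
  refine (tsum_congr fun w => ?_).trans tsum_zero
  rw [sphereVec_apply, sphereVec_apply]
  by_cases hm : w.norm = m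
  · have : w.norm ≠ n := fun hn => h (hm.symm.trans hn)
    simp [this]
  · simp [hm]

theorem sphereVec_ne_zero {r : ℕ} (hr : 1 ≤ r) (n : ℕ) {c : ℝ} (hc : c ≠ 0) :
    sphereVec r n c ≠ 0 := by
  intro h
  have hn : (FreeGroup.of (⟨0, hr⟩ : Fin r) ^ n).norm = n := by
    simp [FreeGroup.norm, FreeGroup.toWord_of_pow]
  have h' : sphereVec r n c (FreeGroup.of (⟨0, hr⟩ : Fin r) ^ n) = 0 := by rw [h]; rfl
  rw [sphereVec_apply, if_pos hn] at h'
  exact hc (Complex.ofReal_eq_zero.1 h')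

theorem adjacencyOp_sphereVec (r n : ℕ) {t : ℝ} (ht : 0 < t) (htr : t ^ 2 = 2 * r - 1) :
    adjacencyOp r (sphereVec r (n + 2) (t⁻¹ ^ (n + 2))) =
      (t : ℂ) • (sphereVec r (n + 3) (t⁻¹ ^ (n + 3)) + sphereVec r (n + 1) (t⁻¹ ^ (n + 1))) := by
  refine lp.ext (funext fun w => ?_)
  rw [adjacencyOp_apply, lp.coeFn_smul, Pi.smul_apply, lp.coeFn_add, Pi.add_apply, smul_eq_mul]
  simp only [sphereVec_apply]
  norm_cast
  by_cases hw : w = 1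
  · subst hw
    rw [sum_norm_mk_singleton_mul_one (fun m => if m = n + 2 then t⁻¹ ^ (n + 2) else 0)]
    simp
  · rw [sum_norm_mk_singleton_mul (fun m => if m = n + 2 then t⁻¹ ^ (n + 2) else 0) hw,
      Fintype.card_fin, ← htr]
    have hpos : w.norm ≠ 0 := by simpa [FreeGroup.norm_eq_zero] using hw
    by_cases h3 : w.norm = n + 3
    · simp [h3]
      field_simp
      ring
    · by_cases h1 : w.norm = n + 1
      · simp [h1]
        field_simp
        ring
      · have : w.norm - 1 ≠ n + 2 := by omega
        have : w.norm + 1 ≠ n + 2 := by omega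
        simp [*]

theorem sum_pow_norm_le {r : ℕ} (hr : 1 ≤ r) {t : ℝ} (ht : 0 < t) (htr : t ^ 2 = 2 * r - 1)
    (w : FreeGroup (Fin r)) :
    ∑ s : Fin r × Bool, t⁻¹ ^ (FreeGroup.mk [s] * w).norm ≤ 2 * t * t⁻¹ ^ w.norm := by
  have hr' : (1 : ℝ) ≤ r := by exact_mod_cast hr
  by_cases hw : w = 1
  · subst hw
    rw [sum_norm_mk_singleton_mul_one (fun m => t⁻¹ ^ m), Fintype.card_fin, FreeGroup.norm_one,
      pow_one, pow_zero, mul_one, ← div_eq_mul_inv, div_le_iff₀ ht]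
    nlinarith
  · rw [sum_norm_mk_singleton_mul (fun m => t⁻¹ ^ m) hw, Fintype.card_fin, ← htr]
    obtain ⟨m, hm⟩ := Nat.exists_eq_succ_of_ne_zero
      (show w.norm ≠ 0 by simpa [FreeGroup.norm_eq_zero] using hw)
    refine le_of_eq ?_
    rw [hm]
    simp only [Nat.succ_eq_add_one, Nat.add_sub_cancel, inv_pow]
    field_simp
    ring

theorem norm_adjacencyOp_le {r : ℕ} (hr : 1 ≤ r) {t : ℝ} (ht : 0 < t)
    (htr : t ^ 2 = 2 * r - 1) : ‖adjacencyOp r‖ ≤ 2 * t := by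
  refine ContinuousLinearMap.opNorm_le_bound _ (by positivity) fun f => ?_
  have h2 : (2 : ℝ≥0∞).toReal = 2 := by norm_num
  set h : FreeGroup (Fin r) → ℝ := fun w => t⁻¹ ^ w.norm with hh
  have hpos (w) : 0 < h w := by positivity
  have hsum (w) : ∑ s : Fin r × Bool, h (FreeGroup.mk [s] * w) ≤ 2 * t * h w :=
    sum_pow_norm_le hr ht htr w
  have hf : HasSum (fun w => ‖f w‖ ^ 2) (‖f‖ ^ 2) := by
    simpa [h2] using lp.hasSum_norm (p := 2) (by norm_num) f
  set F : Fin r × Bool → FreeGroup (Fin r) → ℝ :=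
    fun s v => 2 * t * h ((FreeGroup.mk [s])⁻¹ * v) / h v * ‖f v‖ ^ 2 with hF
  have hF0 (s v) : 0 ≤ F s v := by
    have := hpos v
    have := hpos ((FreeGroup.mk [s])⁻¹ * v)
    positivity
  have hFsum (v) : ∑ s, F s v ≤ (2 * t) ^ 2 * ‖f v‖ ^ 2 := by
    rw [← Finset.sum_mul, ← Finset.sum_div, ← Finset.mul_sum, sum_inv_mk_singleton_mul]
    refine mul_le_mul_of_nonneg_right ?_ (by positivity)
    rw [div_le_iff₀ (hpos v)]
    nlinarith [mul_le_mul_of_nonneg_left (hsum v) (by positivity : 0 ≤ 2 * t)]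
  have hFs (s) : Summable (F s) :=
    Summable.of_nonneg_of_le (hF0 s)
      (fun v => (Finset.single_le_sum (fun s _ => hF0 s v) (Finset.mem_univ s)).trans (hFsum v))
      (hf.summable.mul_left _)
  have hpt (w) : ‖adjacencyOp r f w‖ ^ 2 ≤ ∑ s, F s (FreeGroup.mk [s] * w) := by
    have hS : 0 ≤ ∑ s : Fin r × Bool,
        ‖f (FreeGroup.mk [s] * w)‖ ^ 2 / h (FreeGroup.mk [s] * w) :=
      Finset.sum_nonneg fun s _ => div_nonneg (sq_nonneg _) (hpos _).le
    calc ‖adjacencyOp r f w‖ ^ 2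
        ≤ (∑ s : Fin r × Bool, ‖f (FreeGroup.mk [s] * w)‖) ^ 2 := by
          rw [adjacencyOp_apply]
          exact pow_le_pow_left₀ (norm_nonneg _) (norm_sum_le _ _) 2
      _ ≤ (∑ s : Fin r × Bool, h (FreeGroup.mk [s] * w)) *
            ∑ s : Fin r × Bool, ‖f (FreeGroup.mk [s] * w)‖ ^ 2 / h (FreeGroup.mk [s] * w) :=
          Finset.sum_sq_le_sum_mul_sum_of_sq_le_mul _ (fun s _ => (hpos _).le)
            (fun s _ => div_nonneg (sq_nonneg _) (hpos _).le)
            (fun s _ => (mul_div_cancel₀ _ (hpos _).ne').ge)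
      _ ≤ (2 * t * h w) *
            ∑ s : Fin r × Bool, ‖f (FreeGroup.mk [s] * w)‖ ^ 2 / h (FreeGroup.mk [s] * w) :=
          mul_le_mul_of_nonneg_right (hsum w) hS
      _ = ∑ s, F s (FreeGroup.mk [s] * w) := by
          rw [Finset.mul_sum]
          refine Finset.sum_congr rfl fun s _ => ?_
          simp only [hF, inv_mul_cancel_left]
          ring
  have hTf : HasSum (fun w => ‖adjacencyOp r f w‖ ^ 2) (‖adjacencyOp r f‖ ^ 2) := by
    simpa [h2] using lp.hasSum_norm (p := 2) (by norm_num) (adjacencyOp r f)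
  have hshift : HasSum (fun w => ∑ s, F s (FreeGroup.mk [s] * w)) (∑ s, ∑' v, F s v) :=
    hasSum_sum fun s _ =>
      (Equiv.mulLeft (FreeGroup.mk [s])).hasSum_iff.2 (hFs s).hasSum
  have h3 := hasSum_le hpt hTf hshift
  have h4 := hasSum_le hFsum (hasSum_sum fun s _ => (hFs s).hasSum) (hf.mul_left _)
  refine pow_le_pow_iff_left₀ (norm_nonneg _) (by positivity) two_ne_zero |>.1 ?_
  rw [mul_pow _ ‖f‖]
  exact h3.trans h4

end SC

/-- **Kesten's theorem.**  The operator norm of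
`λ(g₁) + λ(g₁⁻¹) + ⋯ + λ(g_r) + λ(g_r⁻¹)` on `ℓ²(F_r)`, i.e. of the adjacency operator of the
infinite `2r`-regular tree, equals `2·√(2r−1)`. -/
theorem kesten_norm_free_group (r : ℕ) (hr : 1 ≤ r) :
    ‖∑ k : Fin r,
        (lregHom (FreeGroup (Fin r)) (FreeGroup.of k) +
          lregHom (FreeGroup (Fin r)) (FreeGroup.of k)⁻¹)‖ =
      2 * Real.sqrt (2 * r - 1) := by
  have hr' : (1 : ℝ) ≤ r := by exact_mod_cast hr
  have hq : (0 : ℝ) < 2 * r - 1 := by linarith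
  have ht : 0 < Real.sqrt (2 * r - 1) := Real.sqrt_pos.2 hq
  have htr : Real.sqrt (2 * r - 1) ^ 2 = 2 * r - 1 := Real.sq_sqrt hq.le
  set t := Real.sqrt (2 * r - 1)
  refine le_antisymm (norm_adjacencyOp_le hr ht htr) ?_
  exact two_mul_le_opNorm_of_shift (adjacencyOp r) (inner_adjacencyOp_left r)
    (fun n => sphereVec r (n + 1) (t⁻¹ ^ (n + 1)))
    (fun i j hij => inner_sphereVec_of_ne r (by omega) _ _)
    (sphereVec_ne_zero hr _ (by positivity)) ht
    (fun n => adjacencyOp_sphereVec r n ht htr)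
end
end

section
/- (Alon–Boppana) Fix d ≥ 3. For every ε > 0 there exists N₀ such that every finite simple d-regular graph G on N ≥ N₀ vertices, with adjacency matrix A, satisfies ‖A|_{1⊥}‖ ≥ 2·√(d−1) − ε. -/
/-!
Statement 5 (Alon–Boppana): fix `d ≥ 3`.  For every `ε > 0` there exists `N₀` such that every
finite simple `d`-regular graph on `N ≥ N₀` vertices with adjacency matrix `A` satisfies
`‖A|_{1⊥}‖ ≥ 2√(d−1) − ε`, where `‖A|_{1⊥}‖` is the supremum of `‖Av‖₂/‖v‖₂` over nonzero
vectors `v` with `∑ᵢ vᵢ = 0`.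
-/

noncomputable section

/-- The operator norm of (the restriction of) a real matrix on the orthogonal complement of the
all-ones vector: the supremum of `‖Av‖₂ / ‖v‖₂` over nonzero `v` with `∑ i, v i = 0`. -/
def restNormR {n : Type*} [Fintype n] [DecidableEq n] (A : Matrix n n ℝ) : ℝ :=
  sSup {c : ℝ | ∃ v : EuclideanSpace ℝ n, v ≠ 0 ∧ (∑ i, v i) = 0 ∧
    c = ‖Matrix.toEuclideanLin A v‖ / ‖v‖}

open Finset in
/-- A vector of sum zero whose Rayleigh quotient is at least `l` bounds `restNormR` below. -/
theorem le_restNormR {n : Type*} [Fintype n] [DecidableEq n] (A : Matrix n n ℝ) (l : ℝ)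
    (u : n → ℝ) (hu : u ≠ 0) (hsum : ∑ i, u i = 0)
    (h : ∀ i, l * u i ^ 2 ≤ u i * A.mulVec u i) : l ≤ restNormR A := by
  set v : EuclideanSpace ℝ n := WithLp.toLp 2 u with hv
  have hv0 : v ≠ 0 := fun h0 => hu (by simpa [hv] using h0)
  have hpos : 0 < ‖v‖ := norm_pos_iff.mpr hv0
  have hray : l * ‖v‖ ^ 2 ≤ ‖Matrix.toEuclideanLin A v‖ * ‖v‖ := by
    refine le_trans ?_ (real_inner_le_norm _ _)
    rw [EuclideanSpace.norm_sq_eq, mul_sum, PiLp.inner_apply]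
    refine sum_le_sum fun i _ => ?_
    simpa [hv] using h i
  refine le_trans ?_ (le_csSup ?_ ⟨v, hv0, by simpa [hv] using hsum, rfl⟩)
  · rw [le_div_iff₀ hpos]
    nlinarith
  · refine ⟨‖(Matrix.toEuclideanLin A).toContinuousLinearMap‖, ?_⟩
    rintro c ⟨w, -, -, rfl⟩
    exact (Matrix.toEuclideanLin A).toContinuousLinearMap.ratio_le_opNorm w

open Finset in
/-- Two nonnegative vectors that are `l`-superharmonic for `A` and do not interact through `A`
combine to a vector of sum zero with Rayleigh quotient at least `l`. -/
theorem le_restNormR_of_separated {n : Type*} [Fintype n] [DecidableEq n] (A : Matrix n n ℝ)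
    (l : ℝ) (f g : n → ℝ) (hf : 0 ≤ f) (hg : 0 ≤ g) (hf0 : f ≠ 0) (hg0 : g ≠ 0)
    (hAf : ∀ i, l * f i ≤ A.mulVec f i) (hAg : ∀ i, l * g i ≤ A.mulVec g i)
    (hfg : ∀ i, f i ≠ 0 → g i = 0 ∧ A.mulVec g i = 0)
    (hgf : ∀ i, g i ≠ 0 → f i = 0 ∧ A.mulVec f i = 0) : l ≤ restNormR A := by
  have sum_pos_of {h : n → ℝ} (hh : 0 ≤ h) (hh0 : h ≠ 0) : 0 < ∑ i, h i :=
    Fintype.sum_pos (lt_of_le_of_ne hh (Ne.symm hh0))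
  have ha := sum_pos_of hg hg0
  set a := ∑ i, g i
  set b := ∑ i, f i
  refine le_restNormR A l (a • f - b • g) ?_ ?_ fun i => ?_
  · obtain ⟨i, hi⟩ := Function.ne_iff.mp hf0
    refine Function.ne_iff.mpr ⟨i, ?_⟩
    simpa [(hfg i hi).1] using ⟨ha.ne', hi⟩
  · simp only [Pi.sub_apply, Pi.smul_apply, smul_eq_mul, sum_sub_distrib, ← mul_sum]
    ring
  · simp only [Matrix.mulVec_sub, Matrix.mulVec_smul, Pi.sub_apply, Pi.smul_apply, smul_eq_mul]
    by_cases hi : f i = 0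
    · by_cases hj : g i = 0
      · simp [hi, hj]
      · rw [hi, (hgf i hj).2]
        nlinarith [mul_le_mul_of_nonneg_left (hAg i) (mul_nonneg (sq_nonneg b) (hg i))]
    · rw [(hfg i hi).1, (hfg i hi).2]
      nlinarith [mul_le_mul_of_nonneg_left (hAf i) (mul_nonneg (sq_nonneg a) (hf i))]

/-- The radial solution on the `(q + 1)`-regular tree of the eigenvalue equation for `l`. -/
def treeRadial (q l : ℝ) : ℕ → ℝ
  | 0 => 1
  | 1 => l / (q + 1)
  | n + 2 => (l * treeRadial q l (n + 1) - treeRadial q l n) / q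

/-- Below the spectral radius of the tree the radial solution cannot stay positive. -/
theorem exists_treeRadial_nonpos (s ε : ℝ) (hs : 0 < s) (hε : 0 < ε) :
    ∃ n, treeRadial (s ^ 2) (2 * s - ε) n ≤ 0 := by
  by_contra! hpos
  set a := treeRadial (s ^ 2) (2 * s - ε)
  have hstep (n : ℕ) : a (n + 2) / a (n + 1) ≤ a (n + 1) / a n - ε / s ^ 2 := by
    have h0 := hpos n
    have h1 := hpos (n + 1)
    have h2 : a (n + 2) = ((2 * s - ε) * a (n + 1) - a n) / s ^ 2 := rfl
    have key : a (n + 1) / a n - ε / s ^ 2 - a (n + 2) / a (n + 1)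
        = (s * a (n + 1) - a n) ^ 2 / (s ^ 2 * a n * a (n + 1)) := by
      rw [h2]
      field_simp
      ring
    have : 0 ≤ (s * a (n + 1) - a n) ^ 2 / (s ^ 2 * a n * a (n + 1)) := by positivity
    linarith
  have hlin (n : ℕ) : a (n + 1) / a n ≤ a 1 / a 0 - n * (ε / s ^ 2) := by
    induction n with
    | zero => simp
    | succ n ih =>
      push_cast
      linarith [hstep n]
  obtain ⟨n, hn⟩ := exists_nat_gt ((a 1 / a 0) / (ε / s ^ 2))
  rw [div_lt_iff₀ (by positivity)] at hn
  linarith [hlin n, div_pos (hpos (n + 1)) (hpos n)]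

/-- A finitely supported, nonincreasing radial profile which is superharmonic on the
`(s ^ 2 + 1)`-regular tree for the value `2 * s - ε`. -/
theorem exists_radial_profile (s ε : ℝ) (hs : 0 < s) (hε : 0 < ε) :
    ∃ (k : ℕ) (g : ℕ → ℝ), 0 < g 0 ∧ (∀ n, 0 ≤ g n) ∧ Antitone g ∧ (∀ n, k < n → g n = 0) ∧
      (2 * s - ε) * g 0 ≤ (s ^ 2 + 1) * g 1 ∧
      ∀ n, (2 * s - ε) * g (n + 1) ≤ g n + s ^ 2 * g (n + 2) := by
  classical
  have hex := exists_treeRadial_nonpos s ε hs hε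
  set l := 2 * s - ε
  set a := treeRadial (s ^ 2) l
  set m := Nat.find hex
  have hmle : a m ≤ 0 := Nat.find_spec hex
  have hlt {n : ℕ} (h : n < m) : 0 < a n := not_le.mp (Nat.find_min hex h)
  have h0 : a 0 = 1 := rfl
  have h1 : (s ^ 2 + 1) * a 1 = l := by
    change (s ^ 2 + 1) * (l / (s ^ 2 + 1)) = l
    field_simp
  have h2 (n : ℕ) : s ^ 2 * a (n + 2) = l * a (n + 1) - a n := by
    change s ^ 2 * ((l * a (n + 1) - a n) / s ^ 2) = _
    field_simp
  have hs2 : 0 < s ^ 2 := by positivity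
  have hm0 : 0 < m := by
    by_contra! h
    rw [Nat.le_zero.mp h, h0] at hmle
    linarith
  have hanti (n : ℕ) (h : n < m) : a (n + 1) ≤ a n := by
    induction n with
    | zero => nlinarith [sq_nonneg (s - 1)]
    | succ n ih =>
      have := ih (by omega)
      nlinarith [h2 n, hlt h, sq_nonneg (s - 1)]
  refine ⟨m, fun n => if n < m then a n else 0, by simp [hm0, h0], fun n => ?_,
    antitone_nat_of_succ_le fun n => ?_, fun n hn => if_neg (by omega), ?_, fun n => ?_⟩
  · dsimp only
    split_ifs with h
    exacts [(hlt h).le, le_rfl]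
  · split_ifs with h h' h'
    · exact hanti n h'
    · omega
    · exact (hlt h').le
    · exact le_rfl
  · dsimp only
    rw [if_pos hm0, h0]
    split_ifs with h
    · linarith
    · rw [show m = 1 by omega] at hmle
      nlinarith
  · dsimp only
    by_cases h : n + 1 < m
    · rw [if_pos h, if_pos (by omega : n < m)]
      split_ifs with h'
      · linarith [h2 n]
      · rw [show m = n + 2 by omega] at hmle
        nlinarith [h2 n]
    · rw [if_neg h, if_neg (by omega : ¬ n + 2 < m)]
      split_ifs with h'
      · linarith [hlt h']
      · simp

namespace SimpleGraph

variable {V : Type*}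

open Classical in
/-- The radial function around `x` with profile `g`, extended by zero outside the component. -/
def radial (G : SimpleGraph V) (g : ℕ → ℝ) (x v : V) : ℝ :=
  if G.Reachable x v then g (G.dist x v) else 0

theorem radial_nonneg (G : SimpleGraph V) {g : ℕ → ℝ} (hg : ∀ n, 0 ≤ g n) (x v : V) :
    0 ≤ G.radial g x v := by
  unfold radial
  split_ifs
  exacts [hg _, le_rfl]

theorem exists_walk_of_radial_ne_zero (G : SimpleGraph V) {g : ℕ → ℝ} {k : ℕ}
    (hg : ∀ n, k < n → g n = 0) {x v : V} (h : G.radial g x v ≠ 0) :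
    ∃ p : G.Walk x v, p.length ≤ k := by
  unfold radial at h
  split_ifs at h with hr
  · obtain ⟨p, hp⟩ := hr.exists_walk_length_eq_dist
    exact ⟨p, hp ▸ not_lt.mp fun hk => h (hg _ hk)⟩
  · exact absurd rfl h

theorem exists_adj_dist_succ_eq {G : SimpleGraph V} {x v : V} {n : ℕ} (hr : G.Reachable x v)
    (h : G.dist x v = n + 1) : ∃ w, G.Adj v w ∧ G.dist x w = n := by
  obtain ⟨p, hp⟩ := hr.symm.exists_walk_length_eq_dist
  rw [dist_comm, h] at hp
  cases p with
  | nil => simp at hp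
  | @cons _ w _ hvw p =>
    refine ⟨w, hvw, ?_⟩
    have h1 : G.dist x w ≤ n := by
      rw [dist_comm]
      exact (dist_le p).trans (by simpa using hp.le)
    have := Adj.diff_dist_adj (u := x) hvw
    omega

open Finset in
/-- Radial superharmonicity on the `d`-regular tree passes to every `d`-regular graph. -/
theorem radial_superharmonic [Fintype V] (G : SimpleGraph V) [DecidableRel G.Adj] {d : ℕ}
    (hG : G.IsRegularOfDegree d) {g : ℕ → ℝ} {l : ℝ} (hg : ∀ n, 0 ≤ g n) (hanti : Antitone g)
    (h0 : l * g 0 ≤ d * g 1) (hsucc : ∀ n, l * g (n + 1) ≤ g n + (d - 1) * g (n + 2))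
    (x v : V) : l * G.radial g x v ≤ (G.adjMatrix ℝ).mulVec (G.radial g x) v := by
  classical
  rw [adjMatrix_mulVec_apply]
  by_cases hr : G.Reachable x v
  swap
  · rw [radial, if_neg hr, mul_zero]
    exact sum_nonneg fun w _ => G.radial_nonneg hg x w
  have hval {w : V} (hw : G.Adj v w) : G.radial g x w = g (G.dist x w) :=
    if_pos (hr.trans hw.reachable)
  have hle {w : V} (hw : G.Adj v w) : g (G.dist x v + 1) ≤ G.radial g x w := by
    rw [hval hw]
    refine hanti ?_
    have := Adj.diff_dist_adj (u := x) hw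
    omega
  have hcard : #(G.neighborFinset v) = d := hG v
  rw [radial, if_pos hr]
  obtain hn | ⟨n, hn⟩ : G.dist x v = 0 ∨ ∃ n, G.dist x v = n + 1 := by
    cases G.dist x v <;> simp
  · rw [hn] at hle ⊢
    refine h0.trans ?_
    rw [← hcard, ← nsmul_eq_mul]
    exact card_nsmul_le_sum _ _ _ fun w hw => hle ((G.mem_neighborFinset v w).mp hw)
  · obtain ⟨w₀, hw₀, hd₀⟩ := exists_adj_dist_succ_eq hr hn
    have hmem : w₀ ∈ G.neighborFinset v := (G.mem_neighborFinset v w₀).mpr hw₀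
    rw [hn] at hle ⊢
    refine (hsucc n).trans ?_
    rw [← add_sum_erase _ _ hmem, hval hw₀, hd₀]
    gcongr
    have hc : ((#((G.neighborFinset v).erase w₀) : ℕ) : ℝ) = d - 1 := by
      rw [← hcard, ← card_erase_add_one hmem]
      simp
    rw [← hc, ← nsmul_eq_mul]
    exact card_nsmul_le_sum _ _ _ fun w hw =>
      hle ((G.mem_neighborFinset v w).mp (mem_of_mem_erase hw))

open Finset in
/-- In a `d`-regular graph at most `(d + 1) ^ r` vertices are ends of walks of length at most `r`
from a given vertex. -/
theorem exists_finset_card_le_pow [Fintype V] (G : SimpleGraph V) [DecidableRel G.Adj] {d : ℕ}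
    (hG : G.IsRegularOfDegree d) (r : ℕ) (x : V) :
    ∃ B : Finset V, #B ≤ (d + 1) ^ r ∧ ∀ v, ∀ p : G.Walk x v, p.length ≤ r → v ∈ B := by
  classical
  induction r generalizing x with
  | zero =>
    refine ⟨{x}, by simp, fun v p hp => ?_⟩
    cases p with
    | nil => simp
    | cons _ _ => simp at hp
  | succ r ih =>
    choose B hB hmem using ih
    refine ⟨insert x ((G.neighborFinset x).biUnion B), ?_, fun v p hp => ?_⟩
    · have h1 := card_biUnion_le_card_mul (G.neighborFinset x) B _ fun w _ => hB w
      rw [G.card_neighborFinset_eq_degree, hG x] at h1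
      have h2 : 1 ≤ (d + 1) ^ r := Nat.one_le_pow _ _ (by omega)
      calc _ ≤ #((G.neighborFinset x).biUnion B) + 1 := card_insert_le _ _
        _ ≤ d * (d + 1) ^ r + (d + 1) ^ r := by omega
        _ = (d + 1) ^ (r + 1) := by ring
    · cases p with
      | nil => simp
      | @cons _ w _ hw p =>
        refine mem_insert_of_mem (mem_biUnion.mpr ⟨w, by simpa using hw, hmem w v p ?_⟩)
        simpa using hp

/-- Radial functions of radius `k` around vertices not joined by a walk of length at most
`2 * k + 1` do not interact through the adjacency matrix. -/
theorem radial_separated [Fintype V] (G : SimpleGraph V) [DecidableRel G.Adj] {g : ℕ → ℝ} {k : ℕ}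
    (hg : ∀ n, k < n → g n = 0) {x y : V} (hxy : ∀ p : G.Walk x y, 2 * k + 1 < p.length) {v : V}
    (hv : G.radial g x v ≠ 0) :
    G.radial g y v = 0 ∧ (G.adjMatrix ℝ).mulVec (G.radial g y) v = 0 := by
  obtain ⟨p, hp⟩ := G.exists_walk_of_radial_ne_zero hg hv
  constructor
  · by_contra h
    obtain ⟨q, hq⟩ := G.exists_walk_of_radial_ne_zero hg h
    have := hxy (p.append q.reverse)
    rw [Walk.length_append, Walk.length_reverse] at this
    omega
  · rw [adjMatrix_mulVec_apply]
    refine Finset.sum_eq_zero fun w hw => ?_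
    by_contra h
    obtain ⟨q, hq⟩ := G.exists_walk_of_radial_ne_zero hg h
    have := hxy (p.append (Walk.cons ((G.mem_neighborFinset v w).mp hw) q.reverse))
    rw [Walk.length_append, Walk.length_cons, Walk.length_reverse] at this
    omega

end SimpleGraph

/-- **The Alon–Boppana bound.** -/
theorem alon_boppana (d : ℕ) (hd : 3 ≤ d) (ε : ℝ) (hε : 0 < ε) :
    ∃ N₀ : ℕ, ∀ N : ℕ, N₀ ≤ N → ∀ G : SimpleGraph (Fin N), ∀ _inst : DecidableRel G.Adj,
      G.IsRegularOfDegree d →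
      2 * Real.sqrt ((d : ℝ) - 1) - ε ≤ restNormR (G.adjMatrix ℝ) := by
  have hd1 : (0 : ℝ) < d - 1 := by
    have : (3 : ℝ) ≤ d := by exact_mod_cast hd
    linarith
  have hs := Real.sqrt_pos.mpr hd1
  have hs2 := Real.sq_sqrt hd1.le
  obtain ⟨k, g, g0, hg, hanti, hk, h0, hsucc⟩ := exists_radial_profile _ ε hs hε
  rw [hs2] at hsucc h0
  rw [sub_add_cancel] at h0
  refine ⟨(d + 1) ^ (2 * k + 1) + 1, fun N hN G _ hG => ?_⟩
  let x : Fin N := ⟨0, by omega⟩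
  obtain ⟨B, hB, hmem⟩ := G.exists_finset_card_le_pow hG (2 * k + 1) x
  obtain ⟨y, hy⟩ : ∃ y, y ∉ B := by
    by_contra! h
    rw [Finset.eq_univ_iff_forall.mpr h, Finset.card_univ, Fintype.card_fin] at hB
    omega
  have hxy (p : G.Walk x y) : 2 * k + 1 < p.length := not_le.mp fun h => hy (hmem y p h)
  have hyx (p : G.Walk y x) : 2 * k + 1 < p.length := by simpa using hxy p.reverse
  have hne (z : Fin N) : G.radial g z ≠ 0 :=
    Function.ne_iff.mpr ⟨z, by simpa [SimpleGraph.radial] using g0.ne'⟩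
  exact le_restNormR_of_separated _ _ (G.radial g x) (G.radial g y) (G.radial_nonneg hg x)
    (G.radial_nonneg hg y) (hne x) (hne y) (G.radial_superharmonic hG hg hanti h0 hsucc x)
    (G.radial_superharmonic hG hg hanti h0 hsucc y) (fun _ => G.radial_separated hk hxy)
    (fun _ => G.radial_separated hk hyx)
end
end

section
/- (Friedman's theorem, permutation model) Fix r ≥ 1. For each N, let σ_1^N,…,σ_r^N be independent uniformly distributed random permutations of {1,…,N}, and let A^N = Σ_{k=1}^r (P_{σ_k^N} + P_{σ_k^N}ᵀ) be the adjacency matrix of the associated random 2r-regular multigraph. Then ‖A^N|_{1⊥}‖ converges in probability to 2·√(2r−1) as N → ∞. -/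
/-!
Statement 6 (Friedman's theorem, permutation model): for i.i.d. uniform random permutations
`σ₁,…,σ_r` of `{1,…,N}`, the matrix `A = ∑ₖ (P_{σₖ} + P_{σₖ}ᵀ)` (the adjacency matrix of the
random `2r`-regular multigraph) satisfies `‖A|_{1⊥}‖ → 2√(2r−1)` in probability as `N → ∞`.

The uniform distribution on the finite set of `r`-tuples of permutations is expressed by
counting: the probability of an event is the number of tuples realizing it divided by the total
number of tuples.
-/

noncomputable section

/-- The permutation matrix of `σ`, acting by `(P_σ x)_i = x_{σ⁻¹(i)}`. -/
def permMatR {N : ℕ} (σ : Equiv.Perm (Fin N)) : Matrix (Fin N) (Fin N) ℝ :=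
  Matrix.of fun i j => if σ j = i then 1 else 0

open Filter

section PolynomialInequalities

open Polynomial Chebyshev

lemma exists_chebyshev_expansion (q : ℕ) (p : ℝ[X]) (hp : p.natDegree ≤ q) :
    ∃ b : ℕ → ℝ, p = ∑ n ∈ Finset.range (q + 1), b n • T ℝ n := by
  induction q generalizing p with
  | zero =>
    refine ⟨fun _ => p.coeff 0, ?_⟩
    rw [Polynomial.eq_C_of_natDegree_le_zero hp]
    simp [Polynomial.smul_eq_C_mul]
  | succ q ih =>
    set c : ℝ := p.coeff (q + 1) / 2 ^ q with hc
    have hT : (T ℝ ((q + 1 : ℕ) : ℤ)).coeff (q + 1) = 2 ^ q := by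
      have h1 := leadingCoeff_T ℝ ((q + 1 : ℕ) : ℤ)
      have h2 := natDegree_T ℝ ((q + 1 : ℕ) : ℤ)
      rw [Polynomial.leadingCoeff, h2, Int.natAbs_natCast, Nat.add_sub_cancel] at h1
      exact h1
    have hd : (p - c • T ℝ ((q + 1 : ℕ) : ℤ)).natDegree ≤ q := by
      rw [Polynomial.natDegree_le_iff_coeff_eq_zero]
      intro m hm
      rcases eq_or_lt_of_le (Nat.succ_le_of_lt hm) with h | h
      · have h' : m = q + 1 := h.symm
        subst h'
        rw [Polynomial.coeff_sub, Polynomial.coeff_smul, hT, hc, smul_eq_mul]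
        field_simp
        ring
      · rw [Polynomial.coeff_sub, Polynomial.coeff_smul,
          Polynomial.coeff_eq_zero_of_natDegree_lt (lt_of_le_of_lt hp h),
          Polynomial.coeff_eq_zero_of_natDegree_lt (p := T ℝ _) (by
            rw [natDegree_T, Int.natAbs_natCast]; exact h)]
        simp
    obtain ⟨b, hb⟩ := ih _ hd
    refine ⟨fun n => if n = q + 1 then c else b n, ?_⟩
    rw [Finset.sum_range_succ]
    beta_reduce
    rw [if_pos rfl, eq_comm, ← eq_sub_iff_add_eq, hb]
    refine Finset.sum_congr rfl fun n hn => ?_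
    rw [if_neg (by have := Finset.mem_range.1 hn; omega)]

lemma exists_bounded_chebyshev_expansion (q : ℕ) (p : ℝ[X]) (hp : p.natDegree ≤ q) (M : ℝ)
    (hM : ∀ x ∈ Set.Icc (-1 : ℝ) 1, |p.eval x| ≤ M) :
    ∃ b : ℕ → ℝ, p = ∑ n ∈ Finset.range (q + 1), b n • T ℝ n ∧ ∀ n ≤ q, |b n| ≤ 2 * M := by
  obtain ⟨b, hb⟩ := exists_chebyshev_expansion q p hp
  refine ⟨b, hb, fun m hm => ?_⟩
  have hM0 : 0 ≤ M := (abs_nonneg _).trans (hM 0 (by norm_num))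
  have hI : ∫ x, p.eval x * (T ℝ m).eval x ∂measureT =
      b m * ∫ x, (T ℝ m).eval x * (T ℝ m).eval x ∂measureT := by
    conv_lhs => rw [hb]
    simp_rw [Polynomial.eval_finsetSum, Finset.sum_mul, Polynomial.eval_smul, smul_eq_mul]
    rw [MeasureTheory.integral_finsetSum _ fun i _ => integrable_measureT (by fun_prop),
      Finset.sum_eq_single m]
    · simp_rw [mul_assoc]
      rw [MeasureTheory.integral_const_mul]
    · intro n _ hnm
      simp_rw [mul_assoc]
      rw [MeasureTheory.integral_const_mul,
        integral_eval_T_real_mul_eval_T_real_measureT_of_ne hnm, mul_zero]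
    · intro h
      exact absurd (Finset.mem_range.2 (by omega)) h
  have hle : |∫ x, p.eval x * (T ℝ m).eval x ∂measureT| ≤ M * Real.pi := by
    rw [integral_measureT_eq_integral_cos]
    have := intervalIntegral.norm_integral_le_of_norm_le_const (a := 0) (b := Real.pi) (C := M)
      (f := fun t => p.eval (Real.cos t) * (T ℝ m).eval (Real.cos t)) (fun t _ => by
        rw [norm_mul, Real.norm_eq_abs, Real.norm_eq_abs]
        have h1 := hM (Real.cos t) ⟨Real.neg_one_le_cos t, Real.cos_le_one t⟩
        have h2 := abs_eval_T_real_le_one (m : ℤ) (Real.abs_cos_le_one t)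
        calc _ ≤ M * 1 := mul_le_mul h1 h2 (abs_nonneg _) hM0
          _ = M := mul_one M)
    simpa [abs_of_pos Real.pi_pos] using this
  have hge : Real.pi / 2 ≤ ∫ x, (T ℝ m).eval x * (T ℝ m).eval x ∂measureT := by
    rcases eq_or_ne m 0 with rfl | h
    · have := integral_eval_T_real_mul_self_measureT_zero
      simp only [Nat.cast_zero]
      rw [this]
      linarith [Real.pi_pos]
    · rw [integral_T_real_mul_self_measureT_of_ne_zero h]
  rw [hI, abs_mul, abs_of_nonneg (le_trans (by positivity) hge)] at hle
  have h3 : |b m| * (Real.pi / 2) ≤ M * Real.pi :=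
    (mul_le_mul_of_nonneg_left hge (abs_nonneg _)).trans hle
  nlinarith [Real.pi_pos]

lemma abs_eval_derivative_T_le (n : ℕ) {x : ℝ} (hx : |x| ≤ 1) :
    |(derivative (T ℝ n)).eval x| ≤ (n : ℝ) ^ 2 := by
  have h := abs_iterate_derivative_T_real_le (n : ℤ) 1 hx
  have h1 := iterate_derivative_T_eval_one (R := ℝ) (n : ℤ) 1
  simp at h h1
  rw [h1] at h
  exact h

/-- A Markov-type inequality on `[-1, 1]`. -/
lemma abs_eval_derivative_le (q : ℕ) (p : ℝ[X]) (hp : p.natDegree ≤ q) (M : ℝ)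
    (hM : ∀ x ∈ Set.Icc (-1 : ℝ) 1, |p.eval x| ≤ M) {x : ℝ} (hx : x ∈ Set.Icc (-1 : ℝ) 1) :
    |(derivative p).eval x| ≤ 2 * (q + 1) ^ 3 * M := by
  obtain ⟨b, hb, hbM⟩ := exists_bounded_chebyshev_expansion q p hp M hM
  have hM0 : 0 ≤ M := (abs_nonneg _).trans (hM 0 (by norm_num))
  rw [hb, Polynomial.derivative_sum, Polynomial.eval_finsetSum]
  calc _ ≤ ∑ n ∈ Finset.range (q + 1), |(derivative (b n • T ℝ n)).eval x| :=
        Finset.abs_sum_le_sum_abs _ _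
    _ ≤ ∑ n ∈ Finset.range (q + 1), 2 * M * ((q : ℝ) + 1) ^ 2 := by
        refine Finset.sum_le_sum fun n hn => ?_
        have hn' : n ≤ q := by have := Finset.mem_range.1 hn; omega
        rw [Polynomial.derivative_smul, Polynomial.eval_smul, smul_eq_mul, abs_mul]
        have h1 := abs_eval_derivative_T_le n (abs_le.2 hx)
        have h2 : (n : ℝ) ^ 2 ≤ ((q : ℝ) + 1) ^ 2 := by
          have : (n : ℝ) ≤ q := by exact_mod_cast hn'
          gcongr
          linarith
        exact mul_le_mul (hbM n hn') (h1.trans h2) (abs_nonneg _) (by positivity)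
    _ = _ := by
        rw [Finset.sum_const, Finset.card_range, nsmul_eq_mul]
        push_cast
        ring

/-- A Markov-type inequality on `[0, δ]`. -/
lemma abs_eval_derivative_le_of_Icc_zero (q : ℕ) (p : ℝ[X]) (hp : p.natDegree ≤ q) (M δ : ℝ)
    (hδ : 0 < δ) (hM : ∀ x ∈ Set.Icc 0 δ, |p.eval x| ≤ M) {x : ℝ} (hx : x ∈ Set.Icc 0 δ) :
    |(derivative p).eval x| ≤ 4 * (q + 1) ^ 3 / δ * M := by
  set l : ℝ[X] := C (δ / 2) * X + C (δ / 2) with hl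
  have hld : l.natDegree ≤ 1 := by rw [hl]; compute_degree
  have hleval : ∀ y, l.eval y = δ / 2 * y + δ / 2 := fun y => by simp [hl]
  have hlder : derivative l = C (δ / 2) := by simp [hl]
  have hdeg : (p.comp l).natDegree ≤ q :=
    (Polynomial.natDegree_comp_le).trans ((Nat.mul_le_mul hp hld).trans (by simp))
  have key := abs_eval_derivative_le q (p.comp l) hdeg M (fun y hy => by
    rw [Polynomial.eval_comp, hleval]
    refine hM _ ⟨?_, ?_⟩ <;> nlinarith [hy.1, hy.2]) (x := 2 * x / δ - 1) (by
      constructor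
      · have : 0 ≤ 2 * x / δ := div_nonneg (by linarith [hx.1]) hδ.le
        linarith
      · have : 2 * x / δ ≤ 2 := by rw [div_le_iff₀ hδ]; linarith [hx.2]
        linarith)
  rw [Polynomial.derivative_comp, hlder, Polynomial.eval_mul, Polynomial.eval_C,
    Polynomial.eval_comp, hleval, abs_mul, abs_of_pos (by positivity : (0 : ℝ) < δ / 2)] at key
  have hxx : δ / 2 * (2 * x / δ - 1) + δ / 2 = x := by field_simp; ring
  rw [hxx] at key
  rw [div_mul_eq_mul_div, le_div_iff₀ hδ]
  linarith

/-- A polynomial bounded at the points `1 / N` is bounded on an interval `[0, 1 / N₁]`. -/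
lemma abs_eval_le_of_forall_inv (d N₀ N₁ : ℕ) (G : ℝ[X]) (hG : G.natDegree ≤ d) (M : ℝ)
    (hM : ∀ N : ℕ, N₀ ≤ N → 1 ≤ N → |G.eval (1 / (N : ℝ))| ≤ M) (h0 : N₀ ≤ N₁)
    (h1 : 8 * (d + 1) ^ 3 ≤ N₁) {x : ℝ} (hx : x ∈ Set.Icc 0 (1 / (N₁ : ℝ))) :
    |G.eval x| ≤ 2 * M := by
  have hN1 : 0 < N₁ := lt_of_lt_of_le (by positivity) h1
  have hN1r : (0 : ℝ) < N₁ := by exact_mod_cast hN1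
  set δ : ℝ := 1 / (N₁ : ℝ) with hδ
  have hδ0 : 0 < δ := by positivity
  have hM0 : 0 ≤ M := (abs_nonneg _).trans (hM N₁ h0 hN1)
  obtain ⟨y, hy, hmax⟩ := isCompact_Icc.exists_isMaxOn (⟨0, by simp [hδ0.le]⟩ :
    (Set.Icc (0 : ℝ) δ).Nonempty) (f := fun x => |G.eval x|) (by fun_prop)
  set S := |G.eval y| with hS
  have hSmax : ∀ z ∈ Set.Icc 0 δ, |G.eval z| ≤ S := fun z hz => hmax hz
  refine (hSmax x hx).trans ?_
  rcases eq_or_lt_of_le hy.1 with h | hypos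
  · have hlim : Tendsto (fun N : ℕ => |G.eval (1 / (N : ℝ))|) atTop (nhds |G.eval 0|) :=
      ((G.continuous.tendsto 0).comp tendsto_one_div_atTop_nhds_zero_nat).abs
    have : S ≤ M := by
      rw [hS, ← h]
      refine le_of_tendsto hlim ?_
      filter_upwards [eventually_ge_atTop (max N₀ 1)] with N hN
      exact hM N (le_of_max_le_left hN) (le_of_max_le_right hN)
    linarith
  · set N := ⌊1 / y⌋₊ with hN
    have hNle : (N : ℝ) ≤ 1 / y := Nat.floor_le (by positivity)
    have hNlt : 1 / y < N + 1 := Nat.lt_floor_add_one _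
    have hNN : N₁ ≤ N := Nat.le_floor (by
      rw [le_div_iff₀ hypos]
      have := hy.2
      rw [hδ, le_div_iff₀ hN1r] at this
      linarith)
    have hNpos : (0 : ℝ) < N := lt_of_lt_of_le hN1r (by exact_mod_cast hNN)
    have hyN : y ≤ 1 / N := by
      rw [le_div_iff₀ hNpos]; rw [le_div_iff₀ hypos] at hNle; linarith
    have hNδ : 1 / (N : ℝ) ≤ δ := one_div_le_one_div_of_le hN1r (by exact_mod_cast hNN)
    have hgap : 1 / (N : ℝ) - y ≤ δ ^ 2 := by
      have h2 : 1 / ((N : ℝ) + 1) < y := by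
        rw [div_lt_iff₀ (by positivity)]; rw [div_lt_iff₀ hypos] at hNlt; linarith
      have h3 : 1 / (N : ℝ) - 1 / (N + 1) ≤ 1 / N * (1 / N) := by
        rw [div_sub_div _ _ hNpos.ne' (by positivity), div_mul_div_comm,
          div_le_div_iff₀ (by positivity) (by positivity)]
        nlinarith
      have h4 : 1 / (N : ℝ) * (1 / N) ≤ δ ^ 2 := by
        rw [sq]; exact mul_le_mul hNδ hNδ (by positivity) hδ0.le
      linarith
    have hmv := Convex.norm_image_sub_le_of_norm_hasDerivWithin_le (f := fun z => G.eval z)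
      (f' := fun z => (derivative G).eval z) (C := 4 * (d + 1) ^ 3 / δ * S)
      (s := Set.Icc 0 δ) (fun z _ => (G.hasDerivAt z).hasDerivWithinAt)
      (fun z hz => abs_eval_derivative_le_of_Icc_zero d G hG S δ hδ0 hSmax hz)
      (convex_Icc 0 δ) (x := 1 / (N : ℝ)) (y := y) ⟨by positivity, hNδ⟩ hy
    rw [Real.norm_eq_abs, Real.norm_eq_abs, abs_sub_comm y,
      abs_of_nonneg (a := 1 / (N : ℝ) - y) (by linarith)] at hmv
    have hGN := hM N (h0.trans hNN) (hN1.trans_le hNN)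
    have hS0 : 0 ≤ S := abs_nonneg _
    have h5 : 4 * ((d : ℝ) + 1) ^ 3 / δ * S * (1 / N - y) ≤ S / 2 := by
      calc _ ≤ 4 * ((d : ℝ) + 1) ^ 3 / δ * S * δ ^ 2 := by gcongr
        _ = (4 * ((d : ℝ) + 1) ^ 3) * δ * S := by field_simp
        _ ≤ 1 / 2 * S := by
          gcongr
          rw [hδ, mul_one_div, div_le_iff₀ hN1r]
          have : (8 * ((d : ℝ) + 1) ^ 3) ≤ N₁ := by exact_mod_cast h1
          linarith
        _ = S / 2 := by ring
    have h6 : S ≤ |G.eval y - G.eval (1 / (N : ℝ))| + |G.eval (1 / (N : ℝ))| := by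
      rw [hS]
      simpa using abs_add_le (G.eval y - G.eval (1 / (N : ℝ))) (G.eval (1 / (N : ℝ)))
    linarith

/-- Second order expansion at `0` of a polynomial controlled at the points `1 / N`. -/
lemma abs_eval_sub_taylor_le (d N₀ N₁ : ℕ) (G : ℝ[X]) (hG : G.natDegree ≤ d) (M : ℝ)
    (hM : ∀ N : ℕ, N₀ ≤ N → 1 ≤ N → |G.eval (1 / (N : ℝ))| ≤ M) (h0 : N₀ ≤ N₁)
    (h1 : 8 * (d + 1) ^ 3 ≤ N₁) {x : ℝ} (hx : x ∈ Set.Icc 0 (1 / (N₁ : ℝ))) :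
    |G.eval x - G.eval 0 - (derivative G).eval 0 * x| ≤
      32 * (d + 1) ^ 6 * N₁ ^ 2 * M * x ^ 2 := by
  have hN1 : 0 < N₁ := lt_of_lt_of_le (by positivity) h1
  have hN1r : (0 : ℝ) < N₁ := by exact_mod_cast hN1
  set δ : ℝ := 1 / (N₁ : ℝ) with hδ
  have hδ0 : 0 < δ := by positivity
  have b0 : ∀ z ∈ Set.Icc 0 δ, |G.eval z| ≤ 2 * M := fun z hz =>
    abs_eval_le_of_forall_inv d N₀ N₁ G hG M hM h0 h1 hz
  have b1 : ∀ z ∈ Set.Icc 0 δ, |(derivative G).eval z| ≤ 4 * (d + 1) ^ 3 / δ * (2 * M) :=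
    fun z hz => abs_eval_derivative_le_of_Icc_zero d G hG _ δ hδ0 b0 hz
  have b2 : ∀ z ∈ Set.Icc 0 δ, |(derivative (derivative G)).eval z| ≤
      4 * (d + 1) ^ 3 / δ * (4 * (d + 1) ^ 3 / δ * (2 * M)) := fun z hz =>
    abs_eval_derivative_le_of_Icc_zero d (derivative G)
      ((Polynomial.natDegree_derivative_le G).trans (by omega)) _ δ hδ0 b1 hz
  set K : ℝ := 4 * (d + 1) ^ 3 / δ * (4 * (d + 1) ^ 3 / δ * (2 * M)) with hK
  have hKeq : K = 32 * (d + 1) ^ 6 * N₁ ^ 2 * M := by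
    rw [hK, hδ]; field_simp; ring
  have hsub : Set.Icc 0 x ⊆ Set.Icc 0 δ := Set.Icc_subset_Icc le_rfl hx.2
  have m1 : ∀ z ∈ Set.Icc 0 x, |(derivative G).eval z - (derivative G).eval 0| ≤ K * x := by
    intro z hz
    have := Convex.norm_image_sub_le_of_norm_hasDerivWithin_le
      (f := fun z => (derivative G).eval z)
      (f' := fun z => (derivative (derivative G)).eval z) (C := K)
      (s := Set.Icc 0 δ) (fun z _ => ((derivative G).hasDerivAt z).hasDerivWithinAt)
      b2 (convex_Icc 0 δ) (x := 0) (y := z) ⟨le_rfl, hδ0.le⟩ (hsub hz)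
    rw [Real.norm_eq_abs, Real.norm_eq_abs, sub_zero, abs_of_nonneg hz.1] at this
    have hK0 : 0 ≤ K := (abs_nonneg _).trans (b2 0 ⟨le_rfl, hδ0.le⟩)
    exact this.trans (mul_le_mul_of_nonneg_left hz.2 hK0)
  have := Convex.norm_image_sub_le_of_norm_hasDerivWithin_le
    (f := fun z => G.eval z - (derivative G).eval 0 * z)
    (f' := fun z => (derivative G).eval z - (derivative G).eval 0) (C := K * x)
    (s := Set.Icc 0 x) (fun z _ => by
      have h := (G.hasDerivAt z).fun_sub ((hasDerivAt_id z).const_mul ((derivative G).eval 0))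
      simpa using h.hasDerivWithinAt)
    m1 (convex_Icc 0 x) (x := 0) (y := x) ⟨le_rfl, hx.1⟩ ⟨hx.1, le_rfl⟩
  simp only [Real.norm_eq_abs, mul_zero, sub_zero] at this
  rw [abs_of_nonneg hx.1, hKeq] at this
  calc _ = |G.eval x - (derivative G).eval 0 * x - G.eval 0| := by ring_nf
    _ ≤ _ := this
    _ = _ := by ring

end PolynomialInequalities

section Letters

/-- The letters of the alphabet `{g₁, g₁⁻¹, …, g_r, g_r⁻¹}`; `(k, true)` stands for `g_k`. -/
abbrev Letter (r : ℕ) : Type := Fin r × Bool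

/-- The inverse letter. -/
def Letter.bar {r : ℕ} (a : Letter r) : Letter r := (a.1, !a.2)

@[simp] lemma Letter.bar_bar {r : ℕ} (a : Letter r) : a.bar.bar = a := by
  simp [Letter.bar]

lemma Letter.bar_ne {r : ℕ} (a : Letter r) : a.bar ≠ a := by
  intro h
  have := congrArg Prod.snd h
  simp [Letter.bar] at this

/-- The permutation associated with a letter. -/
def letterPerm {r : ℕ} {α : Type*} (σ : Fin r → Equiv.Perm α) (a : Letter r) : Equiv.Perm α :=
  if a.2 then σ a.1 else (σ a.1)⁻¹

lemma letterPerm_bar {r : ℕ} {α : Type*} (σ : Fin r → Equiv.Perm α) (a : Letter r) :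
    letterPerm σ a.bar = (letterPerm σ a)⁻¹ := by
  rcases a with ⟨k, b⟩
  cases b <;> simp [letterPerm, Letter.bar]

@[simp] lemma letterPerm_bar_apply {r : ℕ} {α : Type*} (σ : Fin r → Equiv.Perm α) (a : Letter r)
    (i : α) : letterPerm σ a.bar (letterPerm σ a i) = i := by
  simp [letterPerm_bar]

end Letters

section Nonbacktracking

open Matrix Polynomial

variable {r N : ℕ}

/-- The adjacency matrix of the Schreier graph of a tuple of permutations. -/
def schreierAdj (σ : Fin r → Equiv.Perm (Fin N)) : Matrix (Fin N) (Fin N) ℝ :=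
  ∑ k : Fin r, (permMatR (σ k) + (permMatR (σ k)).transpose)

lemma schreierAdj_apply (σ : Fin r → Equiv.Perm (Fin N)) (i j : Fin N) :
    schreierAdj σ i j = ∑ a : Letter r, if letterPerm σ a i = j then (1 : ℝ) else 0 := by
  rw [schreierAdj, Matrix.sum_apply, Fintype.sum_prod_type]
  refine Finset.sum_congr rfl fun k _ => ?_
  simp only [Fintype.sum_bool, letterPerm, permMatR, Matrix.add_apply, Matrix.transpose_apply,
    Matrix.of_apply, if_true, Equiv.Perm.inv_eq_iff_eq, Bool.false_eq_true, if_false]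
  rw [add_comm]
  congr 2
  exact propext eq_comm

lemma schreierAdj_transpose (σ : Fin r → Equiv.Perm (Fin N)) :
    (schreierAdj σ)ᵀ = schreierAdj σ := by
  rw [schreierAdj, Matrix.transpose_sum]
  refine Finset.sum_congr rfl fun k _ => ?_
  rw [Matrix.transpose_add, Matrix.transpose_transpose, add_comm]

/-- The nonbacktracking matrix, indexed by the oriented edges of the Schreier graph. -/
def nbMat (σ : Fin r → Equiv.Perm (Fin N)) :
    Matrix (Letter r × Fin N) (Letter r × Fin N) ℝ :=
  Matrix.of fun x y => if letterPerm σ x.1 x.2 = y.2 ∧ y.1 ≠ x.1.bar then 1 else 0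

/-- The incidence matrix of oriented edges and their sources. -/
def sourceMat (r N : ℕ) : Matrix (Letter r × Fin N) (Fin N) ℝ :=
  Matrix.of fun x j => if x.2 = j then 1 else 0

/-- The incidence matrix of oriented edges and their targets. -/
def targetMat (σ : Fin r → Equiv.Perm (Fin N)) : Matrix (Letter r × Fin N) (Fin N) ℝ :=
  Matrix.of fun x j => if letterPerm σ x.1 x.2 = j then 1 else 0

/-- Reversal of oriented edges. -/
def edgeRev (σ : Fin r → Equiv.Perm (Fin N)) (x : Letter r × Fin N) : Letter r × Fin N :=
  (x.1.bar, letterPerm σ x.1 x.2)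

lemma edgeRev_edgeRev (σ : Fin r → Equiv.Perm (Fin N)) (x : Letter r × Fin N) :
    edgeRev σ (edgeRev σ x) = x := by
  simp [edgeRev]

/-- The matrix of the reversal of oriented edges. -/
def revMat (σ : Fin r → Equiv.Perm (Fin N)) :
    Matrix (Letter r × Fin N) (Letter r × Fin N) ℝ :=
  Matrix.of fun x y => if y = edgeRev σ x then 1 else 0

lemma revMat_mul {m : Type*} (σ : Fin r → Equiv.Perm (Fin N))
    (M : Matrix (Letter r × Fin N) m ℝ) :
    revMat σ * M = Matrix.of fun x j => M (edgeRev σ x) j := by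
  ext x j
  simp [revMat, Matrix.mul_apply]

lemma nbMat_eq (σ : Fin r → Equiv.Perm (Fin N)) :
    nbMat σ = targetMat σ * (sourceMat r N)ᵀ - revMat σ := by
  ext x y
  simp only [nbMat, targetMat, sourceMat, revMat, edgeRev, Matrix.sub_apply, Matrix.mul_apply,
    Matrix.transpose_apply, Matrix.of_apply, ite_mul, one_mul, zero_mul,
    Finset.sum_ite_eq, Finset.mem_univ, if_true]
  obtain ⟨b, j⟩ := y
  by_cases h1 : letterPerm σ x.1 x.2 = j <;> by_cases h2 : b = x.1.bar
  · simp [h1, h2]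
  · simp [h1, h2]
  · simp [h1, h2, eq_comm (a := j)]
  · simp [h1, h2, eq_comm (a := j)]

lemma revMat_mul_revMat (σ : Fin r → Equiv.Perm (Fin N)) : revMat σ * revMat σ = 1 := by
  rw [revMat_mul]
  ext x y
  simp [revMat, edgeRev_edgeRev, Matrix.one_apply, eq_comm]

lemma revMat_transpose (σ : Fin r → Equiv.Perm (Fin N)) : (revMat σ)ᵀ = revMat σ := by
  ext x y
  simp only [revMat, Matrix.transpose_apply, Matrix.of_apply]
  refine if_congr ⟨?_, ?_⟩ rfl rfl <;> rintro rfl <;> rw [edgeRev_edgeRev]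

lemma revMat_mul_targetMat (σ : Fin r → Equiv.Perm (Fin N)) :
    revMat σ * targetMat σ = sourceMat r N := by
  rw [revMat_mul]
  ext x j
  simp [targetMat, sourceMat, edgeRev]

lemma revMat_mul_sourceMat (σ : Fin r → Equiv.Perm (Fin N)) :
    revMat σ * sourceMat r N = targetMat σ := by
  rw [← revMat_mul_targetMat σ, ← Matrix.mul_assoc, revMat_mul_revMat, Matrix.one_mul]

lemma sourceMat_transpose_mul_targetMat (σ : Fin r → Equiv.Perm (Fin N)) :
    (sourceMat r N)ᵀ * targetMat σ = schreierAdj σ := by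
  ext i j
  rw [schreierAdj_apply]
  rw [Matrix.mul_apply, Fintype.sum_prod_type]
  simp only [sourceMat, targetMat, Matrix.transpose_apply, Matrix.of_apply, ite_mul, one_mul,
    zero_mul, Finset.sum_ite_eq', Finset.mem_univ, if_true]

lemma sourceMat_transpose_mul_sourceMat :
    (sourceMat r N)ᵀ * sourceMat r N = (2 * r : ℝ) • 1 := by
  ext i j
  rw [Matrix.mul_apply, Fintype.sum_prod_type]
  rcases eq_or_ne i j with rfl | h
  · simp [sourceMat, Fintype.card_prod, mul_comm]
  · simp [sourceMat, h, h.symm]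

lemma targetMat_transpose_mul_targetMat (σ : Fin r → Equiv.Perm (Fin N)) :
    (targetMat σ)ᵀ * targetMat σ = (2 * r : ℝ) • 1 := by
  rw [← revMat_mul_sourceMat σ, Matrix.transpose_mul, revMat_transpose, Matrix.mul_assoc,
    ← Matrix.mul_assoc (revMat σ), revMat_mul_revMat, Matrix.one_mul,
    sourceMat_transpose_mul_sourceMat]

lemma nbMat_mul_targetMat (σ : Fin r → Equiv.Perm (Fin N)) :
    nbMat σ * targetMat σ = targetMat σ * schreierAdj σ - sourceMat r N := by
  rw [nbMat_eq, Matrix.sub_mul, Matrix.mul_assoc, sourceMat_transpose_mul_targetMat,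
    revMat_mul_targetMat]

lemma nbMat_mul_sourceMat (σ : Fin r → Equiv.Perm (Fin N)) :
    nbMat σ * sourceMat r N = (2 * r - 1 : ℝ) • targetMat σ := by
  rw [nbMat_eq, Matrix.sub_mul, Matrix.mul_assoc, sourceMat_transpose_mul_sourceMat,
    revMat_mul_sourceMat, Matrix.mul_smul, Matrix.mul_one, sub_smul, one_smul]

/-- The polynomials with `X_{n+2} = x X_{n+1} - k X_n`, `X₀ = 1`, `X₁ = x` (rescaled Chebyshev
polynomials of the second kind). -/
def scaledU (k : ℝ) : ℕ → ℝ[X]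
  | 0 => 1
  | 1 => X
  | n + 2 => X * scaledU k (n + 1) - C k * scaledU k n

/-- The polynomials with `τ_{n+2} = x τ_{n+1} - k τ_n`, `τ₀ = 2`, `τ₁ = x` (rescaled Chebyshev
polynomials of the first kind). -/
def scaledT (k : ℝ) : ℕ → ℝ[X]
  | 0 => 2
  | 1 => X
  | n + 2 => X * scaledT k (n + 1) - C k * scaledT k n

lemma C_two : (C 2 : ℝ[X]) = 2 := map_ofNat C 2

lemma scaledT_succ (k : ℝ) (n : ℕ) :
    scaledT k (n + 1) = 2 * scaledU k (n + 1) - X * scaledU k n := by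
  induction n using Nat.twoStepInduction with
  | zero => simp [scaledT, scaledU]; ring
  | one => simp [scaledT, scaledU]; ring
  | more n h1 h2 =>
    rw [scaledT, h1, h2]
    simp only [scaledU]
    ring

lemma scaledT_add_two (k : ℝ) (n : ℕ) :
    scaledT k (n + 2) = scaledU k (n + 2) - C k * scaledU k n := by
  rw [scaledT_succ, scaledU]
  ring

lemma scaledT_eq_comp (k : ℝ) (hk : 0 < k) (n : ℕ) :
    scaledT k n = C (2 * √k ^ n) * (Chebyshev.T ℝ n).comp (C (2 * √k)⁻¹ * X) := by
  have hs : √k ≠ 0 := (Real.sqrt_pos.2 hk).ne'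
  have hss : √k * √k = k := Real.mul_self_sqrt hk.le
  induction n using Nat.twoStepInduction with
  | zero => simp [scaledT, C_two]
  | one =>
    simp only [scaledT, Nat.cast_one, Chebyshev.T_one, X_comp, ← mul_assoc, ← C_mul, pow_one]
    rw [mul_inv_cancel₀ (by positivity)]
    simp
  | more n h1 h2 =>
    rw [scaledT, h1, h2]
    have : ((n + 2 : ℕ) : ℤ) = (n : ℤ) + 2 := by push_cast; ring
    rw [this, Chebyshev.T_add_two]
    have : ((n + 1 : ℕ) : ℤ) = (n : ℤ) + 1 := by push_cast; ring
    rw [this]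
    simp only [sub_comp, mul_comp, X_comp]
    generalize (Chebyshev.T ℝ ((n : ℤ) + 1)).comp _ = P
    generalize (Chebyshev.T ℝ (n : ℤ)).comp _ = Q
    have e1 : (2 * √k ^ (n + 2)) * 2 * (2 * √k)⁻¹ = 2 * √k ^ (n + 1) := by
      field_simp
      ring
    have e2 : k * (2 * √k ^ n) = 2 * √k ^ (n + 2) := by rw [pow_add, sq, hss]; ring
    have e3 : (2 : ℝ[X]).comp (C (2 * √k)⁻¹ * X) = C 2 := by simp [C_two]
    rw [e3, ← mul_assoc (C k), ← C_mul, e2, ← e1]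
    simp only [C_mul]
    ring

lemma nbMat_pow_succ_mul_targetMat (σ : Fin r → Equiv.Perm (Fin N)) (n : ℕ) :
    nbMat σ ^ (n + 1) * targetMat σ =
      targetMat σ * aeval (schreierAdj σ) (scaledU (2 * r - 1) (n + 1)) -
        sourceMat r N * aeval (schreierAdj σ) (scaledU (2 * r - 1) n) := by
  have hS := nbMat_mul_sourceMat σ
  generalize (2 * r - 1 : ℝ) = k at hS ⊢
  induction n with
  | zero => simp [scaledU, nbMat_mul_targetMat]
  | succ n ih =>
    rw [pow_succ', Matrix.mul_assoc, ih, Matrix.mul_sub, ← Matrix.mul_assoc, ← Matrix.mul_assoc,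
      nbMat_mul_targetMat, hS, scaledU]
    simp only [map_sub, map_mul, aeval_X, aeval_C, Algebra.algebraMap_eq_smul_one,
      Matrix.mul_sub, Matrix.sub_mul, Matrix.smul_mul, Matrix.mul_smul, Matrix.one_mul,
      Matrix.mul_assoc]
    abel

lemma trace_revMat (σ : Fin r → Equiv.Perm (Fin N)) : (revMat σ).trace = 0 := by
  refine Finset.sum_eq_zero fun x _ => ?_
  simp only [revMat, Matrix.diag_apply, Matrix.of_apply]
  rw [if_neg]
  intro h
  exact x.1.bar_ne (congrArg Prod.fst h).symm

lemma trace_nbMat (σ : Fin r → Equiv.Perm (Fin N)) :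
    (nbMat σ).trace = (schreierAdj σ).trace := by
  rw [nbMat_eq, Matrix.trace_sub, trace_revMat, sub_zero, Matrix.trace_mul_comm,
    sourceMat_transpose_mul_targetMat]

lemma trace_nbMat_pow_add_two (σ : Fin r → Equiv.Perm (Fin N)) (n : ℕ) :
    (nbMat σ ^ (n + 2)).trace = (nbMat σ ^ n).trace +
      ((sourceMat r N)ᵀ * (nbMat σ ^ (n + 1) * targetMat σ)).trace -
      ((targetMat σ)ᵀ * (nbMat σ ^ n * targetMat σ)).trace := by
  have h1 : nbMat σ ^ (n + 2) = nbMat σ ^ (n + 1) * targetMat σ * (sourceMat r N)ᵀ -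
      (nbMat σ ^ n * targetMat σ * ((sourceMat r N)ᵀ * revMat σ) - nbMat σ ^ n) := by
    have h2 : nbMat σ ^ n = nbMat σ ^ n * (revMat σ * revMat σ) := by
      rw [revMat_mul_revMat, Matrix.mul_one]
    have h3 : nbMat σ ^ n * targetMat σ * ((sourceMat r N)ᵀ * revMat σ) -
        nbMat σ ^ n * (revMat σ * revMat σ) = nbMat σ ^ (n + 1) * revMat σ := by
      rw [pow_succ (nbMat σ) n]
      nth_rw 4 [nbMat_eq]
      simp only [Matrix.mul_sub, Matrix.sub_mul, Matrix.mul_assoc]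
    rw [← h2] at h3
    rw [h3, pow_succ (nbMat σ) (n + 1)]
    nth_rw 2 [nbMat_eq]
    rw [Matrix.mul_sub, Matrix.mul_assoc]
  have h4 : (sourceMat r N)ᵀ * revMat σ = (targetMat σ)ᵀ := by
    rw [← revMat_mul_sourceMat σ, Matrix.transpose_mul, revMat_transpose]
  rw [h1, h4, Matrix.trace_sub, Matrix.trace_sub, Matrix.trace_mul_comm,
    Matrix.trace_mul_comm _ (targetMat σ)ᵀ]
  ring

/-- The Ihara–Bass type formula for the traces of the powers of the nonbacktracking matrix. -/
lemma trace_nbMat_pow (σ : Fin r → Equiv.Perm (Fin N)) (n : ℕ) :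
    (nbMat σ ^ (n + 1)).trace = (aeval (schreierAdj σ) (scaledT (2 * r - 1) (n + 1))).trace +
      (r - 1) * (1 + (-1) ^ (n + 1)) * N := by
  have hTS : (targetMat σ)ᵀ * sourceMat r N = schreierAdj σ := by
    rw [← schreierAdj_transpose, ← sourceMat_transpose_mul_targetMat, Matrix.transpose_mul,
      Matrix.transpose_transpose]
  induction n using Nat.twoStepInduction with
  | zero => simp [scaledT, trace_nbMat]
  | one =>
    rw [trace_nbMat_pow_add_two, zero_add, nbMat_pow_succ_mul_targetMat, pow_zero, Matrix.one_mul,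
      Matrix.mul_sub, ← Matrix.mul_assoc, ← Matrix.mul_assoc, sourceMat_transpose_mul_targetMat,
      sourceMat_transpose_mul_sourceMat, targetMat_transpose_mul_targetMat]
    generalize hk : (2 * r - 1 : ℝ) = k
    simp only [scaledT, scaledU, ← C_two, Algebra.algebraMap_eq_smul_one, Matrix.trace_sub,
      Matrix.trace_smul, map_sub, map_mul, aeval_X, aeval_C, map_one, Matrix.trace_one,
      Matrix.smul_mul, Matrix.one_mul, Matrix.mul_one, smul_eq_mul, Fintype.card_prod,
      Fintype.card_fin, Fintype.card_bool]
    subst hk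
    push_cast
    ring
  | more n h1 _ =>
    rw [trace_nbMat_pow_add_two, h1, nbMat_pow_succ_mul_targetMat, nbMat_pow_succ_mul_targetMat,
      Matrix.mul_sub, Matrix.mul_sub, ← Matrix.mul_assoc, ← Matrix.mul_assoc, ← Matrix.mul_assoc,
      ← Matrix.mul_assoc, sourceMat_transpose_mul_targetMat,
      sourceMat_transpose_mul_sourceMat, targetMat_transpose_mul_targetMat, hTS]
    have e : scaledT (2 * r - 1 : ℝ) (n + 3) = scaledT (2 * r - 1) (n + 1) +
        X * scaledU (2 * r - 1) (n + 2) - C (4 * r : ℝ) * scaledU (2 * r - 1) (n + 1) +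
        X * scaledU (2 * r - 1) n := by
      rw [scaledT_succ, scaledT_succ, scaledU]
      have h4 : (C (4 * r : ℝ)) = 2 * C (2 * r - 1 : ℝ) + 2 := by
        rw [← C_two, ← C_mul, ← C_add]
        congr 1
        ring
      rw [h4]
      ring
    rw [show n + 2 + 1 = n + 3 from rfl, e]
    simp only [map_add, map_sub, map_mul, aeval_X, aeval_C, Algebra.algebraMap_eq_smul_one,
      Matrix.trace_add, Matrix.trace_sub, Matrix.trace_smul, Matrix.smul_mul, Matrix.one_mul,
      smul_eq_mul, pow_add]
    ring

end Nonbacktracking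

section ClosedWalks

open Matrix

lemma Matrix.pow_succ_apply_eq_sum {X R : Type*} [Fintype X] [DecidableEq X] [CommSemiring R]
    (M : Matrix X X R) (n : ℕ) (x y : X) :
    (M ^ (n + 1)) x y = ∑ p : Fin n → X, ∏ t : Fin (n + 1),
      M ((Fin.cons x p : Fin (n + 1) → X) t) ((Fin.snoc p y : Fin (n + 1) → X) t) := by
  induction n generalizing x with
  | zero => simp [Fin.snoc]
  | succ n ih =>
    rw [pow_succ', Matrix.mul_apply, ← (Fin.consEquiv fun _ => X).sum_comp, Fintype.sum_prod_type]
    refine Finset.sum_congr rfl fun z _ => ?_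
    rw [ih, Finset.mul_sum]
    refine Finset.sum_congr rfl fun p _ => ?_
    rw [Fin.prod_univ_succ (n := n + 1)]
    have e : (Fin.snoc ((Fin.consEquiv fun _ : Fin (n + 1) => X) (z, p)) y : Fin (n + 2) → X) =
        Fin.cons z (Fin.snoc p y : Fin (n + 1) → X) :=
      (Fin.cons_snoc_eq_snoc_cons (β := X) z p y).symm
    simp only [e, Fin.cons_zero, Fin.cons_succ]
    rfl

lemma Matrix.trace_pow_eq_sum {X R : Type*} [Fintype X] [DecidableEq X] [CommSemiring R]
    (M : Matrix X X R) (n : ℕ) [NeZero n] :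
    (M ^ n).trace = ∑ p : ZMod n → X, ∏ t : ZMod n, M (p t) (p (t + 1)) := by
  obtain ⟨m, rfl⟩ := Nat.exists_eq_succ_of_ne_zero (NeZero.ne n)
  change (M ^ (m + 1)).trace = ∑ p : Fin (m + 1) → X, ∏ t : Fin (m + 1), M (p t) (p (t + 1))
  rw [← (Fin.consEquiv fun _ => X).sum_comp, Fintype.sum_prod_type, Matrix.trace]
  refine Finset.sum_congr rfl fun x _ => ?_
  rw [Matrix.diag_apply, Matrix.pow_succ_apply_eq_sum]
  refine Finset.sum_congr rfl fun p _ => Finset.prod_congr rfl fun t _ => ?_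
  simp only [Fin.consEquiv_apply]
  congr 1
  induction t using Fin.lastCases with
  | last => simp
  | cast t => simp [Fin.coeSucc_eq_succ]

/-- Cyclically reduced words, indexed by the cyclic group. -/
def IsCyclicallyReduced {r n : ℕ} (w : ZMod n → Letter r) : Prop :=
  ∀ t, w (t + 1) ≠ (w t).bar

instance {r n : ℕ} [NeZero n] : DecidablePred (IsCyclicallyReduced (r := r) (n := n)) :=
  fun w => inferInstanceAs (Decidable (∀ t, w (t + 1) ≠ (w t).bar))

/-- The cyclically reduced words of length `n`. -/
def crWords (r n : ℕ) [NeZero n] : Finset (ZMod n → Letter r) :=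
  Finset.univ.filter IsCyclicallyReduced

lemma mem_crWords {r n : ℕ} [NeZero n] {w : ZMod n → Letter r} :
    w ∈ crWords r n ↔ IsCyclicallyReduced w := by
  simp [crWords]

/-- The closed walks following the cyclic word `w` in the Schreier graph. -/
def closedWalks {r n : ℕ} [NeZero n] {α : Type*} [Fintype α] [DecidableEq α]
    (σ : Fin r → Equiv.Perm α) (w : ZMod n → Letter r) : Finset (ZMod n → α) :=
  Finset.univ.filter fun i => ∀ t, letterPerm σ (w t) (i t) = i (t + 1)

lemma trace_nbMat_pow_eq_sum {r N : ℕ} (σ : Fin r → Equiv.Perm (Fin N)) (n : ℕ) [NeZero n] :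
    (nbMat σ ^ n).trace = ∑ w ∈ crWords r n, ((closedWalks σ w).card : ℝ) := by
  rw [Matrix.trace_pow_eq_sum, ← (Equiv.arrowProdEquivProdArrow _ _ _).symm.sum_comp,
    Fintype.sum_prod_type, crWords, Finset.sum_filter]
  refine Finset.sum_congr rfl fun w _ => ?_
  simp only [closedWalks, Finset.card_filter, nbMat, Matrix.of_apply, Finset.prod_boole,
    Equiv.arrowProdEquivProdArrow_symm_apply, Finset.mem_univ, true_imp_iff]
  push_cast
  split_ifs with h
  · refine Finset.sum_congr rfl fun i _ => if_congr ?_ rfl rfl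
    exact forall_congr' fun t => and_iff_left (h t)
  · refine Finset.sum_eq_zero fun i _ => if_neg fun h' => h fun t => (h' t).2

lemma eval_scaledT_two_mul_self (r : ℕ) (n : ℕ) :
    (scaledT (2 * r - 1) n).eval (2 * r : ℝ) = (2 * r - 1 : ℝ) ^ n + 1 := by
  induction n using Nat.twoStepInduction with
  | zero => simp [scaledT]; norm_num
  | one => simp [scaledT]
  | more n h1 h2 =>
    rw [scaledT, Polynomial.eval_sub, Polynomial.eval_mul, Polynomial.eval_mul, Polynomial.eval_X,
      Polynomial.eval_C, h1, h2]
    ring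

lemma card_crWords (r n : ℕ) [NeZero n] :
    ((crWords r n).card : ℝ) = (2 * r - 1) ^ n + 1 + (r - 1) * (1 + (-1) ^ n) := by
  have hA : schreierAdj (r := r) (N := 1) (fun _ => 1) =
      algebraMap ℝ (Matrix (Fin 1) (Fin 1) ℝ) (2 * r) := by
    ext i j
    rw [schreierAdj_apply]
    simp [Subsingleton.elim _ j, Matrix.algebraMap_matrix_apply, Fintype.card_prod, mul_comm]
  have h := trace_nbMat_pow_eq_sum (r := r) (N := 1) (fun _ => 1) n
  have h3 := trace_nbMat_pow (r := r) (N := 1) (fun _ => 1) (n - 1)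
  rw [Nat.sub_add_cancel (Nat.one_le_iff_ne_zero.2 (NeZero.ne n)), h, hA,
    Polynomial.aeval_algebraMap_apply] at h3
  simp only [Polynomial.coe_aeval_eq_eval, eval_scaledT_two_mul_self] at h3
  have h1 : ∀ w ∈ crWords r n, ((closedWalks (fun _ : Fin r => (1 : Equiv.Perm (Fin 1)))
      w).card : ℝ) = 1 := by
    intro w _
    rw [closedWalks, Finset.filter_true_of_mem fun i _ t => Subsingleton.elim _ _]
    simp
  rw [Finset.sum_congr rfl h1] at h3
  rw [Algebra.algebraMap_eq_smul_one, Matrix.trace_smul, Matrix.trace_one] at h3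
  simpa using h3

lemma card_crWords_le (r n : ℕ) (hr : 1 ≤ r) [NeZero n] :
    ((crWords r n).card : ℝ) ≤ 2 * (2 * r - 1) ^ n := by
  have hr' : (1 : ℝ) ≤ r := by exact_mod_cast hr
  rw [card_crWords]
  have hn : 1 ≤ n := Nat.one_le_iff_ne_zero.2 (NeZero.ne n)
  have h1 : (1 : ℝ) ≤ (2 * r - 1) ^ n := one_le_pow₀ (by linarith)
  rcases Nat.even_or_odd n with he | ho
  · have h2 : (2 * r - 1 : ℝ) ^ 1 ≤ (2 * r - 1) ^ n := pow_le_pow_right₀ (by linarith) hn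
    rw [he.neg_one_pow]
    linarith
  · rw [ho.neg_one_pow]
    linarith

end ClosedWalks

section PartialInjections

variable {α : Type*} [Fintype α] [DecidableEq α]

lemma card_perm_eq_on (S : Finset α) (π₀ : Equiv.Perm α) :
    Fintype.card {π : Equiv.Perm α // ∀ v ∈ S, π v = π₀ v} =
      (Fintype.card α - S.card).factorial := by
  have e1 : {π : Equiv.Perm α // ∀ v ∈ S, π v = π₀ v} ≃
      {ρ : Equiv.Perm α // ∀ v, ¬ (v ∉ S) → ρ v = v} :=
    (Equiv.mulLeft π₀⁻¹).subtypeEquiv fun π => by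
      refine forall_congr' fun v => ?_
      rw [not_not]
      refine forall_congr' fun _ => ?_
      simp [Equiv.symm_apply_eq]
  rw [Fintype.card_congr (e1.trans (Equiv.Perm.subtypeEquivSubtypePerm _).symm),
    Fintype.card_perm, Fintype.card_subtype_compl, Fintype.card_coe]

lemma card_perm_extending (R : Finset (α × α))
    (h1 : ∀ x ∈ R, ∀ y ∈ R, x.1 = y.1 → x = y) (h2 : ∀ x ∈ R, ∀ y ∈ R, x.2 = y.2 → x = y) :
    Fintype.card {π : Equiv.Perm α // ∀ x ∈ R, π x.1 = x.2} =
      (Fintype.card α - R.card).factorial := by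
  have hinj1 : Set.InjOn (Prod.fst : α × α → α) R := fun x hx y hy h => h1 x hx y hy h
  have hinj2 : Set.InjOn (Prod.snd : α × α → α) R := fun x hx y hy h => h2 x hx y hy h
  set S := R.image Prod.fst with hS
  have hSc : S.card = R.card := Finset.card_image_of_injOn hinj1
  let e1 : {x // x ∈ R} ≃ {v // v ∈ S} := Equiv.ofBijective
    (fun x => ⟨x.1.1, Finset.mem_image_of_mem _ x.2⟩)
    ⟨fun x y h => Subtype.ext (h1 _ x.2 _ y.2 (congrArg Subtype.val h)), fun ⟨v, hv⟩ => by
      obtain ⟨x, hx, rfl⟩ := Finset.mem_image.1 hv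
      exact ⟨⟨x, hx⟩, rfl⟩⟩
  let e2 : {x // x ∈ R} ≃ {v // v ∈ R.image Prod.snd} := Equiv.ofBijective
    (fun x => ⟨x.1.2, Finset.mem_image_of_mem _ x.2⟩)
    ⟨fun x y h => Subtype.ext (h2 _ x.2 _ y.2 (congrArg Subtype.val h)), fun ⟨v, hv⟩ => by
      obtain ⟨x, hx, rfl⟩ := Finset.mem_image.1 hv
      exact ⟨⟨x, hx⟩, rfl⟩⟩
  let π₀ : Equiv.Perm α := (e1.symm.trans e2).extendSubtype
  have hπ : ∀ x ∈ R, π₀ x.1 = x.2 := fun x hx => by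
    have hxS : x.1 ∈ S := Finset.mem_image_of_mem _ hx
    have h : π₀ x.1 = (e1.symm.trans e2) ⟨x.1, hxS⟩ :=
      Equiv.extendSubtype_apply_of_mem _ x.1 hxS
    have h' : e1.symm ⟨x.1, hxS⟩ = ⟨x, hx⟩ := e1.symm_apply_eq.2 rfl
    rw [h, Equiv.trans_apply, h']
    rfl
  rw [← hSc, ← card_perm_eq_on S π₀]
  refine Fintype.card_congr (Equiv.subtypeEquivRight fun π => ?_)
  rw [hS, Finset.forall_mem_image]
  exact forall₂_congr fun x hx => by rw [hπ x hx]

end PartialInjections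

section CyclicWords

variable {r n : ℕ} [NeZero n] {α β : Type*}

open Classical in
/-- The labelled oriented edges, together with their reversals, used by a cyclic path `f`
labelled by `w`. -/
def stepSet (w : ZMod n → Letter r) (f : ZMod n → α) : Finset (Letter r × α × α) :=
  Finset.univ.image (fun t => (w t, f t, f (t + 1))) ∪
    Finset.univ.image (fun t => ((w t).bar, f (t + 1), f t))

lemma mem_stepSet {w : ZMod n → Letter r} {f : ZMod n → α} {x : Letter r × α × α} :
    x ∈ stepSet w f ↔
      (∃ t, (w t, f t, f (t + 1)) = x) ∨ ∃ t, ((w t).bar, f (t + 1), f t) = x := by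
  simp [stepSet]

lemma fwd_mem_stepSet (w : ZMod n → Letter r) (f : ZMod n → α) (t : ZMod n) :
    (w t, f t, f (t + 1)) ∈ stepSet w f :=
  mem_stepSet.2 (Or.inl ⟨t, rfl⟩)

lemma bwd_mem_stepSet (w : ZMod n → Letter r) (f : ZMod n → α) (t : ZMod n) :
    ((w (t - 1)).bar, f t, f (t - 1)) ∈ stepSet w f :=
  mem_stepSet.2 (Or.inr ⟨t - 1, by simp⟩)

lemma swap_mem_stepSet {w : ZMod n → Letter r} {f : ZMod n → α} {a : Letter r} {v u : α}
    (h : (a, v, u) ∈ stepSet w f) : (a.bar, u, v) ∈ stepSet w f := by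
  rcases mem_stepSet.1 h with ⟨t, ht⟩ | ⟨t, ht⟩ <;> simp only [Prod.mk.injEq] at ht <;>
    obtain ⟨rfl, rfl, rfl⟩ := ht
  · exact mem_stepSet.2 (Or.inr ⟨t, rfl⟩)
  · exact mem_stepSet.2 (Or.inl ⟨t, by simp⟩)

open Classical in
/-- The number of edges labelled by the `k`-th generator. -/
def edgeCount (w : ZMod n → Letter r) (f : ZMod n → α) (k : Fin r) : ℕ :=
  ((stepSet w f).filter fun x => x.1 = (k, true)).card

/-- The path `f` can be realized by permutations. -/
def IsConsistent (w : ZMod n → Letter r) (f : ZMod n → α) : Prop :=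
  ∀ x ∈ stepSet w f, ∀ y ∈ stepSet w f, x.1 = y.1 → x.2.1 = y.2.1 → x = y

open Classical in
lemma stepSet_comp (w : ZMod n → Letter r) (f : ZMod n → α) (e : α ↪ β) :
    stepSet w (e ∘ f) = (stepSet w f).image fun x => (x.1, e x.2.1, e x.2.2) := by
  ext x
  simp only [mem_stepSet, Finset.mem_image, Function.comp_apply]
  constructor
  · rintro (⟨t, rfl⟩ | ⟨t, rfl⟩)
    · exact ⟨_, Or.inl ⟨t, rfl⟩, rfl⟩
    · exact ⟨_, Or.inr ⟨t, rfl⟩, rfl⟩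
  · rintro ⟨_, ⟨t, rfl⟩ | ⟨t, rfl⟩, rfl⟩
    · exact Or.inl ⟨t, rfl⟩
    · exact Or.inr ⟨t, rfl⟩

lemma stepMap_injective (e : α ↪ β) :
    Function.Injective fun x : Letter r × α × α => (x.1, e x.2.1, e x.2.2) := by
  rintro ⟨a, v, u⟩ ⟨a', v', u'⟩ h
  simpa [Prod.ext_iff] using h

lemma edgeCount_comp (w : ZMod n → Letter r) (f : ZMod n → α) (e : α ↪ β) (k : Fin r) :
    edgeCount w (e ∘ f) k = edgeCount w f k := by
  classical
  rw [edgeCount, stepSet_comp, Finset.filter_image,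
    Finset.card_image_of_injective _ (stepMap_injective e), edgeCount]

lemma isConsistent_comp (w : ZMod n → Letter r) (f : ZMod n → α) (e : α ↪ β) :
    IsConsistent w (e ∘ f) ↔ IsConsistent w f := by
  classical
  simp only [IsConsistent, stepSet_comp, Finset.forall_mem_image, EmbeddingLike.apply_eq_iff_eq,
    (stepMap_injective e).eq_iff]

lemma forall_letterPerm_iff_stepSet (w : ZMod n → Letter r) (f : ZMod n → α)
    (σ : Fin r → Equiv.Perm α) :
    (∀ t, letterPerm σ (w t) (f t) = f (t + 1)) ↔
      ∀ x ∈ stepSet w f, letterPerm σ x.1 x.2.1 = x.2.2 := by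
  constructor
  · intro h x hx
    rcases mem_stepSet.1 hx with ⟨t, rfl⟩ | ⟨t, rfl⟩
    · exact h t
    · simp only [← h t, letterPerm_bar_apply]
  · intro h t
    exact h _ (fwd_mem_stepSet w f t)

lemma forall_stepSet_iff (w : ZMod n → Letter r) (f : ZMod n → α)
    (σ : Fin r → Equiv.Perm α) :
    (∀ x ∈ stepSet w f, letterPerm σ x.1 x.2.1 = x.2.2) ↔
      ∀ k v u, ((k, true), v, u) ∈ stepSet w f → σ k v = u := by
  constructor
  · intro h k v u hx
    simpa [letterPerm] using h _ hx
  · rintro h ⟨⟨k, b⟩, v, u⟩ hx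
    cases b
    · have := h k u v (swap_mem_stepSet hx)
      simp [letterPerm, ← this]
    · simpa [letterPerm] using h k v u hx

open Classical in
lemma card_realizations (w : ZMod n → Letter r) {N : ℕ} (f : ZMod n → Fin N) :
    (Finset.univ.filter fun σ : Fin r → Equiv.Perm (Fin N) =>
      ∀ t, letterPerm σ (w t) (f t) = f (t + 1)).card =
      if IsConsistent w f then ∏ k, (N - edgeCount w f k).factorial else 0 := by
  split_ifs with hc
  · let R : Fin r → Finset (Fin N × Fin N) := fun k =>
      ((stepSet w f).filter fun x => x.1 = (k, true)).image Prod.snd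
    have hR : ∀ k v u, (v, u) ∈ R k ↔ ((k, true), v, u) ∈ stepSet w f := by
      intro k v u
      simp [R, Finset.mem_image]
    have hRc : ∀ k, (R k).card = edgeCount w f k := fun k => by
      refine Finset.card_image_of_injOn fun x hx y hy h => Prod.ext ?_ h
      exact (Finset.mem_filter.1 hx).2.trans (Finset.mem_filter.1 hy).2.symm
    rw [← Fintype.card_subtype]
    let e : {σ : Fin r → Equiv.Perm (Fin N) // ∀ t, letterPerm σ (w t) (f t) = f (t + 1)} ≃
        ∀ k, {π : Equiv.Perm (Fin N) // ∀ x ∈ R k, π x.1 = x.2} :=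
      (Equiv.subtypeEquivRight fun σ => by
        rw [forall_letterPerm_iff_stepSet, forall_stepSet_iff]
        refine forall_congr' fun k => ?_
        rw [Prod.forall]
        refine forall₂_congr fun v u => ?_
        rw [hR]).trans (Equiv.subtypePiEquivPi (p := fun k (π : Equiv.Perm (Fin N)) =>
          ∀ x ∈ R k, π x.1 = x.2))
    rw [Fintype.card_congr e, Fintype.card_pi]
    refine Finset.prod_congr rfl fun k _ => ?_
    rw [card_perm_extending, Fintype.card_fin, hRc]
    · rintro ⟨v, u⟩ hx ⟨v', u'⟩ hy h
      exact congrArg Prod.snd (hc _ ((hR _ _ _).1 hx) _ ((hR _ _ _).1 hy) rfl h)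
    · rintro ⟨v, u⟩ hx ⟨v', u'⟩ hy h
      have := hc _ (swap_mem_stepSet ((hR _ _ _).1 hx)) _ (swap_mem_stepSet ((hR _ _ _).1 hy))
        rfl h
      simp only [Prod.mk.injEq, true_and] at this
      simp [this]
  · rw [Finset.card_eq_zero, Finset.filter_eq_empty_iff]
    intro σ _ h
    rw [forall_letterPerm_iff_stepSet] at h
    refine hc fun x hx y hy h1 h2 => Prod.ext h1 (Prod.ext h2 ?_)
    rw [← h x hx, ← h y hy, h1, h2]

/-- Functions with a prescribed kernel are embeddings of the quotient. -/
def kerEquiv {γ : Type*} (s : Setoid γ) : {f : γ → β // Setoid.ker f = s} ≃ (Quotient s ↪ β) where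
  toFun f := ⟨Quotient.lift f.1 fun a b h => by
    have h' : s a b := h
    rw [← f.2] at h'
    exact h', by
      rintro ⟨a⟩ ⟨b⟩ h
      refine Quotient.sound ?_
      change s a b
      rw [← f.2]
      exact h⟩
  invFun e := ⟨e ∘ Quotient.mk s, by
    ext a b
    rw [Setoid.ker_def, Function.comp_apply, Function.comp_apply, e.injective.eq_iff,
      Quotient.eq]⟩
  left_inv f := rfl
  right_inv e := by
    ext x
    induction x using Quotient.inductionOn
    rfl

instance {γ : Type*} [Finite γ] : Finite (Setoid γ) :=
  Finite.of_injective (fun s : Setoid γ => fun a b => s a b) fun _ _ h =>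
    Setoid.ext fun a b => iff_of_eq (congrFun (congrFun h a) b)

instance {γ : Type*} [Finite γ] : Fintype (Setoid γ) := Fintype.ofFinite _

open Classical in
/-- The expected number of closed walks along a cyclic word, as a sum over the partitions. -/
lemma sum_card_closedWalks (w : ZMod n → Letter r) (N : ℕ) :
    ∑ σ : Fin r → Equiv.Perm (Fin N), (closedWalks σ w).card =
      ∑ s ∈ Finset.univ.filter fun s : Setoid (ZMod n) => IsConsistent w (Quotient.mk s),
        N.descFactorial (Fintype.card (Quotient s)) *
          ∏ k, (N - edgeCount w (Quotient.mk s) k).factorial := by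
  have h1 : ∑ σ : Fin r → Equiv.Perm (Fin N), (closedWalks σ w).card =
      ∑ f : ZMod n → Fin N,
        if IsConsistent w f then ∏ k, (N - edgeCount w f k).factorial else 0 := by
    simp_rw [closedWalks, Finset.card_filter]
    rw [Finset.sum_comm]
    refine Finset.sum_congr rfl fun f _ => ?_
    rw [← card_realizations, Finset.card_filter]
  rw [h1, ← Finset.sum_fiberwise (s := Finset.univ) (g := fun f : ZMod n → Fin N => Setoid.ker f),
    Finset.sum_filter]
  refine Finset.sum_congr rfl fun s _ => ?_
  rw [← Finset.sum_subtype_eq_sum_filter]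
  have h2 : ∀ e : Quotient s ↪ Fin N,
      (if IsConsistent w ((kerEquiv (β := Fin N) s).symm e).1 then
        ∏ k, (N - edgeCount w ((kerEquiv (β := Fin N) s).symm e).1 k).factorial else 0) =
      if IsConsistent w (Quotient.mk s) then
        ∏ k, (N - edgeCount w (Quotient.mk s) k).factorial else 0 := by
    intro e
    have : ((kerEquiv (β := Fin N) s).symm e).1 = e ∘ Quotient.mk s := rfl
    simp only [this, isConsistent_comp, edgeCount_comp]
  have h3 := (kerEquiv (β := Fin N) s).symm.sum_comp (fun f =>
      if IsConsistent w f.1 then ∏ k, (N - edgeCount w f.1 k).factorial else 0)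
  rw [Finset.sum_congr rfl fun e _ => h2 e] at h3
  rw [Finset.sum_const, Finset.card_univ, Fintype.card_embedding_eq, Fintype.card_fin] at h3
  convert h3.symm using 1
  · refine Finset.sum_congr ?_ fun _ _ => rfl
    ext
    simp
  · split_ifs <;> simp

end CyclicWords

section Euler

variable {r n : ℕ} [NeZero n] {α : Type*}

lemma card_stepSet (w : ZMod n → Letter r) (f : ZMod n → α) :
    (stepSet w f).card = 2 * ∑ k, edgeCount w f k := by
  classical
  have h1 : ∀ k, ((stepSet w f).filter fun x => x.1 = (k, false)).card = edgeCount w f k := by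
    intro k
    refine Finset.card_bij' (fun x _ => (x.1.bar, x.2.2, x.2.1))
      (fun x _ => (x.1.bar, x.2.2, x.2.1)) ?_ ?_ (by simp) (by simp)
    · rintro ⟨a, v, u⟩ hx
      obtain ⟨hx, rfl⟩ := Finset.mem_filter.1 hx
      exact Finset.mem_filter.2 ⟨swap_mem_stepSet hx, rfl⟩
    · rintro ⟨a, v, u⟩ hx
      obtain ⟨hx, rfl⟩ := Finset.mem_filter.1 hx
      exact Finset.mem_filter.2 ⟨swap_mem_stepSet hx, rfl⟩
  rw [Finset.card_eq_sum_card_fiberwise (f := Prod.fst) (t := Finset.univ)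
    fun _ _ => Finset.mem_coe.2 (Finset.mem_univ _), Fintype.sum_prod_type]
  simp only [Fintype.sum_bool, h1, Finset.mul_sum]
  refine Finset.sum_congr rfl fun k _ => ?_
  rw [two_mul, edgeCount]

open Classical in
lemma pair_subset_fiber (w : ZMod n → Letter r) (f : ZMod n → α) (t : ZMod n) :
    ({(w t, f t, f (t + 1)), ((w (t - 1)).bar, f t, f (t - 1))} : Finset _) ⊆
      (stepSet w f).filter fun x => x.2.1 = f t := by
  intro x hx
  rw [Finset.mem_insert, Finset.mem_singleton] at hx
  rcases hx with rfl | rfl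
  · exact Finset.mem_filter.2 ⟨fwd_mem_stepSet w f t, rfl⟩
  · exact Finset.mem_filter.2 ⟨bwd_mem_stepSet w f t, rfl⟩

open Classical in
lemma card_pair_eq_two {d : ℕ} {w : ZMod d → Letter r} (hw : IsCyclicallyReduced w)
    (f : ZMod d → α) (t : ZMod d) :
    ({(w t, f t, f (t + 1)), ((w (t - 1)).bar, f t, f (t - 1))} : Finset _).card = 2 := by
  refine Finset.card_pair fun h => ?_
  have := hw (t - 1)
  rw [sub_add_cancel] at this
  exact this (congrArg Prod.fst h)

open Classical in
lemma two_le_card_fiber {w : ZMod n → Letter r} (hw : IsCyclicallyReduced w) (f : ZMod n → α)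
    (t : ZMod n) : 2 ≤ ((stepSet w f).filter fun x => x.2.1 = f t).card :=
  (card_pair_eq_two hw f t).symm.le.trans (Finset.card_le_card (pair_subset_fiber w f t))

open Classical in
lemma card_stepSet_eq_sum_fiber (w : ZMod n → Letter r) (f : ZMod n → α) :
    (stepSet w f).card = ∑ v ∈ Finset.univ.image f,
      ((stepSet w f).filter fun x => x.2.1 = v).card := by
  refine Finset.card_eq_sum_card_fiberwise fun x hx => ?_
  rcases mem_stepSet.1 hx with ⟨t, rfl⟩ | ⟨t, rfl⟩ <;> simp

open Classical in
lemma card_image_eq_ncard_range {γ : Type*} [Fintype γ] (f : γ → α) :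
    (Finset.univ.image f).card = (Set.range f).ncard := by
  rw [← Set.ncard_coe_finset, Finset.coe_image, Finset.coe_univ, Set.image_univ]

lemma ncard_range_le_sum_edgeCount {w : ZMod n → Letter r} (hw : IsCyclicallyReduced w)
    (f : ZMod n → α) : (Set.range f).ncard ≤ ∑ k, edgeCount w f k := by
  classical
  rw [← card_image_eq_ncard_range]
  have h := card_stepSet w f
  rw [card_stepSet_eq_sum_fiber] at h
  have h1 : ∑ v ∈ Finset.univ.image f, 2 ≤ ∑ v ∈ Finset.univ.image f,
      ((stepSet w f).filter fun x => x.2.1 = v).card := by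
    refine Finset.sum_le_sum fun v hv => ?_
    obtain ⟨t, -, rfl⟩ := Finset.mem_image.1 hv
    exact two_le_card_fiber hw f t
  rw [Finset.sum_const, smul_eq_mul] at h1
  omega

lemma sum_edgeCount_le (w : ZMod n → Letter r) (f : ZMod n → α) :
    ∑ k, edgeCount w f k ≤ n := by
  classical
  have h : (stepSet w f).card ≤ n + n := (Finset.card_union_le _ _).trans
    (add_le_add (Finset.card_image_le.trans (by simp [ZMod.card]))
      (Finset.card_image_le.trans (by simp [ZMod.card])))
  rw [card_stepSet] at h
  omega

open Classical in
lemma fiber_eq_pair {w : ZMod n → Letter r} (hw : IsCyclicallyReduced w) {f : ZMod n → α}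
    (hE : ∑ k, edgeCount w f k = (Set.range f).ncard) (t : ZMod n) :
    ({(w t, f t, f (t + 1)), ((w (t - 1)).bar, f t, f (t - 1))} : Finset _) =
      (stepSet w f).filter fun x => x.2.1 = f t := by
  refine Finset.eq_of_subset_of_card_le (pair_subset_fiber w f t) ?_
  rw [card_pair_eq_two hw]
  have h := card_stepSet w f
  rw [card_stepSet_eq_sum_fiber, hE, ← card_image_eq_ncard_range, mul_comm, ← smul_eq_mul, ← Finset.sum_const, eq_comm] at h
  refine ((Finset.sum_eq_sum_iff_of_le fun v hv => ?_).1 h (f t)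
    (Finset.mem_image_of_mem f (Finset.mem_univ t))).symm.le
  obtain ⟨t, -, rfl⟩ := Finset.mem_image.1 hv
  exact two_le_card_fiber hw f t

lemma eq_or_eq_of_mem_stepSet {w : ZMod n → Letter r} (hw : IsCyclicallyReduced w)
    {f : ZMod n → α} (hE : ∑ k, edgeCount w f k = (Set.range f).ncard) {t : ZMod n}
    {x : Letter r × α × α} (hx : x ∈ stepSet w f) (hxt : x.2.1 = f t) :
    x = (w t, f t, f (t + 1)) ∨ x = ((w (t - 1)).bar, f t, f (t - 1)) := by
  classical
  have h : x ∈ (stepSet w f).filter fun x => x.2.1 = f t := Finset.mem_filter.2 ⟨hx, hxt⟩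
  rw [← fiber_eq_pair hw hE t] at h
  simpa using h

lemma eq_or_eq_of_apply_eq {w : ZMod n → Letter r} {f : ZMod n → α} (hE : ∀ t, ∀ x ∈ stepSet w f, x.2.1 = f t →
      x = (w t, f t, f (t + 1)) ∨ x = ((w (t - 1)).bar, f t, f (t - 1)))
    {t t' : ZMod n} (h : f t' = f t) :
    (w t' = w t ∧ f (t' + 1) = f (t + 1)) ∨
      (w t' = (w (t - 1)).bar ∧ f (t' + 1) = f (t - 1)) := by
  refine (hE t _ (fwd_mem_stepSet w f t') h).imp ?_ ?_ <;>
  · intro h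
    simp only [Prod.mk.injEq] at h
    exact ⟨h.1, h.2.2⟩

lemma exists_eq_bar_reflection (w : ZMod n → Letter r) (T : ZMod n)
    (h : ∀ x, w x = (w (T - x)).bar) : ¬ IsCyclicallyReduced w := by
  intro hw
  obtain ⟨m, rfl⟩ : ∃ m : ℕ, (m : ZMod n) = T := ⟨T.val, ZMod.natCast_zmod_val T⟩
  obtain ⟨j, rfl | rfl⟩ := Nat.even_or_odd' m
  · have h1 := h j
    rw [show ((2 * j : ℕ) : ZMod n) - j = j by push_cast; ring] at h1
    exact (w j).bar_ne h1.symm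
  · have h1 := h (j + 1)
    rw [show ((2 * j + 1 : ℕ) : ZMod n) - (j + 1) = j by push_cast; ring] at h1
    exact hw j h1

lemma shift_invariant_of_apply_eq {w : ZMod n → Letter r} (hw : IsCyclicallyReduced w)
    {f : ZMod n → α} (hE : ∀ t, ∀ x ∈ stepSet w f, x.2.1 = f t →
      x = (w t, f t, f (t + 1)) ∨ x = ((w (t - 1)).bar, f t, f (t - 1)))
    {t t' : ZMod n} (h : f t' = f t) (u : ZMod n) :
    w (t' + u) = w (t + u) ∧ f (t' + u) = f (t + u) := by
  obtain ⟨j, rfl⟩ : ∃ m : ℕ, (m : ZMod n) = u := ⟨u.val, ZMod.natCast_zmod_val u⟩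
  rcases eq_or_eq_of_apply_eq hE h with h1 | h1
  · have key : ∀ j : ℕ, w (t' + j) = w (t + j) ∧ f (t' + j + 1) = f (t + j + 1) := by
      intro j
      induction j with
      | zero => simpa using h1
      | succ j ih =>
        rcases eq_or_eq_of_apply_eq hE ih.2 with h3 | h3
        · push_cast
          rw [← add_assoc, ← add_assoc]
          exact h3
        · rw [add_sub_cancel_right, ← ih.1] at h3
          exact absurd h3.1 (hw _)
    refine ⟨(key j).1, ?_⟩
    cases j with
    | zero => simpa using h
    | succ j =>
      push_cast
      rw [← add_assoc, ← add_assoc]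
      exact (key j).2
  · exfalso
    have key : ∀ j : ℕ, w (t' + j) = (w (t - 1 - j)).bar ∧ f (t' + j + 1) = f (t - 1 - j) := by
      intro j
      induction j with
      | zero => simpa using h1
      | succ j ih =>
        have h2 := eq_or_eq_of_apply_eq hE ih.2
        rcases h2 with h3 | h3
        · exfalso
          refine hw (t' + j) ?_
          rw [h3.1, ih.1, Letter.bar_bar]
        · push_cast
          rw [show t' + ((j : ZMod n) + 1) = t' + j + 1 by ring,
            show t - 1 - ((j : ZMod n) + 1) = t - 1 - j - 1 by ring]
          exact h3
    refine exists_eq_bar_reflection w (t' + t - 1) (fun x => ?_) hw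
    obtain ⟨m, hm⟩ : ∃ m : ℕ, (m : ZMod n) = x - t' := ⟨_, ZMod.natCast_zmod_val _⟩
    have := (key m).1
    rw [hm] at this
    convert this using 3
    · ring
    · ring

/-- The partitions contributing to the leading order. -/
def IsTight (w : ZMod n → Letter r) (s : Setoid (ZMod n)) : Prop :=
  IsConsistent w (Quotient.mk s) ∧
    ∑ k, edgeCount w (Quotient.mk s) k = Nat.card (Quotient s)

lemma card_quotient_le_sum_edgeCount {w : ZMod n → Letter r} (hw : IsCyclicallyReduced w)
    (s : Setoid (ZMod n)) :
    Nat.card (Quotient s) ≤ ∑ k, edgeCount w (Quotient.mk s) k := by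
  have h := ncard_range_le_sum_edgeCount hw (Quotient.mk s)
  rwa [Quotient.mk_surjective.range_eq, Set.ncard_univ] at h

lemma IsTight.shift_invariant {w : ZMod n → Letter r} (hw : IsCyclicallyReduced w)
    {s : Setoid (ZMod n)} (hs : IsTight w s) {t t' : ZMod n} (h : s t' t) (u : ZMod n) :
    w (t' + u) = w (t + u) ∧ s (t' + u) (t + u) := by
  have hE : ∑ k, edgeCount w (Quotient.mk s) k = (Set.range (Quotient.mk s)).ncard := by
    rw [Quotient.mk_surjective.range_eq, Set.ncard_univ, hs.2]
  have := shift_invariant_of_apply_eq hw (f := Quotient.mk s)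
    (fun t x hx hxt => eq_or_eq_of_mem_stepSet hw hE hx hxt) (Quotient.sound h) u
  exact ⟨this.1, Quotient.exact this.2⟩

lemma isTight_bot {w : ZMod n → Letter r} (hw : IsCyclicallyReduced w) : IsTight w ⊥ := by
  classical
  have hinj : Function.Injective (Quotient.mk (⊥ : Setoid (ZMod n))) := fun a b h =>
    Quotient.exact h
  constructor
  · intro x hx y hy
    rcases mem_stepSet.1 hx with ⟨t, rfl⟩ | ⟨t, rfl⟩ <;>
      rcases mem_stepSet.1 hy with ⟨t', rfl⟩ | ⟨t', rfl⟩ <;> intro h1 h2 <;>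
      simp only [hinj.eq_iff] at h1 h2
    · rw [h2]
    · subst h2
      exact absurd h1 (hw _)
    · subst h2
      exact absurd h1.symm (hw _)
    · rw [add_right_cancel h2]
  · have h1 : Nat.card (Quotient (⊥ : Setoid (ZMod n))) = n := by
      rw [← Nat.card_congr (Equiv.ofBijective _ ⟨hinj, Quotient.mk_surjective⟩), Nat.card_zmod]
    refine le_antisymm ?_ (card_quotient_le_sum_edgeCount hw _)
    rw [h1]
    exact sum_edgeCount_le w _

lemma IsTight.exists_generator {w : ZMod n → Letter r} (hw : IsCyclicallyReduced w)
    {s : Setoid (ZMod n)} (hs : IsTight w s) :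
    ∃ g : ZMod n, (∀ t, w (t + g) = w t) ∧ ∀ a b, s a b ↔ a - b ∈ AddSubgroup.zmultiples g := by
  let H : AddSubgroup (ZMod n) :=
    { carrier := {a | s a 0}
      zero_mem' := s.refl 0
      add_mem' := fun {a b} ha hb => by
        have := (hs.shift_invariant hw ha b).2
        rw [zero_add] at this
        exact s.trans this hb
      neg_mem' := fun {a} ha => by
        have := (hs.shift_invariant hw ha (-a)).2
        rw [zero_add, add_neg_cancel] at this
        exact s.symm this }
  obtain ⟨⟨g, hg⟩, hgen⟩ := IsAddCyclic.exists_generator (α := H)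
  have hH : ∀ x, x ∈ AddSubgroup.zmultiples g ↔ x ∈ H := by
    intro x
    constructor
    · intro hx
      exact (AddSubgroup.zmultiples_le_of_mem hg) hx
    · intro hx
      obtain ⟨k, hk⟩ := AddSubgroup.mem_zmultiples_iff.1 (hgen ⟨x, hx⟩)
      exact AddSubgroup.mem_zmultiples_iff.2 ⟨k, congrArg Subtype.val hk⟩
  refine ⟨g, fun t => ?_, fun a b => ?_⟩
  · have := (hs.shift_invariant hw (show s g 0 from hg) t).1
    rwa [zero_add, add_comm] at this
  · rw [hH]
    constructor
    · intro h
      have := (hs.shift_invariant hw h (-b)).2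
      rw [← sub_eq_add_neg, ← sub_eq_add_neg, sub_self] at this
      exact this
    · intro h
      have := (hs.shift_invariant hw (show s (a - b) 0 from h) b).2
      rwa [sub_add_cancel, zero_add] at this

open Classical in
/-- The number of tight partitions is controlled by the number of periods. -/
lemma card_isTight_le {w : ZMod n → Letter r} (hw : IsCyclicallyReduced w) :
    ((Finset.univ.filter fun s => IsTight w s).erase ⊥).card ≤
      (Finset.univ.filter fun g : ZMod n => g ≠ 0 ∧ ∀ t, w (t + g) = w t).card := by
  choose! g hg1 hg2 using fun s (hs : IsTight w s) => hs.exists_generator hw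
  refine Finset.card_le_card_of_injOn g (fun s hs => ?_) fun s hs s' hs' h => ?_
  · obtain ⟨hne, hs⟩ := Finset.mem_erase.1 hs
    have hs := (Finset.mem_filter.1 hs).2
    refine Finset.mem_coe.2 (Finset.mem_filter.2 ⟨Finset.mem_univ _, fun h0 => hne ?_, hg1 s hs⟩)
    ext a b
    rw [hg2 s hs, h0]
    simp [sub_eq_zero]
  · have hs := (Finset.mem_filter.1 (Finset.mem_erase.1 hs).2).2
    have hs' := (Finset.mem_filter.1 (Finset.mem_erase.1 hs').2).2
    ext a b
    rw [hg2 s hs, hg2 s' hs', h]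

end Euler

section Periods

variable {r n : ℕ} [NeZero n]

lemma apply_add_zsmul_of_period {α : Type*} {d : ℕ} {w : ZMod d → α} {g : ZMod d}
    (hg : ∀ t, w (t + g) = w t) (x : ℤ) (t : ZMod d) : w (t + x * g) = w t := by
  have hnat : ∀ (m : ℕ) (t : ZMod d), w (t + m * g) = w t := by
    intro m
    induction m with
    | zero => simp
    | succ m ih =>
      intro t
      rw [show t + ((m + 1 : ℕ) : ZMod d) * g = t + m * g + g by push_cast; ring, hg, ih]
  obtain ⟨m, rfl | rfl⟩ := x.eq_nat_or_neg
  · simpa using hnat m t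
  · rw [← hnat m (t + _)]
    congr 1
    push_cast
    ring

lemma apply_natCast_mod_gcd {α : Type*} {w : ZMod n → α} {g : ZMod n}
    (hg : ∀ t, w (t + g) = w t) (m : ℕ) :
    w ((m % Nat.gcd g.val n : ℕ) : ZMod n) = w (m : ZMod n) := by
  set d := Nat.gcd g.val n
  have hd : (d : ZMod n) = (Nat.gcdA g.val n : ℤ) * g := by
    have h := congrArg (Int.cast : ℤ → ZMod n) (Nat.gcd_eq_gcd_ab g.val n)
    push_cast at h
    rw [ZMod.natCast_self, zero_mul, add_zero, ZMod.natCast_zmod_val, mul_comm] at h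
    exact h
  have h2 : (m : ZMod n) = ((m % d : ℕ) : ZMod n) +
      (((m / d : ℕ) * Nat.gcdA g.val n : ℤ) : ZMod n) * g := by
    conv_lhs => rw [← Nat.mod_add_div m d]
    rw [Nat.cast_add, Nat.cast_mul, hd, Int.cast_mul, Int.cast_natCast]
    ring
  rw [h2, apply_add_zsmul_of_period hg]

open Classical in
lemma card_periodic_le (hr : 1 ≤ r) {g : ZMod n} (hg : g ≠ 0) :
    (((crWords r n).filter fun w => ∀ t, w (t + g) = w t).card : ℝ) ≤
      2 * √(2 * r - 1) ^ n := by
  have hr' : (1 : ℝ) ≤ r := by exact_mod_cast hr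
  have hn : 0 < n := NeZero.pos n
  have hgpos : 0 < g.val := Nat.pos_of_ne_zero fun h => hg ((ZMod.val_eq_zero g).1 h)
  have hgn : g.val < n := ZMod.val_lt g
  set d := Nat.gcd g.val n with hd
  have hdn : d ∣ n := Nat.gcd_dvd_right _ _
  have hdpos : 0 < d := Nat.gcd_pos_of_pos_right _ hn
  have hdlt : d < n := (Nat.le_of_dvd hgpos (Nat.gcd_dvd_left _ _)).trans_lt hgn
  have h2d : 2 * d ≤ n := by
    obtain ⟨c, hc⟩ := hdn
    have hc2 : 2 ≤ c := by
      by_contra h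
      interval_cases c <;> omega
    rw [hc, mul_comm]
    exact Nat.mul_le_mul_left d hc2
  have : NeZero d := ⟨hdpos.ne'⟩
  have hcard : ((crWords r n).filter fun w => ∀ t, w (t + g) = w t).card ≤ (crWords r d).card := by
    refine Finset.card_le_card_of_injOn (fun w y => w (y.val : ZMod n)) (fun w hw => ?_)
      fun w hw w' hw' h => ?_
    · obtain ⟨hw, hper⟩ := Finset.mem_filter.1 hw
      refine Finset.mem_coe.2 (mem_crWords.2 fun y => ?_)
      have h1 : w (((y + 1).val : ℕ) : ZMod n) = w ((y.val : ZMod n) + 1) := by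
        have : (y + 1).val = (y.val + 1) % d := by
          rw [ZMod.val_add, ZMod.val_one_eq_one_mod, Nat.add_mod_mod]
        rw [this, apply_natCast_mod_gcd hper]
        push_cast
        rfl
      simp only [h1]
      exact mem_crWords.1 hw _
    · have hper := (Finset.mem_filter.1 hw).2
      have hper' := (Finset.mem_filter.1 hw').2
      funext t
      have h1 := congrFun h ((t.val : ℕ) : ZMod d)
      simp only [ZMod.val_natCast] at h1
      rw [apply_natCast_mod_gcd hper, apply_natCast_mod_gcd hper', ZMod.natCast_zmod_val] at h1
      exact h1
  have hs : (1 : ℝ) ≤ √(2 * r - 1) := Real.one_le_sqrt.2 (by linarith)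
  calc _ ≤ ((crWords r d).card : ℝ) := by exact_mod_cast hcard
    _ ≤ 2 * (2 * r - 1) ^ d := card_crWords_le r d hr
    _ = 2 * √(2 * r - 1) ^ (2 * d) := by rw [pow_mul, Real.sq_sqrt (by linarith)]
    _ ≤ 2 * √(2 * r - 1) ^ n := by gcongr

open Classical in
/-- The number of tight partitions. -/
def tightCount (w : ZMod n → Letter r) : ℕ := (Finset.univ.filter fun s => IsTight w s).card

lemma one_le_tightCount {w : ZMod n → Letter r} (hw : IsCyclicallyReduced w) :
    1 ≤ tightCount w := by
  classical
  exact Finset.card_pos.2 ⟨⊥, Finset.mem_filter.2 ⟨Finset.mem_univ _, isTight_bot hw⟩⟩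

lemma sum_tightCount_sub_one_le (hr : 1 ≤ r) :
    ∑ w ∈ crWords r n, ((tightCount w : ℝ) - 1) ≤ 2 * n * √(2 * r - 1) ^ n := by
  classical
  have h1 : ∀ w ∈ crWords r n, (tightCount w : ℝ) - 1 ≤
      ∑ g : ZMod n, if g ≠ 0 ∧ ∀ t, w (t + g) = w t then (1 : ℝ) else 0 := by
    intro w hw
    have hw := mem_crWords.1 hw
    have h2 := card_isTight_le hw
    rw [Finset.card_erase_of_mem (Finset.mem_filter.2 ⟨Finset.mem_univ _, isTight_bot hw⟩)] at h2
    rw [Finset.sum_boole, sub_le_iff_le_add]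
    have h3 : tightCount w ≤
        (Finset.univ.filter fun g : ZMod n => g ≠ 0 ∧ ∀ t, w (t + g) = w t).card + 1 :=
      Nat.le_add_of_sub_le h2
    exact_mod_cast h3
  refine (Finset.sum_le_sum h1).trans ?_
  rw [Finset.sum_comm]
  calc _ ≤ ∑ g : ZMod n, 2 * √(2 * r - 1 : ℝ) ^ n := by
        refine Finset.sum_le_sum fun g _ => ?_
        by_cases hg : g = 0
        · simp [hg]
        · refine le_trans (le_of_eq ?_) (card_periodic_le hr hg)
          simp [hg]
    _ = _ := by
        rw [Finset.sum_const, Finset.card_univ, ZMod.card, nsmul_eq_mul]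
        ring

end Periods

section MomentPolynomials

open Polynomial

/-- The polynomial `∏_{j < m} (1 - j x)`, whose value at `1 / N` is a normalized falling
factorial. -/
def fallPoly (m : ℕ) : ℝ[X] := ∏ j ∈ Finset.range m, (1 - C (j : ℝ) * X)

lemma natDegree_prod_one_sub_le (s : Finset ℕ) :
    (∏ j ∈ s, (1 - C (j : ℝ) * X)).natDegree ≤ s.card := by
  refine (natDegree_prod_le _ _).trans ?_
  rw [Finset.card_eq_sum_ones]
  refine Finset.sum_le_sum fun j _ => ?_
  compute_degree

lemma natDegree_fallPoly_le (m : ℕ) : (fallPoly m).natDegree ≤ m :=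
  (natDegree_prod_one_sub_le _).trans (by simp)

lemma eval_zero_prod_one_sub (s : Finset ℕ) :
    (∏ j ∈ s, (1 - C (j : ℝ) * X)).eval 0 = 1 := by
  rw [eval_prod]
  simp

lemma eval_zero_fallPoly (m : ℕ) : (fallPoly m).eval 0 = 1 := eval_zero_prod_one_sub _

lemma fallPoly_mul_prod_Ico {a q : ℕ} (h : a ≤ q) :
    fallPoly a * ∏ j ∈ Finset.Ico a q, (1 - C (j : ℝ) * X) = fallPoly q :=
  Finset.prod_range_mul_prod_Ico _ h

lemma eval_fallPoly {N m : ℕ} (hN : 1 ≤ N) (hm : m ≤ N) :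
    (fallPoly m).eval (1 / (N : ℝ)) = N.descFactorial m / (N : ℝ) ^ m := by
  have hN0 : (N : ℝ) ≠ 0 := by positivity
  rw [fallPoly, eval_prod, Nat.descFactorial_eq_prod_range, Nat.cast_prod,
    ← Finset.card_range m, ← Finset.prod_const, Finset.card_range, ← Finset.prod_div_distrib]
  refine Finset.prod_congr rfl fun j hj => ?_
  rw [Nat.cast_sub (by have := Finset.mem_range.1 hj; omega)]
  simp
  field_simp

lemma eval_fallPoly_pos {N m : ℕ} (hN : 1 ≤ N) (hm : m ≤ N) :
    0 < (fallPoly m).eval (1 / (N : ℝ)) := by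
  rw [eval_fallPoly hN hm]
  have : 0 < N.descFactorial m := Nat.descFactorial_pos.2 hm
  positivity

lemma abs_eval_zero_derivative_fallPoly_le (m : ℕ) :
    |(derivative (fallPoly m)).eval 0| ≤ (m : ℝ) ^ 2 := by
  induction m with
  | zero => simp [fallPoly]
  | succ m ih =>
    rw [fallPoly, Finset.prod_range_succ, ← fallPoly, derivative_mul]
    simp only [eval_add, eval_mul, derivative_sub, derivative_one, derivative_C_mul,
      derivative_X, eval_sub, eval_one, eval_C, eval_X, eval_zero, eval_zero_fallPoly]
    have h := abs_add_le ((derivative (fallPoly m)).eval 0) (-(m : ℝ))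
    rw [abs_neg, abs_of_nonneg (Nat.cast_nonneg m : (0 : ℝ) ≤ m)] at h
    calc _ = |(derivative (fallPoly m)).eval 0 + -(m : ℝ)| := by ring_nf
      _ ≤ (m : ℝ) ^ 2 + m := by linarith
      _ ≤ _ := by
        push_cast
        nlinarith [(Nat.cast_nonneg m : (0 : ℝ) ≤ m)]

lemma abs_eval_zero_derivative_fallPoly_pow_le (m r : ℕ) :
    |(derivative (fallPoly m ^ r)).eval 0| ≤ r * (m : ℝ) ^ 2 := by
  rw [derivative_pow]
  simp only [eval_mul, eval_C, eval_pow, eval_zero_fallPoly, one_pow, mul_one]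
  rw [abs_mul, abs_of_nonneg (Nat.cast_nonneg r : (0 : ℝ) ≤ r)]
  exact mul_le_mul_of_nonneg_left (abs_eval_zero_derivative_fallPoly_le m) (Nat.cast_nonneg r)

variable {r n : ℕ} [NeZero n]

open Classical in
/-- The polynomial giving, up to normalization, the expected number of closed walks along a
cyclic word as a function of `1 / N`. -/
def wordPoly (w : ZMod n → Letter r) (q : ℕ) : ℝ[X] :=
  ∑ s ∈ Finset.univ.filter fun s : Setoid (ZMod n) => IsConsistent w (Quotient.mk s),
    X ^ (∑ k, edgeCount w (Quotient.mk s) k - Nat.card (Quotient s)) *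
      fallPoly (Nat.card (Quotient s)) *
      ∏ k, ∏ j ∈ Finset.Ico (edgeCount w (Quotient.mk s) k) q, (1 - C (j : ℝ) * X)

lemma edgeCount_le {α : Type*} (w : ZMod n → Letter r) (f : ZMod n → α) (k : Fin r) :
    edgeCount w f k ≤ n :=
  (Finset.single_le_sum (f := fun k => edgeCount w f k) (fun _ _ => Nat.zero_le _)
    (Finset.mem_univ k)).trans (sum_edgeCount_le w f)

lemma natDegree_wordPoly_le {w : ZMod n → Letter r} (hw : IsCyclicallyReduced w) {q : ℕ}
    (hq : n ≤ q) : (wordPoly w q).natDegree ≤ r * q := by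
  refine natDegree_sum_le_of_forall_le _ _ fun s _ => ?_
  have h1 := card_quotient_le_sum_edgeCount hw s
  have h2 : ∑ k, (q - edgeCount w (Quotient.mk s) k) + ∑ k, edgeCount w (Quotient.mk s) k =
      r * q := by
    rw [← Finset.sum_add_distrib, Finset.sum_congr rfl fun k _ =>
      Nat.sub_add_cancel ((edgeCount_le w (Quotient.mk s) k).trans hq)]
    simp
  have h3 : (∏ k, ∏ j ∈ Finset.Ico (edgeCount w (Quotient.mk s) k) q,
      (1 - C (j : ℝ) * X)).natDegree ≤ ∑ k, (q - edgeCount w (Quotient.mk s) k) := by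
    refine (natDegree_prod_le _ _).trans (Finset.sum_le_sum fun k _ => ?_)
    exact (natDegree_prod_one_sub_le _).trans (by simp)
  have h4 := natDegree_fallPoly_le (Nat.card (Quotient s))
  refine natDegree_mul_le.trans ((add_le_add (natDegree_mul_le.trans
    (add_le_add (natDegree_X_pow_le _) h4)) h3).trans ?_)
  omega

lemma eval_zero_wordPoly {w : ZMod n → Letter r} (hw : IsCyclicallyReduced w) (q : ℕ) :
    (wordPoly w q).eval 0 = tightCount w := by
  classical
  rw [wordPoly, eval_finsetSum, tightCount, Finset.card_filter]
  push_cast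
  rw [Finset.sum_filter]
  refine Finset.sum_congr rfl fun s _ => ?_
  have h1 := card_quotient_le_sum_edgeCount hw s
  simp only [eval_mul, eval_pow, eval_X, eval_zero_fallPoly, mul_one, eval_prod (s := Finset.univ),
    eval_zero_prod_one_sub, Finset.prod_const_one]
  by_cases h2 : IsConsistent w (Quotient.mk s)
  · by_cases h3 : ∑ k, edgeCount w (Quotient.mk s) k = Nat.card (Quotient s)
    · rw [if_pos h2, if_pos (show IsTight w s from ⟨h2, h3⟩), h3]
      simp
    · rw [if_pos h2, if_neg fun h : IsTight w s => h3 h.2, zero_pow (by omega)]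
  · rw [if_neg h2, if_neg fun h : IsTight w s => h2 h.1]

lemma eval_wordPoly {w : ZMod n → Letter r} (hw : IsCyclicallyReduced w) {q N : ℕ}
    (hq : n ≤ q) (hqN : q ≤ N) :
    (wordPoly w q).eval (1 / (N : ℝ)) = (fallPoly q).eval (1 / (N : ℝ)) ^ r *
      (∑ σ : Fin r → Equiv.Perm (Fin N), ((closedWalks σ w).card : ℝ)) /
        (N.factorial : ℝ) ^ r := by
  classical
  have hN : 1 ≤ N := (Nat.one_le_iff_ne_zero.2 (NeZero.ne n)).trans (hq.trans hqN)
  have hN0 : (N : ℝ) ≠ 0 := by positivity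
  have hsum := congrArg (Nat.cast : ℕ → ℝ) (sum_card_closedWalks w N)
  push_cast at hsum
  rw [hsum, wordPoly, eval_finsetSum, Finset.mul_sum, Finset.sum_div]
  refine Finset.sum_congr rfl fun s _ => ?_
  set E := edgeCount w (Quotient.mk s) with hE
  have hVE := card_quotient_le_sum_edgeCount hw s
  rw [← hE] at hVE
  have hEn : ∑ k, E k ≤ n := sum_edgeCount_le w _
  have hEk : ∀ k, E k ≤ N := fun k => (edgeCount_le w _ k).trans (hq.trans hqN)
  rw [Nat.card_eq_fintype_card] at hVE ⊢
  set V := Fintype.card (Quotient s)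
  have h1 : ∀ k, (∏ j ∈ Finset.Ico (E k) q, (1 - C (j : ℝ) * X)).eval (1 / (N : ℝ)) =
      (fallPoly q).eval (1 / (N : ℝ)) * (N : ℝ) ^ E k * (N - E k).factorial / N.factorial := by
    intro k
    have h2 := congrArg (eval (1 / (N : ℝ)))
      (fallPoly_mul_prod_Ico (a := E k) (q := q) ((edgeCount_le w _ k).trans hq))
    rw [eval_mul, eval_fallPoly hN (hEk k)] at h2
    have h3 : ((N - E k).factorial : ℝ) * N.descFactorial (E k) = N.factorial := by
      exact_mod_cast Nat.factorial_mul_descFactorial (hEk k)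
    have h4 : ((N.descFactorial (E k) : ℕ) : ℝ) ≠ 0 := by
      exact_mod_cast (Nat.descFactorial_pos.2 (hEk k)).ne'
    have h5 : ((N - E k).factorial : ℝ) ≠ 0 := by positivity
    rw [← h2, ← h3]
    field_simp
  rw [eval_mul, eval_mul, eval_pow, eval_X, eval_prod, eval_fallPoly hN (by omega),
    Finset.prod_congr rfl fun k _ => h1 k, Finset.prod_div_distrib, Finset.prod_mul_distrib,
    Finset.prod_mul_distrib, Finset.prod_pow_eq_pow_sum]
  simp only [Finset.prod_const, Finset.card_univ, Fintype.card_fin]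
  have h6 : (N : ℝ) ^ (∑ k, E k) = (N : ℝ) ^ (∑ k, E k - V) * (N : ℝ) ^ V := by
    rw [← pow_add, Nat.sub_add_cancel hVE]
  rw [h6, one_div, inv_pow]
  field_simp

end MomentPolynomials

section ExpectedTraces

open Polynomial

variable {r N : ℕ}

/-- The linear statistic `h ↦ tr h(A) - h(2r)` of the adjacency matrix. -/
def specSum (σ : Fin r → Equiv.Perm (Fin N)) : ℝ[X] →ₗ[ℝ] ℝ :=
  Matrix.traceLinearMap (Fin N) ℝ ℝ ∘ₗ (aeval (schreierAdj σ)).toLinearMap - leval (2 * r : ℝ)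

lemma specSum_apply (σ : Fin r → Equiv.Perm (Fin N)) (h : ℝ[X]) :
    specSum σ h = (aeval (schreierAdj σ) h).trace - h.eval (2 * r : ℝ) := rfl

/-- The expectation of `specSum` over a uniform tuple of permutations. -/
def meanSpecSum (r N : ℕ) : ℝ[X] →ₗ[ℝ] ℝ :=
  ((N.factorial : ℝ) ^ r)⁻¹ • ∑ σ : Fin r → Equiv.Perm (Fin N), specSum σ

lemma meanSpecSum_apply (h : ℝ[X]) :
    meanSpecSum r N h =
      (∑ σ : Fin r → Equiv.Perm (Fin N), specSum σ h) / (N.factorial : ℝ) ^ r := by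
  simp [meanSpecSum, div_eq_inv_mul]

lemma card_fin_perm : (Fintype.card (Fin r → Equiv.Perm (Fin N)) : ℝ) = (N.factorial : ℝ) ^ r := by
  simp [Fintype.card_perm]

lemma specSum_scaledT (σ : Fin r → Equiv.Perm (Fin N)) (n : ℕ) [NeZero n] :
    specSum σ (scaledT (2 * r - 1) n) =
      ∑ w ∈ crWords r n, (((closedWalks σ w).card : ℝ) - 1) -
        (r - 1) * (1 + (-1) ^ n) * (N - 1) := by
  obtain ⟨m, rfl⟩ := Nat.exists_eq_add_one_of_ne_zero (NeZero.ne n)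
  have h1 := trace_nbMat_pow σ m
  have h2 := trace_nbMat_pow_eq_sum σ (m + 1)
  have h3 := card_crWords r (m + 1)
  rw [specSum_apply, eval_scaledT_two_mul_self, Finset.sum_sub_distrib, Finset.sum_const,
    nsmul_eq_mul, mul_one, h3, ← h2, h1]
  ring

lemma meanSpecSum_scaledT (r N n : ℕ) [NeZero n] :
    meanSpecSum r N (scaledT (2 * r - 1) n) =
      ∑ w ∈ crWords r n, ((∑ σ : Fin r → Equiv.Perm (Fin N), ((closedWalks σ w).card : ℝ)) /
        (N.factorial : ℝ) ^ r - 1) - (r - 1) * (1 + (-1) ^ n) * (N - 1) := by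
  have hN : (N.factorial : ℝ) ^ r ≠ 0 := by positivity
  rw [meanSpecSum_apply]
  simp only [specSum_scaledT]
  rw [Finset.sum_sub_distrib, Finset.sum_comm, Finset.sum_const, sub_div, Finset.card_univ,
    nsmul_eq_mul, card_fin_perm, mul_div_cancel_left₀ _ hN, Finset.sum_div]
  congr 1
  refine Finset.sum_congr rfl fun w _ => ?_
  rw [Finset.sum_sub_distrib, Finset.sum_const, Finset.card_univ, nsmul_eq_mul, card_fin_perm,
    sub_div, mul_one, div_self hN]

/-- The Chebyshev polynomial of the first kind of the interval `[-2√k, 2√k]`. -/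
def chebT (k : ℝ) (n : ℕ) : ℝ[X] := (Chebyshev.T ℝ n).comp (C (2 * √k)⁻¹ * X)

lemma eval_zero_derivative_X_mul (p : ℝ[X]) : (derivative (X * p)).eval 0 = p.eval 0 := by
  simp [derivative_mul]

lemma exists_moment_poly_zero (hr : 1 ≤ r) (q : ℕ) :
    ∃ G : ℝ[X], G.natDegree ≤ r * q + 1 ∧
      (∀ N : ℕ, q ≤ N → 1 ≤ N → G.eval (1 / (N : ℝ)) =
        (fallPoly q).eval (1 / (N : ℝ)) ^ r * meanSpecSum r N (chebT (2 * r - 1) 0) / N) ∧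
      |G.eval 0| ≤ r ∧ |(derivative G).eval 0| ≤ q + r * (1 + r * (q : ℝ) ^ 2) := by
  have hr1 : (1 : ℝ) ≤ r := by exact_mod_cast hr
  have hD := natDegree_fallPoly_le q
  have hD' := abs_eval_zero_derivative_fallPoly_pow_le q r
  refine ⟨(1 - X) * fallPoly q ^ r, ?_, fun N _ hN => ?_, ?_, ?_⟩
  · have h1 : (fallPoly q ^ r).natDegree ≤ r * q :=
      natDegree_pow_le.trans (Nat.mul_le_mul_left r hD)
    have h2 : (1 - X : ℝ[X]).natDegree ≤ 1 := by compute_degree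
    exact natDegree_mul_le.trans (by omega)
  · have hN0 : (N : ℝ) ≠ 0 := by positivity
    have hf : (N.factorial : ℝ) ^ r ≠ 0 := by positivity
    have h : meanSpecSum r N (chebT (2 * r - 1) 0) = N - 1 := by
      rw [meanSpecSum_apply]
      simp only [specSum_apply, chebT, Nat.cast_zero, Chebyshev.T_zero, one_comp, map_one,
        Matrix.trace_one, eval_one, Fintype.card_fin, Finset.sum_const, Finset.card_univ,
        nsmul_eq_mul, card_fin_perm]
      field_simp
    rw [h]
    simp only [eval_mul, eval_sub, eval_one, eval_X, eval_pow]
    field_simp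
  · simpa [eval_zero_fallPoly] using hr1
  · rw [derivative_mul]
    simp only [eval_add, eval_mul, derivative_sub, derivative_one, derivative_X, eval_sub,
      eval_one, eval_X, eval_zero, eval_pow, eval_zero_fallPoly, one_pow]
    rw [abs_le] at hD' ⊢
    have : (0 : ℝ) ≤ r * (q : ℝ) ^ 2 := by positivity
    have hq : (0 : ℝ) ≤ q := by positivity
    constructor <;> nlinarith

lemma exists_moment_poly_pos (hr : 1 ≤ r) {q n : ℕ} [NeZero n] (hn : n ≤ q) :
    ∃ G : ℝ[X], G.natDegree ≤ r * q + 1 ∧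
      (∀ N : ℕ, q ≤ N → 1 ≤ N → G.eval (1 / (N : ℝ)) =
        (fallPoly q).eval (1 / (N : ℝ)) ^ r * meanSpecSum r N (chebT (2 * r - 1) n) / N) ∧
      |G.eval 0| ≤ r ∧ |(derivative G).eval 0| ≤ q + r * (1 + r * (q : ℝ) ^ 2) := by
  have hr1 : (1 : ℝ) ≤ r := by exact_mod_cast hr
  have hs1 : 1 ≤ √(2 * r - 1 : ℝ) ^ n := one_le_pow₀ (Real.one_le_sqrt.2 (by linarith))
  set S := √(2 * r - 1 : ℝ) ^ n with hS
  have hD := natDegree_fallPoly_le q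
  have hD' := abs_eval_zero_derivative_fallPoly_pow_le q r
  have hDr : (fallPoly q ^ r).natDegree ≤ r * q :=
    natDegree_pow_le.trans (Nat.mul_le_mul_left r hD)
  set c : ℝ := (r - 1) * (1 + (-1) ^ n) with hc
  have hc2 : |c| ≤ 2 * (r - 1) := by
    rw [hc, abs_mul, abs_of_nonneg (by linarith), mul_comm]
    refine mul_le_mul_of_nonneg_right ?_ (by linarith)
    rcases neg_one_pow_eq_or ℝ n with h | h <;> rw [h] <;> norm_num
  set W : ℝ[X] := ∑ w ∈ crWords r n, (wordPoly w q - fallPoly q ^ r) with hW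
  have hW0 : W.eval 0 = ∑ w ∈ crWords r n, ((tightCount w : ℝ) - 1) := by
    rw [hW, eval_finsetSum]
    refine Finset.sum_congr rfl fun w hw => ?_
    rw [eval_sub, eval_zero_wordPoly (mem_crWords.1 hw), eval_pow, eval_zero_fallPoly, one_pow]
  have hW1 : 0 ≤ W.eval 0 := by
    rw [hW0]
    refine Finset.sum_nonneg fun w hw => ?_
    have : (1 : ℝ) ≤ tightCount w := by exact_mod_cast one_le_tightCount (mem_crWords.1 hw)
    linarith
  have hW2 : W.eval 0 ≤ 2 * n * S := hW0.trans_le (sum_tightCount_sub_one_le hr)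
  have hWd : W.natDegree ≤ r * q := by
    refine natDegree_sum_le_of_forall_le _ _ fun w hw => ?_
    exact (natDegree_sub_le _ _).trans (max_le (natDegree_wordPoly_le (mem_crWords.1 hw) hn) hDr)
  refine ⟨C (2 * S)⁻¹ * (X * W - C c * ((1 - X) * fallPoly q ^ r)), ?_, fun N hqN hN => ?_, ?_, ?_⟩
  · have h2 : (1 - X : ℝ[X]).natDegree ≤ 1 := by compute_degree
    refine (natDegree_C_mul_le _ _).trans ((natDegree_sub_le _ _).trans (max_le ?_ ?_))
    · exact natDegree_mul_le.trans (by rw [natDegree_X]; omega)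
    · exact (natDegree_C_mul_le _ _).trans (natDegree_mul_le.trans (by omega))
  · have hN0 : (N : ℝ) ≠ 0 := by positivity
    have h1 : (2 * S) * meanSpecSum r N (chebT (2 * r - 1) n) =
        meanSpecSum r N (scaledT (2 * r - 1) n) := by
      rw [scaledT_eq_comp _ (by linarith), ← chebT, C_mul', map_smul, smul_eq_mul]
    rw [meanSpecSum_scaledT, ← hc] at h1
    have h2 : W.eval (1 / (N : ℝ)) = (fallPoly q).eval (1 / (N : ℝ)) ^ r *
        ∑ w ∈ crWords r n, ((∑ σ : Fin r → Equiv.Perm (Fin N), ((closedWalks σ w).card : ℝ)) /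
        (N.factorial : ℝ) ^ r - 1) := by
      rw [hW, eval_finsetSum, Finset.mul_sum]
      refine Finset.sum_congr rfl fun w hw => ?_
      rw [eval_sub, eval_wordPoly (mem_crWords.1 hw) hn hqN, eval_pow]
      ring
    rw [eq_sub_iff_add_eq] at h1
    rw [← h1] at h2
    simp only [eval_mul, eval_C, eval_sub, eval_X, eval_one, eval_pow]
    rw [h2]
    field_simp
    ring
  · simp only [eval_mul, eval_C, eval_sub, eval_X, eval_one, eval_pow, eval_zero_fallPoly]
    simp only [zero_mul, zero_sub, one_pow, sub_zero, mul_one]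
    rw [abs_mul, abs_neg, abs_of_pos (by positivity), inv_mul_le_iff₀ (by positivity)]
    nlinarith
  · have h3 : (derivative (C (2 * S)⁻¹ * (X * W - C c * ((1 - X) * fallPoly q ^ r)))).eval 0 =
        (2 * S)⁻¹ * (W.eval 0 - c * ((derivative (fallPoly q ^ r)).eval 0 - 1)) := by
      simp only [derivative_C_mul, derivative_sub, eval_mul, eval_C, eval_sub,
        eval_zero_derivative_X_mul]
      rw [derivative_mul]
      simp only [eval_add, eval_mul, derivative_sub, derivative_one, derivative_X, eval_sub,
        eval_one, eval_X, eval_zero, eval_pow, eval_zero_fallPoly, one_pow]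
      ring
    rw [h3, abs_mul, abs_of_pos (by positivity), inv_mul_le_iff₀ (by positivity)]
    have hnq : (n : ℝ) ≤ q := by exact_mod_cast hn
    have h4 : |c * ((derivative (fallPoly q ^ r)).eval 0 - 1)| ≤
        2 * (r - 1) * (r * (q : ℝ) ^ 2 + 1) := by
      rw [abs_mul]
      refine mul_le_mul hc2 ?_ (abs_nonneg _) (by linarith)
      exact (abs_sub _ _).trans (by rw [abs_one]; linarith)
    have h5 : 2 * ((r : ℝ) - 1) * (r * (q : ℝ) ^ 2 + 1) ≤
        2 * S * (r * (1 + r * (q : ℝ) ^ 2)) := by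
      have : 2 * ((r : ℝ) - 1) * (r * (q : ℝ) ^ 2 + 1) ≤ 2 * (r * (1 + r * (q : ℝ) ^ 2)) := by
        nlinarith [sq_nonneg (q : ℝ)]
      refine this.trans ?_
      have h6 : 0 ≤ (r * (1 + r * (q : ℝ) ^ 2) : ℝ) := by positivity
      nlinarith
    calc _ ≤ |W.eval 0| + |c * ((derivative (fallPoly q ^ r)).eval 0 - 1)| := abs_sub _ _
      _ ≤ 2 * n * S + 2 * S * (r * (1 + r * (q : ℝ) ^ 2)) := by
        rw [abs_of_nonneg hW1]
        linarith
      _ ≤ _ := by nlinarith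

/-- The expected Chebyshev statistics are, up to normalization, polynomials in `1 / N`, with
control of the first two Taylor coefficients at `0`. -/
lemma exists_moment_poly (hr : 1 ≤ r) {q n : ℕ} (hn : n ≤ q) :
    ∃ G : ℝ[X], G.natDegree ≤ r * q + 1 ∧
      (∀ N : ℕ, q ≤ N → 1 ≤ N → G.eval (1 / (N : ℝ)) =
        (fallPoly q).eval (1 / (N : ℝ)) ^ r * meanSpecSum r N (chebT (2 * r - 1) n) / N) ∧
      |G.eval 0| ≤ r ∧ |(derivative G).eval 0| ≤ q + r * (1 + r * (q : ℝ) ^ 2) := by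
  rcases Nat.eq_zero_or_pos n with rfl | h
  · exact exists_moment_poly_zero hr q
  · have : NeZero n := ⟨h.ne'⟩
    exact exists_moment_poly_pos hr hn

end ExpectedTraces

section Spectral

open Matrix Polynomial Unitary

variable {ι : Type*} [Fintype ι]

/-- The all-ones matrix. -/
def onesMat (ι : Type*) : Matrix ι ι ℝ := Matrix.of fun _ _ => 1

variable {A : Matrix ι ι ℝ} {d : ℝ}

lemma mul_onesMat (hd : ∀ i, ∑ j, A i j = d) : A * onesMat ι = d • onesMat ι := by
  ext i j
  simp [Matrix.mul_apply, onesMat, hd]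

lemma onesMat_mul (hA : A.IsHermitian) (hd : ∀ i, ∑ j, A i j = d) :
    onesMat ι * A = d • onesMat ι := by
  ext i j
  have : ∀ k, A k j = A j k := fun k => by
    rw [← hA.apply k j]
    rfl
  simp [Matrix.mul_apply, onesMat, this, hd]

lemma onesMat_mul_onesMat : onesMat ι * onesMat ι = (Fintype.card ι : ℝ) • onesMat ι := by
  ext i j
  simp [Matrix.mul_apply, onesMat]

/-- The adjacency matrix with its trivial eigenvalue removed. -/
def deflate (A : Matrix ι ι ℝ) (d : ℝ) : Matrix ι ι ℝ := A - (d / Fintype.card ι) • onesMat ι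

lemma deflate_isHermitian (hA : A.IsHermitian) : (deflate A d).IsHermitian := by
  refine hA.sub ?_
  ext i j
  simp [onesMat]

lemma deflate_mulVec {v : ι → ℝ} (hv : ∑ i, v i = 0) : deflate A d *ᵥ v = A *ᵥ v := by
  have : onesMat ι *ᵥ v = 0 := by
    ext i
    simp [Matrix.mulVec, dotProduct, onesMat, hv]
  rw [deflate, sub_mulVec, smul_mulVec, this, smul_zero, sub_zero]

variable [DecidableEq ι]

lemma Matrix.IsHermitian.trace_aeval {B : Matrix ι ι ℝ} (hB : B.IsHermitian) (h : ℝ[X]) :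
    (aeval B h).trace = ∑ i, h.eval (hB.eigenvalues i) := by
  have h1 : aeval B h = conjStarAlgAut ℝ _ hB.eigenvectorUnitary
      (diagonal fun i => h.eval (hB.eigenvalues i)) := by
    have h2 : aeval (diagonal hB.eigenvalues) h =
        diagonal fun i => h.eval (hB.eigenvalues i) := by
      have := aeval_algHom_apply (diagonalAlgHom (n := ι) (α := ℝ) ℝ) hB.eigenvalues h
      simp only [diagonalAlgHom_apply] at this
      rw [this]
      congr 1
      ext i
      simp
    have h3 : B = conjStarAlgAut ℝ _ hB.eigenvectorUnitary (diagonal hB.eigenvalues) := by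
      simpa using! hB.spectral_theorem
    rw [← h2]
    conv_lhs => rw [h3]
    exact aeval_algHom_apply (conjStarAlgAut ℝ _ hB.eigenvectorUnitary).toAlgEquiv.toAlgHom _ h
  rw [h1, conjStarAlgAut_apply, Matrix.trace_mul_comm, ← mul_assoc]
  simp [Matrix.trace]

lemma Matrix.IsHermitian.norm_toEuclideanLin_le {B : Matrix ι ι ℝ} (hB : B.IsHermitian) {t : ℝ}
    (ht : 0 ≤ t) (h : ∀ i, |hB.eigenvalues i| ≤ t) (v : EuclideanSpace ℝ ι) :
    ‖toEuclideanLin B v‖ ≤ t * ‖v‖ := by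
  open scoped Matrix.Norms.L2Operator in
  have h3 : B = hB.eigenvectorUnitary * diagonal hB.eigenvalues *
      (star hB.eigenvectorUnitary : unitaryGroup ι ℝ) := by
    simpa using! hB.spectral_theorem
  have h4 : ‖B‖ ≤ t := by
    rw [h3, CStarRing.norm_mul_coe_unitary, CStarRing.norm_coe_unitary_mul, l2_opNorm_diagonal]
    exact (pi_norm_le_iff_of_nonneg ht).2 h
  exact (l2_opNorm_mulVec B v).trans (mul_le_mul_of_nonneg_right h4 (norm_nonneg v))

lemma Matrix.norm_toEuclideanLin_div_norm_le (A : Matrix ι ι ℝ) (v : EuclideanSpace ℝ ι) :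
    ‖toEuclideanLin A v‖ / ‖v‖ ≤ ‖toEuclideanCLM (𝕜 := ℝ) A‖ := by
  refine div_le_of_le_mul₀ (norm_nonneg _) (norm_nonneg _) ?_
  exact (toEuclideanCLM (𝕜 := ℝ) A).le_opNorm v

lemma restNormR_nonneg (A : Matrix ι ι ℝ) : 0 ≤ restNormR A :=
  Real.sSup_nonneg (by rintro _ ⟨v, -, -, rfl⟩; positivity)

lemma deflate_mul_onesMat [Nonempty ι] (hd : ∀ i, ∑ j, A i j = d) :
    deflate A d * onesMat ι = 0 := by
  have : (Fintype.card ι : ℝ) ≠ 0 := by positivity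
  rw [deflate, sub_mul, mul_onesMat hd, smul_mul_assoc, onesMat_mul_onesMat, smul_smul,
    div_mul_cancel₀ _ this, sub_self]

lemma aeval_deflate [Nonempty ι] (hA : A.IsHermitian) (hd : ∀ i, ∑ j, A i j = d) (h : ℝ[X]) :
    aeval (deflate A d) h =
      aeval A h + ((h.eval 0 - h.eval d) / Fintype.card ι) • onesMat ι := by
  have hN : (Fintype.card ι : ℝ) ≠ 0 := by positivity
  have hpow : ∀ m : ℕ, deflate A d ^ m =
      A ^ m + (((0 : ℝ) ^ m - d ^ m) / Fintype.card ι) • onesMat ι := by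
    intro m
    induction m with
    | zero => simp
    | succ m ih =>
      have h1 : onesMat ι * deflate A d = 0 := by
        rw [deflate, mul_sub, onesMat_mul hA hd, mul_smul_comm, onesMat_mul_onesMat, smul_smul,
          div_mul_cancel₀ _ hN, sub_self]
      have h2 : A ^ m * onesMat ι = d ^ m • onesMat ι := by
        clear ih
        induction m with
        | zero => simp
        | succ m ih => rw [pow_succ, mul_assoc, mul_onesMat hd, mul_smul_comm, ih, smul_smul,
            pow_succ, mul_comm]
      rw [pow_succ, ih, add_mul, smul_mul_assoc, h1, smul_zero, add_zero, deflate, mul_sub,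
        mul_smul_comm, h2, ← pow_succ, smul_smul, sub_eq_add_neg, ← neg_smul]
      congr 2
      rw [zero_pow (Nat.succ_ne_zero m)]
      ring
  induction h using Polynomial.induction_on' with
  | add p q hp hq =>
    rw [map_add, map_add, hp, hq, eval_add, eval_add]
    module
  | monomial m a =>
    rw [aeval_monomial, aeval_monomial, hpow, eval_monomial, eval_monomial,
      ← Algebra.smul_def, ← Algebra.smul_def, smul_add, smul_smul]
    congr 2
    ring

lemma sum_ofLp_eq_zero_of_deflate [Nonempty ι] (hA : A.IsHermitian) (hd : ∀ i, ∑ j, A i j = d)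
    {v : ι → ℝ} {μ : ℝ} (hμ : μ ≠ 0) (h : deflate A d *ᵥ v = μ • v) : ∑ i, v i = 0 := by
  have h1 : (fun _ : ι => (1 : ℝ)) ᵥ* deflate A d = 0 := by
    have h2 := deflate_mul_onesMat hd
    have h3 := (deflate_isHermitian (d := d) hA)
    ext j
    have h4 := congrFun (congrFun h2 j) j
    simp only [Matrix.mul_apply, onesMat, Matrix.of_apply, mul_one, Matrix.zero_apply] at h4
    simp only [Matrix.vecMul, dotProduct, one_mul, Pi.zero_apply]
    rw [← h4]
    refine Finset.sum_congr rfl fun k _ => ?_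
    rw [← h3.apply k j]
    rfl
  have h2 := congrArg (fun u => (fun _ : ι => (1 : ℝ)) ⬝ᵥ u) h
  simp only [Matrix.dotProduct_mulVec, h1, zero_dotProduct] at h2
  simp only [dotProduct, Pi.smul_apply, smul_eq_mul, one_mul, ← Finset.mul_sum] at h2
  exact (mul_eq_zero.1 h2.symm).resolve_left hμ

/-- The nontrivial spectrum of a symmetric matrix with nonnegative entries and constant row
sums, and its relation to `restNormR`. -/
lemma exists_nontrivial_eigenvalues [Nonempty ι] (hA : A.IsHermitian) (hd : ∀ i, ∑ j, A i j = d)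
    (hpos : ∀ i j, 0 ≤ A i j) :
    ∃ (μ : ι → ℝ) (i₀ : ι),
      (∀ h : ℝ[X], (aeval A h).trace - h.eval d = ∑ i ∈ Finset.univ.erase i₀, h.eval (μ i)) ∧
      (∀ i, |μ i| ≤ d) ∧ (∀ i, |μ i| ≤ restNormR A) ∧
      (∀ t, 0 ≤ t → t < restNormR A → ∃ i ∈ Finset.univ.erase i₀, t < |μ i|) := by
  have hB := deflate_isHermitian (d := d) hA
  have hN : (Fintype.card ι : ℝ) ≠ 0 := by positivity
  have hd0 : 0 ≤ d := by
    rw [← hd (Classical.arbitrary ι)]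
    exact Finset.sum_nonneg fun j _ => hpos _ j
  have hdet : (deflate A d).det = 0 := by
    refine exists_mulVec_eq_zero_iff.1 ⟨fun _ => 1, ?_, ?_⟩
    · intro h
      exact one_ne_zero (congrFun h (Classical.arbitrary ι))
    · ext i
      have h4 := congrFun (congrFun (deflate_mul_onesMat hd) i) i
      simpa [Matrix.mul_apply, onesMat, Matrix.mulVec, dotProduct] using h4
  obtain ⟨i₀, hi₀⟩ : ∃ i₀, hB.eigenvalues i₀ = 0 := by
    rw [hB.det_eq_prod_eigenvalues] at hdet
    obtain ⟨i, -, hi⟩ := Finset.prod_eq_zero_iff.1 hdet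
    exact ⟨i, by simpa using hi⟩
  have hvec : ∀ i, hB.eigenvalues i ≠ 0 →
      ∑ j, hB.eigenvectorBasis i j = 0 ∧
      A *ᵥ ⇑(hB.eigenvectorBasis i) = hB.eigenvalues i • ⇑(hB.eigenvectorBasis i) := by
    intro i hi
    have h1 := hB.mulVec_eigenvectorBasis i
    have h2 := sum_ofLp_eq_zero_of_deflate hA hd hi h1
    exact ⟨h2, by rw [← deflate_mulVec (d := d) h2, h1]⟩
  refine ⟨hB.eigenvalues, i₀, fun h => ?_, fun i => ?_, fun i => ?_, fun t ht htA => ?_⟩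
  · have h1 := hB.trace_aeval h
    rw [aeval_deflate hA hd, Matrix.trace_add, Matrix.trace_smul,
      ← Finset.add_sum_erase _ _ (Finset.mem_univ i₀), hi₀] at h1
    have h2 : (onesMat ι).trace = Fintype.card ι := by simp [Matrix.trace, onesMat]
    rw [h2, smul_eq_mul, div_mul_cancel₀ _ hN] at h1
    linarith
  · by_cases hi : hB.eigenvalues i = 0
    · rw [hi, abs_zero]
      exact hd0
    have h1 : Module.End.HasEigenvalue (Matrix.toLin' A) (hB.eigenvalues i) := by
      refine Module.End.hasEigenvalue_of_hasEigenvector (x := ⇑(hB.eigenvectorBasis i)) ?_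
      refine ⟨Module.End.mem_eigenspace_iff.2 ?_, ?_⟩
      · rw [Matrix.toLin'_apply, (hvec i hi).2]
      · intro h
        exact hB.eigenvectorBasis.orthonormal.ne_zero i (by ext j; exact congrFun h j)
    obtain ⟨k, hk⟩ := eigenvalue_mem_ball h1
    rw [Metric.mem_closedBall, Real.dist_eq] at hk
    have h2 := hd k
    rw [← Finset.add_sum_erase _ _ (Finset.mem_univ k)] at h2
    simp only [Real.norm_eq_abs, abs_of_nonneg (hpos _ _)] at hk
    have h3 := abs_sub_abs_le_abs_sub (hB.eigenvalues i) (A k k)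
    rw [abs_of_nonneg (hpos k k)] at h3
    linarith
  · by_cases hi : hB.eigenvalues i = 0
    · rw [hi, abs_zero]
      exact restNormR_nonneg A
    have hv : ‖hB.eigenvectorBasis i‖ = 1 := hB.eigenvectorBasis.orthonormal.1 i
    refine le_csSup ⟨‖toEuclideanCLM (𝕜 := ℝ) A‖, ?_⟩
      ⟨hB.eigenvectorBasis i, hB.eigenvectorBasis.orthonormal.ne_zero i, (hvec i hi).1, ?_⟩
    · rintro _ ⟨v, -, -, rfl⟩
      exact norm_toEuclideanLin_div_norm_le A v
    · rw [toLpLin_apply, (hvec i hi).2, WithLp.toLp_smul, norm_smul]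
      simp [hv]
  · by_contra! hcon
    refine htA.not_ge (Real.sSup_le ?_ ht)
    rintro _ ⟨v, hv0, hv, rfl⟩
    rw [div_le_iff₀ (norm_pos_iff.2 hv0)]
    have h1 := hB.norm_toEuclideanLin_le ht (fun i => ?_) v
    · rwa [toLpLin_apply, deflate_mulVec hv, ← toLpLin_apply] at h1
    · by_cases hi : i = i₀
      · rw [hi, hi₀, abs_zero]
        exact ht
      · exact hcon i (by simpa using hi)

end Spectral

section SchreierSpectrum

open Matrix Polynomial

variable {r N : ℕ}

lemma sum_schreierAdj (σ : Fin r → Equiv.Perm (Fin N)) (i : Fin N) :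
    ∑ j, schreierAdj σ i j = 2 * r := by
  simp only [schreierAdj_apply]
  rw [Finset.sum_comm]
  simp
  ring

lemma schreierAdj_nonneg (σ : Fin r → Equiv.Perm (Fin N)) (i j : Fin N) :
    0 ≤ schreierAdj σ i j := by
  rw [schreierAdj_apply]
  exact Finset.sum_nonneg fun a _ => by split_ifs <;> norm_num

lemma exists_schreier_eigenvalues (hN : 1 ≤ N) (σ : Fin r → Equiv.Perm (Fin N)) :
    ∃ (μ : Fin N → ℝ) (i₀ : Fin N),
      (∀ h : ℝ[X], specSum σ h = ∑ i ∈ Finset.univ.erase i₀, h.eval (μ i)) ∧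
      (∀ i, |μ i| ≤ 2 * r) ∧ (∀ i, |μ i| ≤ restNormR (schreierAdj σ)) ∧
      (∀ t, 0 ≤ t → t < restNormR (schreierAdj σ) → ∃ i ∈ Finset.univ.erase i₀, t < |μ i|) := by
  have : Nonempty (Fin N) := ⟨⟨0, hN⟩⟩
  exact exists_nontrivial_eigenvalues (schreierAdj_transpose σ) (sum_schreierAdj σ)
    (schreierAdj_nonneg σ)

end SchreierSpectrum

section LowerBound

open Matrix Polynomial

variable {r N : ℕ}

lemma two_mul_X_pow_eq_sum_U (m : ℕ) :
    (2 * X : ℝ[X]) ^ m =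
      ∑ i ∈ Finset.range (m + 1), (m.choose i : ℝ[X]) * Chebyshev.U ℝ (m - 2 * i : ℤ) := by
  induction m with
  | zero => simp
  | succ m ih =>
    have h1 : ∀ j : ℤ, 2 * X * Chebyshev.U ℝ j = Chebyshev.U ℝ (j + 1) + Chebyshev.U ℝ (j - 1) := by
      intro j
      have := Chebyshev.U_add_one ℝ j
      rw [this]
      ring
    rw [pow_succ, ih, Finset.sum_mul]
    have h2 : ∀ i ∈ Finset.range (m + 1), (m.choose i : ℝ[X]) * Chebyshev.U ℝ (m - 2 * i : ℤ) *
        (2 * X) = (m.choose i : ℝ[X]) * Chebyshev.U ℝ (m + 1 - 2 * i : ℤ) +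
          (m.choose i : ℝ[X]) * Chebyshev.U ℝ (m + 1 - 2 * (i + 1) : ℤ) := by
      intro i _
      rw [mul_assoc, mul_comm (Chebyshev.U ℝ _), h1, mul_add]
      congr 3 <;> ring_nf
    rw [Finset.sum_congr rfl h2, Finset.sum_add_distrib, Finset.sum_range_succ' _ (m + 1)]
    have h3 : ∀ i ∈ Finset.range (m + 1),
        ((m + 1).choose (i + 1) : ℝ[X]) * Chebyshev.U ℝ (((m + 1 : ℕ) : ℤ) - 2 * ((i + 1 : ℕ) : ℤ)) =
        (m.choose i : ℝ[X]) * Chebyshev.U ℝ (m + 1 - 2 * (i + 1) : ℤ) +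
        (m.choose (i + 1) : ℝ[X]) * Chebyshev.U ℝ (m + 1 - 2 * (i + 1) : ℤ) := by
      intro i _
      rw [Nat.choose_succ_succ]
      push_cast
      ring
    rw [Finset.sum_congr rfl h3, Finset.sum_add_distrib, add_comm (∑ i ∈ _, _), add_assoc]
    congr 1
    have h4 := Finset.sum_range_succ' (fun i => (m.choose i : ℝ[X]) *
      Chebyshev.U ℝ (m + 1 - 2 * i : ℤ)) (m + 1)
    rw [Finset.sum_range_succ, Nat.choose_succ_self, Nat.cast_zero, zero_mul, add_zero] at h4
    rw [h4]
    push_cast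
    simp

lemma two_mul_X_pow_two_mul_eq_sum_U (p : ℕ) :
    (2 * X : ℝ[X]) ^ (2 * p) = ∑ l ∈ Finset.range (p + 1),
      (((2 * p).choose (p + l) : ℝ[X]) - (2 * p).choose (p + l + 1)) *
        Chebyshev.U ℝ ((2 * l : ℕ) : ℤ) := by
  rw [two_mul_X_pow_eq_sum_U, show 2 * p + 1 = (p + 1) + p by ring, Finset.sum_range_add,
    ← Finset.sum_range_reflect _ (p + 1)]
  simp only [sub_mul, Finset.sum_sub_distrib]
  rw [sub_eq_add_neg]
  congr 1
  · refine Finset.sum_congr rfl fun l hl => ?_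
    have hl := Finset.mem_range.1 hl
    have h1 : p + 1 - 1 - l = p - l := by omega
    rw [h1, ← Nat.choose_symm_of_eq_add (show 2 * p = (p + l) + (p - l) by omega)]
    congr 2
    omega
  · rw [Finset.sum_range_succ, show p + p + 1 = 2 * p + 1 by ring, Nat.choose_succ_self,
      Nat.cast_zero, zero_mul, add_zero, ← Finset.sum_neg_distrib]
    refine Finset.sum_congr rfl fun l _ => ?_
    have h2 := Chebyshev.U_neg_sub_two ℝ ((2 * l : ℕ) : ℤ)
    rw [← mul_neg, ← h2]
    congr 2
    · congr 1
      ring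
    · push_cast
      ring

lemma choose_add_succ_le (p l : ℕ) : (2 * p).choose (p + l + 1) ≤ (2 * p).choose (p + l) := by
  have h := Nat.choose_succ_right_eq (2 * p) (p + l)
  refine Nat.le_of_mul_le_mul_right (c := p + l + 1) ?_ (by omega)
  rw [h]
  exact Nat.mul_le_mul_left _ (by omega)

lemma le_choose_sub_choose {p : ℕ} (hp : 1 ≤ p) :
    (4 : ℝ) ^ p / (2 * p * (p + 1)) ≤ ((2 * p).choose p : ℝ) - (2 * p).choose (p + 1) := by
  have h1 := Nat.choose_succ_right_eq (2 * p) p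
  rw [show 2 * p - p = p by omega] at h1
  have h2 := Nat.four_pow_le_two_mul_self_mul_centralBinom p hp
  rw [Nat.centralBinom] at h2
  have h1' : ((2 * p).choose (p + 1) : ℝ) * (p + 1) = (2 * p).choose p * p := by exact_mod_cast h1
  have h2' : (4 : ℝ) ^ p ≤ 2 * p * (2 * p).choose p := by exact_mod_cast h2
  have hp0 : (0 : ℝ) < p := by exact_mod_cast hp
  rw [div_le_iff₀ (by positivity)]
  have h3 : (((2 * p).choose p : ℝ) - (2 * p).choose (p + 1)) * (2 * p * (p + 1)) =
      2 * p * (2 * p).choose p := by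
    linear_combination (-(2 * p : ℝ)) * h1'
  rw [h3]
  exact h2'

lemma scaledU_eq_comp (k : ℝ) (hk : 0 < k) (n : ℕ) :
    scaledU k n = C (√k ^ n) * (Chebyshev.U ℝ n).comp (C (2 * √k)⁻¹ * X) := by
  have hs : √k ≠ 0 := (Real.sqrt_pos.2 hk).ne'
  have hss : √k * √k = k := Real.mul_self_sqrt hk.le
  have e3 : (2 : ℝ[X]).comp (C (2 * √k)⁻¹ * X) = C 2 := by simp [C_two]
  induction n using Nat.twoStepInduction with
  | zero => simp [scaledU]
  | one =>
    simp only [scaledU, Nat.cast_one, Chebyshev.U_one, mul_comp, X_comp, e3, ← mul_assoc, ← C_mul,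
      pow_one]
    rw [mul_comm (√k) 2, mul_inv_cancel₀ (by positivity)]
    simp
  | more n h1 h2 =>
    rw [scaledU, h1, h2]
    have : ((n + 2 : ℕ) : ℤ) = (n : ℤ) + 2 := by push_cast; ring
    rw [this, Chebyshev.U_add_two]
    have : ((n + 1 : ℕ) : ℤ) = (n : ℤ) + 1 := by push_cast; ring
    rw [this]
    simp only [sub_comp, mul_comp, X_comp]
    generalize (Chebyshev.U ℝ ((n : ℤ) + 1)).comp _ = P
    generalize (Chebyshev.U ℝ (n : ℤ)).comp _ = Q
    have e1 : (√k ^ (n + 2)) * 2 * (2 * √k)⁻¹ = √k ^ (n + 1) := by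
      field_simp
      ring
    have e2 : k * √k ^ n = √k ^ (n + 2) := by rw [pow_add, sq, hss]; ring
    rw [e3, ← mul_assoc (C k), ← C_mul, e2, ← e1]
    simp only [C_mul]
    ring

lemma le_trace_scaledU (hr : 1 ≤ r) (σ : Fin r → Equiv.Perm (Fin N)) (j : ℕ) :
    (N : ℝ) ≤ (aeval (schreierAdj σ) (scaledU (2 * r - 1) (2 * j))).trace := by
  have hr1 : (1 : ℝ) ≤ r := by exact_mod_cast hr
  induction j with
  | zero => simp [scaledU]
  | succ j ih =>
    have h1 := trace_nbMat_pow σ (2 * j + 1)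
    have h2 := trace_nbMat_pow_eq_sum σ (2 * j + 2)
    have h3 : (0 : ℝ) ≤ (nbMat σ ^ (2 * j + 2)).trace := by
      rw [h2]
      exact Finset.sum_nonneg fun _ _ => Nat.cast_nonneg _
    have h4 : ((-1 : ℝ)) ^ (2 * j + 1 + 1) = 1 := Even.neg_one_pow ⟨j + 1, by ring⟩
    rw [h4, scaledT_add_two, map_sub, Matrix.trace_sub, ← smul_eq_C_mul, map_smul,
      Matrix.trace_smul, smul_eq_mul] at h1
    rw [show 2 * (j + 1) = 2 * j + 2 by ring]
    have h5 : (2 * r - 1 : ℝ) * N ≤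
        (2 * r - 1) * (aeval (schreierAdj σ) (scaledU (2 * r - 1) (2 * j))).trace :=
      mul_le_mul_of_nonneg_left ih (by linarith)
    linarith

lemma le_trace_schreierAdj_pow (hr : 1 ≤ r) (σ : Fin r → Equiv.Perm (Fin N)) {p : ℕ} (hp : 1 ≤ p) :
    N * (2 * √(2 * r - 1 : ℝ)) ^ (2 * p) / (2 * p * (p + 1)) ≤ (schreierAdj σ ^ (2 * p)).trace := by
  have hr1 : (1 : ℝ) ≤ r := by exact_mod_cast hr
  set s := √(2 * r - 1 : ℝ) with hs
  have hs0 : 0 < s := Real.sqrt_pos.2 (by linarith)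
  set u : ℕ → ℝ := fun l => (aeval (schreierAdj σ)
    ((Chebyshev.U ℝ ((2 * l : ℕ) : ℤ)).comp (C (2 * s)⁻¹ * X))).trace with hu
  have hu1 : ∀ l, 0 ≤ u l := by
    intro l
    have h1 := le_trace_scaledU hr σ l
    rw [scaledU_eq_comp _ (by linarith), ← hs, ← smul_eq_C_mul, map_smul, Matrix.trace_smul,
      smul_eq_mul] at h1
    exact nonneg_of_mul_nonneg_right ((Nat.cast_nonneg N).trans h1) (by positivity)
  have hu0 : u 0 = N := by simp [hu]
  have h2 := congrArg (fun P : ℝ[X] => (aeval (schreierAdj σ)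
    (P.comp (C (2 * s)⁻¹ * X))).trace) (two_mul_X_pow_two_mul_eq_sum_U p)
  have h3 : ((2 * X : ℝ[X]) ^ (2 * p)).comp (C (2 * s)⁻¹ * X) =
      (s⁻¹) ^ (2 * p) • (X ^ (2 * p) : ℝ[X]) := by
    have : ((2 : ℝ[X])).comp (C (2 * s)⁻¹ * X) = C 2 := by simp [C_two]
    rw [pow_comp, mul_comp, X_comp, this, ← mul_assoc, ← C_mul, mul_pow, ← C_pow, smul_eq_C_mul]
    congr 3
    field_simp
  have h4 : (aeval (schreierAdj σ) ((∑ l ∈ Finset.range (p + 1),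
      (((2 * p).choose (p + l) : ℝ[X]) - (2 * p).choose (p + l + 1)) *
        Chebyshev.U ℝ ((2 * l : ℕ) : ℤ)).comp (C (2 * s)⁻¹ * X))).trace =
      ∑ l ∈ Finset.range (p + 1),
        (((2 * p).choose (p + l) : ℝ) - (2 * p).choose (p + l + 1)) * u l := by
    rw [Polynomial.sum_comp, map_sum, Matrix.trace_sum]
    refine Finset.sum_congr rfl fun l _ => ?_
    rw [← C_eq_natCast, ← C_eq_natCast, ← C_sub, mul_comp, C_comp, ← smul_eq_C_mul, map_smul,
      Matrix.trace_smul, smul_eq_mul]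
  simp only [h3, h4, map_smul, Matrix.trace_smul, smul_eq_mul, map_pow, aeval_X] at h2
  have h5 : (4 : ℝ) ^ p / (2 * p * (p + 1)) * N ≤ (s⁻¹) ^ (2 * p) * (schreierAdj σ ^ (2 * p)).trace := by
    rw [h2]
    calc _ ≤ (((2 * p).choose p : ℝ) - (2 * p).choose (p + 1)) * u 0 := by
          rw [hu0]
          exact mul_le_mul_of_nonneg_right (le_choose_sub_choose hp) (Nat.cast_nonneg N)
      _ ≤ _ := by
        refine Finset.single_le_sum (f := fun l =>
          (((2 * p).choose (p + l) : ℝ) - (2 * p).choose (p + l + 1)) * u l) (fun l _ => ?_)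
          (Finset.mem_range.2 (Nat.succ_pos p))
        refine mul_nonneg (sub_nonneg.2 ?_) (hu1 l)
        exact_mod_cast choose_add_succ_le p l
  rw [inv_pow, inv_mul_eq_div, le_div_iff₀ (by positivity)] at h5
  refine le_trans (le_of_eq ?_) h5
  rw [mul_pow, pow_mul 2 2 p]
  norm_num
  ring

lemma le_restNormR_pow (hr : 1 ≤ r) (hN : 1 ≤ N) (σ : Fin r → Equiv.Perm (Fin N)) {p : ℕ}
    (hp : 1 ≤ p) :
    (2 * √(2 * r - 1 : ℝ)) ^ (2 * p) / (2 * p * (p + 1)) - (2 * r) ^ (2 * p) / N ≤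
      restNormR (schreierAdj σ) ^ (2 * p) := by
  obtain ⟨μ, i₀, h1, -, h3, -⟩ := exists_schreier_eigenvalues hN σ
  have h4 := le_trace_schreierAdj_pow hr σ hp
  have h5 := h1 (X ^ (2 * p))
  rw [specSum_apply, map_pow, aeval_X, eval_pow, eval_X] at h5
  have h6 : ∑ i ∈ Finset.univ.erase i₀, (X ^ (2 * p) : ℝ[X]).eval (μ i) ≤
      N * restNormR (schreierAdj σ) ^ (2 * p) := by
    refine (Finset.sum_le_sum (g := fun _ => restNormR (schreierAdj σ) ^ (2 * p))
      fun i _ => ?_).trans ?_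
    · rw [eval_pow, eval_X, ← (even_two_mul p).pow_abs]
      exact pow_le_pow_left₀ (abs_nonneg _) (h3 i) _
    · rw [Finset.sum_const, nsmul_eq_mul]
      refine mul_le_mul_of_nonneg_right ?_ (pow_nonneg (restNormR_nonneg _) _)
      exact_mod_cast (Finset.card_le_univ _).trans (by simp)
  have hN0 : (0 : ℝ) < N := by exact_mod_cast hN
  rw [sub_le_iff_le_add, ← mul_le_mul_iff_right₀ hN0, mul_add _ (restNormR _ ^ _), mul_div_cancel₀ _ hN0.ne',
    ← mul_div_assoc]
  linarith

/-- The deterministic lower bound of Alon–Boppana type. -/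
lemma eventually_le_restNormR (hr : 1 ≤ r) {ε : ℝ} (hε : 0 < ε) :
    ∀ᶠ N : ℕ in atTop, ∀ σ : Fin r → Equiv.Perm (Fin N),
      2 * √(2 * r - 1 : ℝ) - ε ≤ restNormR (schreierAdj σ) := by
  have hr1 : (1 : ℝ) ≤ r := by exact_mod_cast hr
  set ρ := 2 * √(2 * r - 1 : ℝ) with hρ
  have hρ0 : 0 < ρ := mul_pos two_pos (Real.sqrt_pos.2 (by linarith))
  rcases lt_or_ge (ρ - ε) 0 with hb | hb
  · exact Eventually.of_forall fun N σ => hb.le.trans (restNormR_nonneg _)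
  set b := ρ - ε with hbdef
  have hx1 : |(b / ρ) ^ 2| < 1 := by
    rw [abs_of_nonneg (by positivity)]
    exact pow_lt_one₀ (by positivity) ((div_lt_one hρ0).2 (by linarith)) two_ne_zero
  have hlim : Tendsto (fun p : ℕ => 4 * ((p : ℝ) ^ 2 * ((b / ρ) ^ 2) ^ p)) atTop (nhds 0) := by
    simpa using (tendsto_pow_const_mul_const_pow_of_abs_lt_one 2 hx1).const_mul 4
  obtain ⟨p, hp, hp1⟩ := ((hlim.eventually (gt_mem_nhds one_pos)).and
    (eventually_ge_atTop 1)).exists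
  have hp0 : (1 : ℝ) ≤ p := by exact_mod_cast hp1
  have hgap : b ^ (2 * p) < ρ ^ (2 * p) / (2 * p * (p + 1)) := by
    rw [lt_div_iff₀ (by positivity)]
    rw [div_pow, div_pow, ← pow_mul, ← pow_mul, ← mul_div_assoc, ← mul_div_assoc,
      div_lt_one (by positivity)] at hp
    refine lt_of_le_of_lt ?_ hp
    have : (0 : ℝ) ≤ b ^ (2 * p) * (p * (p - 1)) :=
      mul_nonneg (by positivity) (mul_nonneg (by linarith) (by linarith))
    linarith
  have hlim2 : Tendsto (fun N : ℕ => (2 * r : ℝ) ^ (2 * p) / N) atTop (nhds 0) :=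
    tendsto_const_div_atTop_nhds_zero_nat _
  filter_upwards [hlim2.eventually (gt_mem_nhds (sub_pos.2 hgap)), eventually_ge_atTop 1]
    with N hN hN1 σ
  by_contra! hcon
  have h1 := le_restNormR_pow hr hN1 σ hp1
  have h2 := pow_le_pow_left₀ (restNormR_nonneg _) hcon.le (2 * p)
  linarith

end LowerBound

section UpperBound

open Polynomial

variable {r N : ℕ}

lemma eval_fallPoly_le_one {m : ℕ} (hN : 1 ≤ N) (hm : m ≤ N) :
    (fallPoly m).eval (1 / (N : ℝ)) ≤ 1 := by
  rw [eval_fallPoly hN hm]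
  refine div_le_one_of_le₀ ?_ (by positivity)
  exact_mod_cast Nat.descFactorial_le_pow N m

lemma half_le_eval_fallPoly_pow {q : ℕ} (hN : 1 ≤ N) (hq : q ≤ N) (h : 2 * (r * q ^ 2) ≤ N) :
    1 / 2 ≤ (fallPoly q).eval (1 / (N : ℝ)) ^ r := by
  have hN0 : (0 : ℝ) < N := by exact_mod_cast hN
  have hqN : (q : ℝ) / N ≤ 1 := (div_le_one hN0).2 (by exact_mod_cast hq)
  have h1 : (1 - (q : ℝ) / N) ^ q ≤ (fallPoly q).eval (1 / (N : ℝ)) := by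
    rw [fallPoly, eval_prod]
    refine (Finset.prod_le_prod (s := Finset.range q) (f := fun _ => 1 - (q : ℝ) / N)
      (fun _ _ => by linarith) fun j hj => ?_).trans_eq' (by simp)
    simp only [eval_sub, eval_one, eval_mul, eval_C, eval_X, mul_one_div]
    have : (j : ℝ) / N ≤ q / N := by
      gcongr
      exact (Finset.mem_range.1 hj).le
    linarith
  have h2 := one_add_mul_le_pow (a := -((q : ℝ) / N)) (by linarith) (q * r)
  calc (1 / 2 : ℝ) ≤ 1 + (q * r : ℕ) * -((q : ℝ) / N) := by
        have h3 : (2 * (r * q ^ 2) : ℝ) ≤ N := by exact_mod_cast h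
        have h4 : (r * q ^ 2 : ℝ) / N ≤ 1 / 2 := by
          rw [div_le_iff₀ hN0]
          linarith
        have h5 : (q * r : ℝ) * ((q : ℝ) / N) = r * q ^ 2 / N := by ring
        push_cast
        linarith
    _ ≤ (1 + -((q : ℝ) / N)) ^ (q * r) := h2
    _ = ((1 - (q : ℝ) / N) ^ q) ^ r := by rw [pow_mul, ← sub_eq_add_neg]
    _ ≤ _ := by
      refine pow_le_pow_left₀ (pow_nonneg ?_ _) h1 r
      linarith

lemma specSum_nonneg (hN : 1 ≤ N) (σ : Fin r → Equiv.Perm (Fin N)) {h : ℝ[X]}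
    (h0 : ∀ x : ℝ, |x| ≤ 2 * r → 0 ≤ h.eval x) : 0 ≤ specSum σ h := by
  obtain ⟨μ, i₀, h1, h2, -, -⟩ := exists_schreier_eigenvalues hN σ
  rw [h1]
  exact Finset.sum_nonneg fun i _ => h0 _ (h2 i)

lemma specSum_le (hN : 1 ≤ N) (σ : Fin r → Equiv.Perm (Fin N)) {h : ℝ[X]}
    (h0 : ∀ x : ℝ, |x| ≤ 2 * r → h.eval x ≤ 1) : specSum σ h ≤ N := by
  obtain ⟨μ, i₀, h1, h2, -, -⟩ := exists_schreier_eigenvalues hN σ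
  rw [h1]
  refine (Finset.sum_le_sum fun i _ => h0 _ (h2 i)).trans ?_
  rw [Finset.sum_const, nsmul_eq_mul, mul_one]
  exact_mod_cast (Finset.card_le_univ _).trans (by simp)

lemma le_specSum (hN : 1 ≤ N) (σ : Fin r → Equiv.Perm (Fin N)) {h : ℝ[X]} {t c : ℝ} (ht : 0 ≤ t)
    (h0 : ∀ x : ℝ, |x| ≤ 2 * r → 0 ≤ h.eval x)
    (hc : ∀ x : ℝ, |x| ≤ 2 * r → t < |x| → c ≤ h.eval x)
    (hσ : t < restNormR (schreierAdj σ)) : c ≤ specSum σ h := by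
  obtain ⟨μ, i₀, h1, h2, -, h4⟩ := exists_schreier_eigenvalues hN σ
  obtain ⟨i, hi, hti⟩ := h4 t ht hσ
  rw [h1]
  exact (hc _ (h2 i) hti).trans
    (Finset.single_le_sum (f := fun i => h.eval (μ i)) (fun i _ => h0 _ (h2 i)) hi)

open Classical in
/-- Markov's inequality for the linear statistic of `h`. -/
lemma card_restNormR_mul_le (hN : 1 ≤ N) {h : ℝ[X]} {t c : ℝ} (ht : 0 ≤ t)
    (h0 : ∀ x : ℝ, |x| ≤ 2 * r → 0 ≤ h.eval x)
    (hc : ∀ x : ℝ, |x| ≤ 2 * r → t < |x| → c ≤ h.eval x) :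
    ((Finset.univ.filter fun σ : Fin r → Equiv.Perm (Fin N) =>
      t < restNormR (schreierAdj σ)).card : ℝ) * c ≤
      (N.factorial : ℝ) ^ r * meanSpecSum r N h := by
  have hf : (N.factorial : ℝ) ^ r ≠ 0 := by positivity
  rw [meanSpecSum_apply, mul_div_cancel₀ _ hf, ← nsmul_eq_mul, ← Finset.sum_const]
  refine (Finset.sum_le_sum fun σ hσ => le_specSum hN σ ht h0 hc (Finset.mem_filter.1 hσ).2).trans ?_
  exact Finset.sum_le_sum_of_subset_of_nonneg (Finset.filter_subset _ _)
    fun σ _ _ => specSum_nonneg hN σ h0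

lemma exists_moment_poly_of_bound (hr : 1 ≤ r) {h : ℝ[X]} {q : ℕ} (hq : h.natDegree ≤ q) {δ : ℝ}
    (hδ : ∀ x : ℝ, |x| ≤ 2 * √(2 * r - 1) → |h.eval x| ≤ δ) :
    ∃ G : ℝ[X], G.natDegree ≤ r * q + 1 ∧
      (∀ N : ℕ, q ≤ N → 1 ≤ N → G.eval (1 / (N : ℝ)) =
        (fallPoly q).eval (1 / (N : ℝ)) ^ r * meanSpecSum r N h / N) ∧
      |G.eval 0| ≤ (q + 1) * (2 * δ * r) ∧
      |(derivative G).eval 0| ≤ (q + 1) * (2 * δ * (q + r * (1 + r * (q : ℝ) ^ 2))) := by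
  have hr1 : (1 : ℝ) ≤ r := by exact_mod_cast hr
  set ρ := 2 * √(2 * r - 1 : ℝ) with hρ
  have hρ0 : 0 < ρ := mul_pos two_pos (Real.sqrt_pos.2 (by linarith))
  have hδ0 : 0 ≤ δ := (abs_nonneg _).trans (hδ 0 (by simpa using hρ0.le))
  obtain ⟨b, hb, hbδ⟩ := exists_bounded_chebyshev_expansion q (h.comp (C ρ * X))
    (by
      refine natDegree_comp_le.trans ?_
      have : (C ρ * X : ℝ[X]).natDegree ≤ 1 := (natDegree_C_mul_le _ _).trans natDegree_X_le
      nlinarith) δ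
    (fun x hx => by
      rw [eval_comp]
      refine hδ _ ?_
      simp only [eval_mul, eval_C, eval_X, abs_mul, abs_of_pos hρ0]
      exact mul_le_of_le_one_right hρ0.le (abs_le.2 hx))
  have hh : h = ∑ n ∈ Finset.range (q + 1), b n • chebT (2 * r - 1) n := by
    have h1 := congrArg (fun P : ℝ[X] => P.comp (C ρ⁻¹ * X)) hb
    simp only [comp_assoc, Polynomial.sum_comp, smul_comp, mul_comp, C_comp, X_comp] at h1
    rw [← mul_assoc, ← C_mul, mul_inv_cancel₀ hρ0.ne', C_1, one_mul, comp_X] at h1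
    exact h1
  choose! G hG1 hG2 hG3 hG4 using fun n (hn : n ≤ q) => exists_moment_poly hr hn
  have hle : ∀ n ∈ Finset.range (q + 1), n ≤ q := fun n hn => by
    have := Finset.mem_range.1 hn
    omega
  have hsum : ∀ (f : ℕ → ℝ) (c : ℝ), (∀ n ≤ q, |f n| ≤ c) →
      |∑ n ∈ Finset.range (q + 1), b n * f n| ≤ (q + 1) * (2 * δ * c) := by
    intro f c hf
    refine (Finset.abs_sum_le_sum_abs _ _).trans ((Finset.sum_le_card_nsmul _ _ (2 * δ * c)
      fun n hn => ?_).trans_eq (by simp))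
    rw [abs_mul]
    exact mul_le_mul (hbδ n (hle n hn)) (hf n (hle n hn)) (abs_nonneg _) (by positivity)
  refine ⟨∑ n ∈ Finset.range (q + 1), b n • G n, ?_, fun N hqN hN => ?_, ?_, ?_⟩
  · exact natDegree_sum_le_of_forall_le _ _ fun n hn =>
      (natDegree_smul_le _ _).trans (hG1 n (hle n hn))
  · rw [eval_finsetSum]
    conv_rhs => rw [hh]
    rw [map_sum, Finset.mul_sum, Finset.sum_div]
    refine Finset.sum_congr rfl fun n hn => ?_
    rw [eval_smul, hG2 n (hle n hn) N hqN hN, map_smul, smul_eq_mul, smul_eq_mul]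
    ring
  · simp only [eval_finsetSum, eval_smul, smul_eq_mul]
    exact hsum _ _ hG3
  · simp only [derivative_sum, derivative_smul, eval_finsetSum, eval_smul, smul_eq_mul]
    exact hsum _ _ hG4

lemma meanSpecSum_nonneg (hN : 1 ≤ N) {h : ℝ[X]}
    (h0 : ∀ x : ℝ, |x| ≤ 2 * r → 0 ≤ h.eval x) : 0 ≤ meanSpecSum r N h := by
  rw [meanSpecSum_apply]
  exact div_nonneg (Finset.sum_nonneg fun σ _ => specSum_nonneg hN σ h0) (by positivity)

lemma meanSpecSum_le (hN : 1 ≤ N) {h : ℝ[X]}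
    (h1 : ∀ x : ℝ, |x| ≤ 2 * r → h.eval x ≤ 1) : meanSpecSum r N h ≤ N := by
  rw [meanSpecSum_apply, div_le_iff₀ (by positivity)]
  refine (Finset.sum_le_card_nsmul _ _ (N : ℝ) fun σ _ => specSum_le hN σ h1).trans_eq ?_
  rw [Finset.card_univ, nsmul_eq_mul, card_fin_perm, mul_comm]

lemma meanSpecSum_le_of_bound (hr : 1 ≤ r) {h : ℝ[X]} {q : ℕ} (hq : h.natDegree ≤ q) (hq1 : 1 ≤ q)
    {δ : ℝ} (hδ : ∀ x : ℝ, |x| ≤ 2 * √(2 * r - 1) → |h.eval x| ≤ δ)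
    (h0 : ∀ x : ℝ, |x| ≤ 2 * r → 0 ≤ h.eval x) (h1 : ∀ x : ℝ, |x| ≤ 2 * r → h.eval x ≤ 1)
    (hN : 8 * (r * q + 2) ^ 3 ≤ N) :
    meanSpecSum r N h ≤
      4 * N * δ * (r * q + 2 : ℝ) ^ 3 + 4096 * (r * q + 2 : ℝ) ^ 12 / N := by
  obtain ⟨G, hG1, hG2, hG3, hG4⟩ := exists_moment_poly_of_bound hr hq hδ
  have hδ0 : 0 ≤ δ := (abs_nonneg _).trans (hδ 0 (by simp))
  have hrq : q ≤ r * q := Nat.le_mul_of_pos_left q hr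
  have hrq' : r ≤ r * q := Nat.le_mul_of_pos_right r hq1
  set K := r * q + 2 with hK
  have hK2 : K ^ 2 ≤ K ^ 3 := Nat.pow_le_pow_right (by omega) (by norm_num)
  have hK1 : K ≤ K ^ 2 := by nlinarith
  have hqN : q ≤ N := by omega
  have hN1 : 1 ≤ N := by omega
  have hD : 2 * (r * q ^ 2) ≤ N := by
    have : r * q ^ 2 ≤ K ^ 2 := by nlinarith
    omega
  have hN0 : (1 : ℝ) ≤ N := by exact_mod_cast hN1
  have hGM : ∀ N : ℕ, q ≤ N → 1 ≤ N → |G.eval (1 / (N : ℝ))| ≤ 1 := by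
    intro N hqN hN1
    have hp := (eval_fallPoly_pos hN1 hqN).le
    have hN0 : (0 : ℝ) < N := by exact_mod_cast hN1
    rw [hG2 N hqN hN1, abs_of_nonneg
      (div_nonneg (mul_nonneg (pow_nonneg hp r) (meanSpecSum_nonneg hN1 h0)) hN0.le)]
    refine (div_le_one hN0).2 ((mul_le_of_le_one_left (meanSpecSum_nonneg hN1 h0) ?_).trans
      (meanSpecSum_le hN1 h1))
    exact pow_le_one₀ hp (eval_fallPoly_le_one hN1 hqN)
  have htaylor := abs_eval_sub_taylor_le (r * q + 1) q (8 * K ^ 3) G hG1 1 hGM (by omega)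
    (by rw [hK]) (x := 1 / (N : ℝ)) ⟨by positivity, one_div_le_one_div_of_le (by positivity)
      (by exact_mod_cast hN)⟩
  have hKc : ((r * q + 1 : ℕ) : ℝ) + 1 = K := by
    rw [hK]
    push_cast
    ring
  have hKr : (r * q + 2 : ℝ) = K := by
    rw [hK]
    push_cast
    ring
  rw [hKr]
  rw [hKc] at htaylor
  push_cast at htaylor
  have hq0 : (1 : ℝ) ≤ q := by exact_mod_cast hq1
  have hr0 : (1 : ℝ) ≤ r := by exact_mod_cast hr
  have h2 : |G.eval 0| + |(derivative G).eval 0| ≤ 2 * δ * (K : ℝ) ^ 3 := by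
    have e1 : (q + 1 : ℝ) ≤ K := by rw [← hKr]; nlinarith
    have e2 : r + (q + r * (1 + r * (q : ℝ) ^ 2)) ≤ (K : ℝ) ^ 2 := by rw [← hKr]; nlinarith
    calc _ ≤ (q + 1) * (2 * δ * r) + (q + 1) * (2 * δ * (q + r * (1 + r * (q : ℝ) ^ 2))) :=
          add_le_add hG3 hG4
      _ = 2 * δ * ((q + 1) * (r + (q + r * (1 + r * (q : ℝ) ^ 2)))) := by ring
      _ ≤ 2 * δ * (K * (K : ℝ) ^ 2) := by gcongr
      _ = _ := by ring
  have h3 : |G.eval (1 / (N : ℝ))| ≤ 2 * δ * (K : ℝ) ^ 3 + 2048 * (K : ℝ) ^ 12 / (N : ℝ) ^ 2 := by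
    have e1 : |(derivative G).eval 0 * (1 / (N : ℝ))| ≤ |(derivative G).eval 0| := by
      rw [abs_mul, abs_of_nonneg (by positivity : (0 : ℝ) ≤ 1 / N)]
      exact mul_le_of_le_one_right (abs_nonneg _) ((div_le_one (by linarith)).2 hN0)
    have e2 : 32 * (K : ℝ) ^ 6 * (8 * (K : ℝ) ^ 3) ^ 2 * 1 * (1 / (N : ℝ)) ^ 2 =
        2048 * (K : ℝ) ^ 12 / (N : ℝ) ^ 2 := by
      ring
    rw [e2] at htaylor
    have e3 := abs_add_le (G.eval (1 / (N : ℝ)) - G.eval 0 - (derivative G).eval 0 * (1 / (N : ℝ)))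
      (G.eval 0 + (derivative G).eval 0 * (1 / (N : ℝ)))
    have e4 := abs_add_le (G.eval 0) ((derivative G).eval 0 * (1 / (N : ℝ)))
    rw [show ∀ a b c : ℝ, a - b - c + (b + c) = a by intros; ring] at e3
    linarith
  have h4 : meanSpecSum r N h / (2 * N) ≤ |G.eval (1 / (N : ℝ))| := by
    refine le_trans ?_ (le_abs_self _)
    rw [hG2 N hqN hN1, ← div_div]
    refine div_le_div_of_nonneg_right ?_ (by linarith)
    have := mul_le_mul_of_nonneg_right (half_le_eval_fallPoly_pow hN1 hqN hD)
      (meanSpecSum_nonneg (r := r) hN1 h0)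
    linarith
  rw [div_le_iff₀ (by linarith)] at h4
  calc _ ≤ |G.eval (1 / (N : ℝ))| * (2 * N) := h4
    _ ≤ (2 * δ * (K : ℝ) ^ 3 + 2048 * (K : ℝ) ^ 12 / (N : ℝ) ^ 2) * (2 * N) := by gcongr
    _ = _ := by
      field_simp
      ring

lemma exists_test_poly {ρ ε : ℝ} (hε : 0 < ε) (D : ℝ) :
    ∃ g : ℝ[X], (∀ x, |x| ≤ D → 0 ≤ g.eval x ∧ g.eval x ≤ 1) ∧
      (∀ x, |x| ≤ D → |x| ≤ ρ → g.eval x ≤ 1 / 6) ∧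
      (∀ x, |x| ≤ D → ρ + ε < |x| → 5 / 6 ≤ g.eval x) := by
  obtain ⟨p, hp⟩ := exists_polynomial_near_of_continuousOn (-D) D
    (fun x => min 1 (max 0 ((|x| - ρ) / ε))) (by fun_prop) (1 / 10) (by norm_num)
  have hg : ∀ x, (C (5 / 6) * (p + C (1 / 10)) : ℝ[X]).eval x = 5 / 6 * (p.eval x + 1 / 10) := by
    intro x
    simp
  refine ⟨C (5 / 6) * (p + C (1 / 10)), fun x hx => ?_, fun x hx hxρ => ?_, fun x hx hxρ => ?_⟩
  all_goals
    rw [hg]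
    have h1 := abs_lt.1 (hp x (abs_le.1 hx))
  · have h2 : 0 ≤ min 1 (max 0 ((|x| - ρ) / ε)) := le_min zero_le_one (le_max_left _ _)
    have h3 : min 1 (max 0 ((|x| - ρ) / ε)) ≤ 1 := min_le_left _ _
    constructor <;> linarith [h1.1, h1.2]
  · have h2 : (|x| - ρ) / ε ≤ 0 := div_nonpos_of_nonpos_of_nonneg (by linarith) hε.le
    rw [max_eq_left h2, min_eq_right zero_le_one] at h1
    linarith [h1.1, h1.2]
  · have h2 : 1 ≤ (|x| - ρ) / ε := (one_le_div hε).2 (by linarith)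
    rw [max_eq_right (by linarith), min_eq_left h2] at h1
    linarith [h1.1, h1.2]

end UpperBound

section

open Polynomial Equiv Topology

lemma two_mul_sqrt_le {r : ℕ} (hr : 1 ≤ r) : 2 * √(2 * r - 1 : ℝ) ≤ 2 * r := by
  have hr1 : (1 : ℝ) ≤ r := by exact_mod_cast hr
  refine mul_le_mul_of_nonneg_left (Real.sqrt_le_iff.2 ⟨by linarith, ?_⟩) two_pos.le
  nlinarith [sq_nonneg ((r : ℝ) - 1)]

open Classical in
lemma card_restNormR_div_le {r : ℕ} (hr : 1 ≤ r) {g : ℝ[X]} {t : ℝ} (ht : 0 ≤ t)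
    (hg : ∀ x : ℝ, |x| ≤ 2 * r → 0 ≤ g.eval x ∧ g.eval x ≤ 1)
    (hg1 : ∀ x : ℝ, |x| ≤ 2 * r → |x| ≤ 2 * √(2 * r - 1) → g.eval x ≤ 1 / 6)
    (hg2 : ∀ x : ℝ, |x| ≤ 2 * r → t < |x| → 5 / 6 ≤ g.eval x)
    {N J m : ℕ} (hm : g.natDegree ≤ m) (hm1 : 1 ≤ m) (hJ : 1 ≤ J)
    (hN : N ≤ 4 ^ J) (hJN : 4 ^ J ≤ 4 * N) (hlarge : 32 * (((r * m + 2) * J) ^ 3) ≤ 4 ^ J) :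
    ((Finset.univ.filter fun σ : Fin r → Perm (Fin N) =>
      t < restNormR (schreierAdj σ)).card : ℝ) / (N.factorial : ℝ) ^ r ≤
      4 * ((r * m + 2 : ℝ) * J) ^ 3 * (4 / 5) ^ J +
        16384 * ((r * m + 2 : ℝ) * J) ^ 12 * (3 / 10) ^ J := by
  have hN1 : 1 ≤ N := by
    have : 0 < 4 ^ J := by positivity
    omega
  have hN0 : (0 : ℝ) < N := by exact_mod_cast hN1
  have hK : r * (J * m) + 2 ≤ (r * m + 2) * J := by nlinarith
  have hK' : (r * ((J * m : ℕ) : ℝ) + 2) ≤ (r * m + 2 : ℝ) * J := by exact_mod_cast hK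
  have hmean := meanSpecSum_le_of_bound (N := N) (h := g ^ J) (q := J * m) (δ := (1 / 6) ^ J) hr
    (natDegree_pow_le_of_le J hm) (Nat.mul_pos hJ hm1)
    (fun x hx => by
      have hx2 := hx.trans (two_mul_sqrt_le hr)
      rw [eval_pow, abs_pow, abs_of_nonneg (hg x hx2).1]
      exact pow_le_pow_left₀ (hg x hx2).1 (hg1 x hx2 hx) J)
    (fun x hx => by rw [eval_pow]; exact pow_nonneg (hg x hx).1 J)
    (fun x hx => by rw [eval_pow]; exact pow_le_one₀ (hg x hx).1 (hg x hx).2)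
    (by
      have := Nat.pow_le_pow_left hK 3
      omega)
  have hcard := card_restNormR_mul_le (r := r) (h := g ^ J) (c := (5 / 6) ^ J) hN1 ht
    (fun x hx => by rw [eval_pow]; exact pow_nonneg (hg x hx).1 J)
    (fun x hx hx2 => by rw [eval_pow]; exact pow_le_pow_left₀ (by norm_num) (hg2 x hx hx2) J)
  have hNJ : (N : ℝ) ≤ 4 ^ J := by exact_mod_cast hN
  have hJN' : (4 : ℝ) ^ J ≤ 4 * N := by exact_mod_cast hJN
  rw [div_le_iff₀ (by positivity)]
  refine le_of_mul_le_mul_right (hcard.trans ?_) (show (0 : ℝ) < (5 / 6) ^ J by positivity)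
  set K := (r * m + 2 : ℝ) * J
  have h3 : (r * ((J * m : ℕ) : ℝ) + 2) ^ 3 ≤ K ^ 3 := pow_le_pow_left₀ (by positivity) hK' 3
  have h12 : (r * ((J * m : ℕ) : ℝ) + 2) ^ 12 ≤ K ^ 12 := pow_le_pow_left₀ (by positivity) hK' 12
  have hfirst : 4 * N * (1 / 6 : ℝ) ^ J * (r * ((J * m : ℕ) : ℝ) + 2) ^ 3 ≤
      4 * K ^ 3 * ((4 / 5) ^ J * (5 / 6) ^ J) := by
    calc _ ≤ 4 * 4 ^ J * (1 / 6 : ℝ) ^ J * K ^ 3 := by gcongr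
      _ = 4 * K ^ 3 * ((4 : ℝ) * (1 / 6)) ^ J := by rw [mul_pow (4 : ℝ)]; ring
      _ = _ := by rw [← mul_pow]; norm_num
  have hsecond : 4096 * (r * ((J * m : ℕ) : ℝ) + 2) ^ 12 / N ≤
      16384 * K ^ 12 * ((3 / 10) ^ J * (5 / 6) ^ J) := by
    rw [div_le_iff₀ hN0]
    calc _ ≤ 4096 * K ^ 12 * 1 := by rw [mul_one]; gcongr
      _ = 4096 * K ^ 12 * ((3 / 10 : ℝ) ^ J * (5 / 6) ^ J * 4 ^ J) := by
        rw [← mul_pow, ← mul_pow]; norm_num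
      _ ≤ 4096 * K ^ 12 * ((3 / 10 : ℝ) ^ J * (5 / 6) ^ J * (4 * N)) := by gcongr
      _ = _ := by ring
  calc _ ≤ (4 * K ^ 3 * ((4 / 5) ^ J * (5 / 6) ^ J) +
        16384 * K ^ 12 * ((3 / 10) ^ J * (5 / 6) ^ J)) * (N.factorial : ℝ) ^ r := by
        rw [mul_comm]
        gcongr
        exact hmean.trans (add_le_add hfirst hsecond)
    _ = _ := by ring

lemma tendsto_mul_pow_mul_pow (c a : ℝ) (k : ℕ) {b : ℝ} (hb : |b| < 1) :
    Tendsto (fun J : ℕ => a * (c * J) ^ k * b ^ J) atTop (𝓝 0) := by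
  have h := (tendsto_pow_const_mul_const_pow_of_abs_lt_one k hb).const_mul (a * c ^ k)
  rw [mul_zero] at h
  refine h.congr fun J => ?_
  rw [mul_pow]
  ring

open Classical in
lemma tendsto_card_lt_restNormR {r : ℕ} (hr : 1 ≤ r) {ε : ℝ} (hε : 0 < ε) :
    Tendsto (fun N : ℕ => ((Finset.univ.filter fun σ : Fin r → Perm (Fin N) =>
      2 * √(2 * r - 1 : ℝ) + ε < restNormR (schreierAdj σ)).card : ℝ) / (N.factorial : ℝ) ^ r)
      atTop (𝓝 0) := by
  obtain ⟨g, hg, hg1, hg2⟩ := exists_test_poly (ρ := 2 * √(2 * r - 1 : ℝ)) hε (2 * r)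
  set m := g.natDegree + 1
  have hlog : Tendsto (fun N : ℕ => Nat.log 4 N + 1) atTop atTop := by
    refine tendsto_atTop_mono (fun N => Nat.le_succ _) (tendsto_atTop.2 fun k => ?_)
    filter_upwards [eventually_ge_atTop (4 ^ k)] with N hN
    exact Nat.le_log_of_pow_le (by norm_num) hN
  have hlim := (tendsto_mul_pow_mul_pow (r * m + 2) 4 3 (b := 4 / 5)
    (by rw [abs_lt]; norm_num)).add
    (tendsto_mul_pow_mul_pow (r * m + 2) 16384 12 (b := 3 / 10) (by rw [abs_lt]; norm_num))
  rw [add_zero] at hlim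
  have hev : ∀ᶠ J : ℕ in atTop, 32 * (((r * m + 2) * J) ^ 3) ≤ 4 ^ J := by
    filter_upwards [(tendsto_mul_pow_mul_pow (r * m + 2) 32 3 (b := 1 / 4)
      (by rw [abs_lt]; norm_num)).eventually_lt_const one_pos] with J hJ
    rw [one_div, inv_pow, ← div_eq_mul_inv, div_lt_one (by positivity)] at hJ
    exact_mod_cast hJ.le
  refine squeeze_zero' (Eventually.of_forall fun N => by positivity) ?_ (hlim.comp hlog)
  filter_upwards [hlog.eventually hev, eventually_ge_atTop 1] with N hN hN1
  refine card_restNormR_div_le hr (by positivity) hg hg1 hg2 (Nat.le_succ _) (Nat.le_add_left 1 _)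
    (Nat.le_add_left 1 _) (Nat.lt_pow_succ_log_self (by norm_num) N).le ?_ hN
  rw [pow_succ, mul_comm]
  exact Nat.mul_le_mul_left 4 (Nat.pow_log_le_self 4 (by omega))

end

/-- **Friedman's theorem** (permutation model of random regular graphs). -/
theorem friedman (r : ℕ) (hr : 1 ≤ r) (ε : ℝ) (hε : 0 < ε) :
    Tendsto
      (fun N =>
        (Nat.card {σ : Fin r → Equiv.Perm (Fin N) //
            ε < |restNormR (∑ k : Fin r, (permMatR (σ k) + (permMatR (σ k)).transpose)) -
                  2 * Real.sqrt (2 * r - 1)|} : ℝ) /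
          (Nat.card (Fin r → Equiv.Perm (Fin N)) : ℝ))
      atTop (nhds 0) := by
  classical
  refine squeeze_zero' (Eventually.of_forall fun N => by positivity) ?_
    (tendsto_card_lt_restNormR hr hε)
  filter_upwards [eventually_le_restNormR hr hε] with N hN
  rw [Nat.card_eq_fintype_card, Nat.card_eq_fintype_card, card_fin_perm, Fintype.card_subtype]
  refine div_le_div_of_nonneg_right (Nat.cast_le.2 (Finset.card_le_card fun σ hσ => ?_))
    (by positivity)
  rw [Finset.mem_filter] at hσ ⊢
  refine ⟨hσ.1, ?_⟩
  have hlow := hN σ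
  rcases lt_abs.1 hσ.2 with h | h
  · exact lt_sub_iff_add_lt'.1 h
  · exact absurd hlow (not_le.2 (by
      change restNormR (schreierAdj σ) < _
      have h' : ε < -(restNormR (schreierAdj σ) - 2 * √(2 * r - 1 : ℝ)) := h
      linarith))
end
end
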